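/- There exists an aperiodic Wang tile set consisting of exactly 11 tiles (Jeandel–Rao). -/

import Mathlib

/-- A Wang tile: the colours of its (west, south, east, north) edges. -/
abbrev WangTile : Type := ℕ × ℕ × ℕ × ℕ

def WangTile.west (t : WangTile) : ℕ := t.1
def WangTile.south (t : WangTile) : ℕ := t.2.1
def WangTile.east (t : WangTile) : ℕ := t.2.2.1
def WangTile.north (t : WangTile) : ℕ := t.2.2.2

/-- The Wang matching conditions for a configuration of tiles on `ℤ × ℤ`. -/
def WangMatch (f : ℤ × ℤ → WangTile) : Prop :=
  ∀ x y : ℤ,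
    (f (x, y)).east = (f (x + 1, y)).west ∧ (f (x, y)).north = (f (x, y + 1)).south

/-- A tiling of the plane by the Wang tile set `S`. -/
def IsWangTiling (S : Finset WangTile) (f : ℤ × ℤ → WangTile) : Prop :=
  (∀ p, f p ∈ S) ∧ WangMatch f

/-- A configuration is periodic if it is invariant under some nonzero translation. -/
def WangPeriodic (f : ℤ × ℤ → WangTile) : Prop :=
  ∃ v : ℤ × ℤ, v ≠ 0 ∧ ∀ p, f (p + v) = f p

/-- A Wang tile set is aperiodic if it admits a tiling of the plane and every tiling
of the plane by it is nonperiodic. -/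
def WangAperiodic (S : Finset WangTile) : Prop :=
  (∃ f, IsWangTiling S f) ∧ ∀ f, IsWangTiling S f → ¬ WangPeriodic f

namespace JR

/-- The five kinds of blocks of a level strip. -/
inductive Blk : Type
  | us | ul | ds | dl | c
  deriving DecidableEq

open Blk

def Blk.len (a b : ℤ) : Blk → ℤ
  | us => a
  | ul => b
  | ds => a
  | dl => b
  | c => 2 * a

def Blk.flip : Blk → Blk
  | us => ds
  | ul => dl
  | ds => us
  | dl => ul
  | c => c

theorem Blk.len_flip (a b : ℤ) (β : Blk) : β.flip.len a b = β.len a b := by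
  cases β <;> rfl

theorem Blk.flip_flip (β : Blk) : β.flip.flip = β := by
  cases β <;> rfl

/-- A bi-infinite concatenation of blocks; `B β x` means that a block `β` starts at `x`. -/
structure Row (a b : ℤ) (B : Blk → ℤ → Prop) : Prop where
  next : ∀ {β x}, B β x → ∃ β', B β' (x + β.len a b)
  prev : ∀ {β x}, B β x → ∃ β', B β' (x - β'.len a b)
  sep : ∀ {β x β' y}, B β x → B β' y →
    (x = y ∧ β = β') ∨ x + β.len a b ≤ y ∨ y + β'.len a b ≤ x
  ne : ∃ β x, B β x

def rev (a b : ℤ) (B : Blk → ℤ → Prop) : Blk → ℤ → Prop :=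
  fun β x => B β.flip (- x - β.len a b)

theorem mv {B : Blk → ℤ → Prop} {β : Blk} {x y : ℤ} (h : B β x) (e : x = y) : B β y := e ▸ h

theorem Row.rev {a b : ℤ} {B : Blk → ℤ → Prop} (h : Row a b B) : Row a b (rev a b B) where
  next := by
    intro β x hx
    obtain ⟨β', h'⟩ := h.prev hx
    refine ⟨β'.flip, ?_⟩
    unfold JR.rev
    rw [Blk.flip_flip, Blk.len_flip]
    exact mv h' (by ring)
  prev := by
    intro β x hx
    obtain ⟨β', h'⟩ := h.next hx
    refine ⟨β'.flip, ?_⟩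
    unfold JR.rev
    rw [Blk.flip_flip, Blk.len_flip]
    rw [Blk.len_flip] at h'
    exact mv h' (by ring)
  sep := by
    intro β x β' y hx hy
    have := h.sep hx hy
    rw [Blk.len_flip, Blk.len_flip] at this
    rcases this with ⟨h1, h2⟩ | h1 | h1
    · left
      have : β = β' := by rw [← Blk.flip_flip β, h2, Blk.flip_flip]
      subst this
      exact ⟨by omega, rfl⟩
    · right; right; omega
    · right; left; omega
  ne := by
    obtain ⟨β, x, hx⟩ := h.ne
    refine ⟨β.flip, -x - β.len a b, ?_⟩
    unfold JR.rev
    rw [Blk.flip_flip, Blk.len_flip]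
    exact mv hx (by ring)

theorem Row.clash {a b : ℤ} {B : Blk → ℤ → Prop} (h : Row a b B) {β β' : Blk} {x y : ℤ}
    (h1 : B β x) (h2 : B β' y) (hne : β ≠ β' ∨ x ≠ y) (hx : x < y + β'.len a b)
    (hy : y < x + β.len a b) : False := by
  rcases h.sep h1 h2 with ⟨e, e'⟩ | e | e
  · rcases hne with n | n
    · exact n e'
    · exact n e
  · omega
  · omega

/-- Three consecutive strips of sizes `(b, a+b)`, `(a, b)`, `(b, a+b)`, in normalised coordinates. -/
structure Trip (a b : ℤ) (L M U : Blk → ℤ → Prop) : Prop where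
  hL : Row b (a + b) L
  hM : Row a b M
  hU : Row b (a + b) U
  i1 : 0 < a
  i2 : 3 * a < 2 * b
  i3 : 3 * b < 5 * a
  l1 : ∀ y, (L us (y - b) ∨ L c (y + a - 2 * b)) ↔ (M ds y ∨ M c (y - (b - a)))
  l2 : ∀ y, L ul (y - (a + b)) ↔ M dl y
  u1 : ∀ y, (M us (y - a) ∨ M c (y + (b - a) - 2 * a)) ↔ (U ds y ∨ U c (y - a))
  u2 : ∀ y, M ul (y - b) ↔ U dl y

theorem Trip.rev {a b : ℤ} {L M U : Blk → ℤ → Prop} (h : Trip a b L M U) :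
    Trip a b (rev b (a + b) U) (JR.rev a b M) (JR.rev b (a + b) L) where
  hL := h.hU.rev
  hM := h.hM.rev
  hU := h.hL.rev
  i1 := h.i1
  i2 := h.i2
  i3 := h.i3
  l1 := by
    intro y
    have := h.u1 (-y)
    simp only [JR.rev, Blk.flip, Blk.len]
    rw [show -(y - b) - b = -y by ring, show -(y + a - 2 * b) - 2 * b = -y - a by ring,
      show -(y - (b - a)) - 2 * a = -y + (b - a) - 2 * a by ring]
    exact this.symm
  l2 := by
    intro y
    have := h.u2 (-y)
    simp only [JR.rev, Blk.flip, Blk.len]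
    rw [show -(y - (a + b)) - (a + b) = -y by ring]
    exact this.symm
  u1 := by
    intro y
    have := h.l1 (-y)
    simp only [JR.rev, Blk.flip, Blk.len]
    rw [show -(y - a) - a = -y by ring, show -(y - a) - 2 * b = -y + a - 2 * b by ring,
      show -(y + (b - a) - 2 * a) - 2 * a = -y - (b - a) by ring]
    exact this.symm
  u2 := by
    intro y
    have := h.l2 (-y)
    simp only [JR.rev, Blk.flip, Blk.len]
    rw [show -(y - b) - b = -y by ring, ← this]

variable {a b : ℤ} {L M U : Blk → ℤ → Prop}

/-- A mark on the lower interface, of type `t` (`true` = large). -/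
def Dm (a b : ℤ) (M : Blk → ℤ → Prop) : Bool → ℤ → Prop
  | false, y => M ds y ∨ M c (y - (b - a))
  | true, y => M dl y

/-- Relation of marks after a block start of the lower strip. -/
theorem Trip.dsep (h : Trip a b L M U) {β : Blk} {y z : ℤ} {t : Bool} (hb : L β y)
    (hz : Dm a b M t z) (hyz : y < z) :
    (β = us ∧ z = y + b ∧ t = false) ∨ (β = ul ∧ z = y + a + b ∧ t = true) ∨
    (β = c ∧ z = y + 2 * b - a ∧ t = false) ∨ y + β.len b (a + b) < z := by
  have i1 := h.i1; have i2 := h.i2; have i3 := h.i3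
  cases t with
  | true =>
    have h1 := (h.l2 z).2 hz
    rcases h.hL.sep hb h1 with ⟨e, e'⟩ | e | e
    · subst e'; right; left; exact ⟨rfl, by omega, rfl⟩
    · right; right; right; omega
    · simp only [Blk.len] at e; omega
  | false =>
    rcases (h.l1 z).2 hz with h1 | h1
    · rcases h.hL.sep hb h1 with ⟨e, e'⟩ | e | e
      · subst e'; left; exact ⟨rfl, by omega, rfl⟩
      · right; right; right; omega
      · simp only [Blk.len] at e; omega
    · rcases h.hL.sep hb h1 with ⟨e, e'⟩ | e | e
      · subst e'; right; right; left; exact ⟨rfl, by omega, rfl⟩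
      · right; right; right; omega
      · simp only [Blk.len] at e; omega

theorem Trip.lgap (h : Trip a b L M U) {y z : ℤ} {t : Bool} (hs : ∃ β, L β y)
    (hz : Dm a b M t z) (hyz : y < z) (hno : ∀ t' w, y < w → w < z → ¬ Dm a b M t' w)
    (hd : z ≤ y + a + 2 * b) :
    (z = y + b ∧ t = false ∧ L us y) ∨ (z = y + a + b ∧ t = true ∧ L ul y) ∨
    (z = y + 2 * b - a ∧ t = false ∧ L c y) ∨
    (z = y + 2 * b ∧ t = false ∧ L ds y ∧ L us (y + b)) ∨
    (z = y + a + 2 * b ∧ t = true ∧ L ds y ∧ L ul (y + b)) ∨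
    (z = y + 3 * b - a ∧ t = false ∧ L ds y ∧ L c (y + b)) ∨
    (z = y + a + 2 * b ∧ t = false ∧ L dl y ∧ L us (y + a + b)) := by
  have i1 := h.i1; have i2 := h.i2; have i3 := h.i3
  have kus : ∀ w, L us w → Dm a b M false (w + b) := fun w hw =>
    (h.l1 (w + b)).1 (Or.inl (mv hw (by ring)))
  have kc : ∀ w, L c w → Dm a b M false (w + 2 * b - a) := fun w hw =>
    (h.l1 _).1 (Or.inr (mv hw (by ring)))
  have kul : ∀ w, L ul w → Dm a b M true (w + a + b) := fun w hw =>
    (h.l2 _).1 (mv hw (by ring))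
  obtain ⟨β, hβ⟩ := hs
  have H := h.dsep hβ hz hyz
  obtain ⟨β', hβ'⟩ := h.hL.next hβ
  cases β <;> simp only [Blk.len, reduceCtorEq, false_and, true_and, false_or] at H hβ'
  · rcases H with H | H
    · exact Or.inl ⟨H.1, H.2, hβ⟩
    · exact absurd (kus _ hβ) (hno _ _ (by omega) (by omega))
  · rcases H with H | H
    · exact Or.inr (Or.inl ⟨H.1, H.2, hβ⟩)
    · exact absurd (kul _ hβ) (hno _ _ (by omega) (by omega))
  · have H' := h.dsep hβ' hz H
    obtain ⟨β'', hβ''⟩ := h.hL.next hβ'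
    cases β' <;> simp only [Blk.len, reduceCtorEq, false_and, true_and, false_or] at H' hβ''
    · rcases H' with H' | H'
      · exact Or.inr (Or.inr (Or.inr (Or.inl ⟨by omega, H'.2, hβ, hβ'⟩)))
      · exact absurd (kus _ hβ') (hno _ _ (by omega) (by omega))
    · rcases H' with H' | H'
      · exact Or.inr (Or.inr (Or.inr (Or.inr (Or.inl ⟨by omega, H'.2, hβ, hβ'⟩))))
      · exact absurd (kul _ hβ') (hno _ _ (by omega) (by omega))
    · have H'' := h.dsep hβ'' hz H'
      cases β'' <;> simp only [Blk.len, reduceCtorEq, false_and, true_and, false_or] at H'' <;> omega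
    · omega
    · rcases H' with H' | H'
      · exact Or.inr (Or.inr (Or.inr (Or.inr (Or.inr (Or.inl ⟨by omega, H'.2, hβ, hβ'⟩)))))
      · exact absurd (kc _ hβ') (hno _ _ (by omega) (by omega))
  · have H' := h.dsep hβ' hz H
    cases β' <;> simp only [Blk.len, reduceCtorEq, false_and, true_and, false_or] at H'
    · rcases H' with H' | H'
      · exact Or.inr (Or.inr (Or.inr (Or.inr (Or.inr (Or.inr ⟨by omega, H'.2, hβ, mv hβ' (by ring)⟩)))))
      · omega
    all_goals omega
  · rcases H with H | H
    · exact Or.inr (Or.inr (Or.inl ⟨H.1, H.2, hβ⟩))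
    · exact absurd (kc _ hβ) (hno _ _ (by omega) (by omega))

end JR

namespace JR
open Blk
variable {a b : ℤ} {L M U : Blk → ℤ → Prop}

theorem Trip.dcell (h : Trip a b L M U) {β : Blk} {p w : ℤ} {t : Bool} (hb : M β p)
    (hw : Dm a b M t w) (h1 : p ≤ w) (h2 : w < p + β.len a b) :
    (β = ds ∧ t = false ∧ w = p) ∨ (β = dl ∧ t = true ∧ w = p) ∨
    (β = c ∧ t = false ∧ w = p + (b - a)) := by
  have i1 := h.i1; have i2 := h.i2; have i3 := h.i3
  cases t with
  | true =>
    rcases h.hM.sep hb hw with ⟨e, e'⟩ | e | e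
    · exact Or.inr (Or.inl ⟨e', rfl, e.symm⟩)
    · omega
    · simp only [Blk.len] at e; omega
  | false =>
    rcases hw with hw | hw
    · rcases h.hM.sep hb hw with ⟨e, e'⟩ | e | e
      · exact Or.inl ⟨e', rfl, e.symm⟩
      · omega
      · simp only [Blk.len] at e; omega
    · rcases h.hM.sep hb hw with ⟨e, e'⟩ | e | e
      · exact Or.inr (Or.inr ⟨e', rfl, by omega⟩)
      · omega
      · simp only [Blk.len] at e; omega

theorem Trip.dm_c (_ : Trip a b L M U) {p : ℤ} (h : M c p) : Dm a b M false (p + (b - a)) :=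
  Or.inr (mv h (by ring))

theorem Trip.gap2 (h : Trip a b L M U) {y z : ℤ} {t0 t : Bool} (hy : Dm a b M t0 y)
    (hz : Dm a b M t z) (hyz : y < z) (hno : ∀ t' w, y < w → w < z → ¬ Dm a b M t' w)
    (hd : z ≤ y + a + 2 * b) :
    ∃ s, (s = y ∨ (s = y + a ∧ t0 = false ∧ L c (y + a - 2 * b))) ∧
    ((z = s + b ∧ t = false ∧ L us s) ∨ (z = s + a + b ∧ t = true ∧ L ul s) ∨
    (z = s + 2 * b - a ∧ t = false ∧ L c s) ∨
    (z = s + 2 * b ∧ t = false ∧ L ds s ∧ L us (s + b)) ∨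
    (z = s + a + 2 * b ∧ t = true ∧ L ds s ∧ L ul (s + b)) ∨
    (z = s + 3 * b - a ∧ t = false ∧ L ds s ∧ L c (s + b)) ∨
    (z = s + a + 2 * b ∧ t = false ∧ L dl s ∧ L us (s + a + b))) := by
  have i1 := h.i1; have i2 := h.i2; have i3 := h.i3
  cases t0 with
  | true =>
    have h1 := (h.l2 y).2 hy
    obtain ⟨β, hβ⟩ := h.hL.next h1
    exact ⟨y, Or.inl rfl, h.lgap ⟨β, mv hβ (by simp only [Blk.len]; ring)⟩ hz hyz hno hd⟩
  | false =>
    rcases (h.l1 y).2 hy with h1 | h1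
    · obtain ⟨β, hβ⟩ := h.hL.next h1
      exact ⟨y, Or.inl rfl, h.lgap ⟨β, mv hβ (by simp only [Blk.len]; ring)⟩ hz hyz hno hd⟩
    · obtain ⟨β, hβ⟩ := h.hL.next h1
      have H := h.dsep h1 hz (by omega)
      simp only [reduceCtorEq, false_and, true_and, false_or, Blk.len] at H
      exact ⟨y + a, Or.inr ⟨rfl, rfl, h1⟩, h.lgap ⟨β, mv hβ (by simp only [Blk.len]; ring)⟩ hz
        (by omega) (fun t' w e1 e2 => hno t' w (by omega) e2) (by omega)⟩

/-- a down block, as a mark -/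
def dk : Bool → Blk
  | false => ds
  | true => dl

theorem dk_dm {t : Bool} {y : ℤ} (h : M (dk t) y) : Dm a b M t y := by
  cases t
  · exact Or.inl h
  · exact h

def ll (a b : ℤ) : Bool → ℤ
  | false => a
  | true => b

theorem dk_len (t : Bool) : (dk t).len a b = ll a b t := by cases t <;> rfl

theorem Trip.nofirst (h : Trip a b L M U) {t t' : Bool} {y w : ℤ} (hy : M (dk t) y)
    (hw : Dm a b M t' w) (h1 : y < w) : y + ll a b t ≤ w := by
  by_contra hc
  have := h.dcell hy hw h1.le (by rw [dk_len]; omega)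
  cases t <;> simp [dk] at this <;> omega

theorem Trip.noc1 (h : Trip a b L M U) {t' : Bool} {y w : ℤ} (hy : M c y)
    (hw : Dm a b M t' w) (h1 : y + (b - a) < w) : y + 2 * a ≤ w := by
  have i1 := h.i1; have i2 := h.i2; have i3 := h.i3
  by_contra hc
  have := h.dcell hy hw (by omega) (by simp only [Blk.len]; omega)
  simp at this; omega

def uk : Bool → Blk
  | false => us
  | true => ul

theorem uk_len (t : Bool) : (uk t).len a b = ll a b t := by cases t <;> rfl

theorem Trip.noup (h : Trip a b L M U) {t t' : Bool} {y w : ℤ} (hy : M (uk t) y)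
    (hw : Dm a b M t' w) (h1 : y ≤ w) : y + ll a b t ≤ w := by
  by_contra hc
  have := h.dcell hy hw h1 (by rw [uk_len]; omega)
  cases t <;> simp [uk] at this

theorem ll_cases (a b : ℤ) (t : Bool) : (t = false ∧ ll a b t = a) ∨ (t = true ∧ ll a b t = b) := by
  cases t <;> simp [ll]

/-- adjacent down blocks -/
theorem Trip.s1 (h : Trip a b L M U) {t t' : Bool} {y : ℤ} (h1 : M (dk t) y)
    (h2 : M (dk t') (y + ll a b t)) : t = true ∧ t' = false ∧ L us y := by
  have i1 := h.i1; have i2 := h.i2; have i3 := h.i3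
  have e1 := ll_cases a b t
  obtain ⟨s, hs, H⟩ := h.gap2 (dk_dm h1) (dk_dm h2) (by omega)
    (fun t' w e1 e2 hw => by have := h.nofirst h1 hw e1; omega) (by omega)
  rcases hs with rfl | ⟨rfl, rfl, -⟩
  · rcases H with H | H | H | H | H | H | H
    · exact ⟨by rcases e1 with e | e; omega; exact e.1, H.2.1, H.2.2⟩
    all_goals omega
  · simp only [ll] at H
    omega

theorem Trip.s2 (h : Trip a b L M U) {t : Bool} {y : ℤ} (h1 : M c y)
    (h2 : M (dk t) (y + 2 * a)) : False := by
  have i1 := h.i1; have i2 := h.i2; have i3 := h.i3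
  obtain ⟨s, hs, H⟩ := h.gap2 (h.dm_c h1) (dk_dm h2) (by omega)
    (fun t' w e1 e2 hw => by have := h.noc1 h1 hw e1; omega) (by omega)
  rcases hs with rfl | ⟨rfl, -, -⟩ <;> omega

theorem Trip.s2c (h : Trip a b L M U) {y : ℤ} (h1 : M c y)
    (h2 : M c (y + 2 * a)) : False := by
  have i1 := h.i1; have i2 := h.i2; have i3 := h.i3
  obtain ⟨s, hs, H⟩ := h.gap2 (h.dm_c h1) (h.dm_c h2) (by omega)
    (fun t' w e1 e2 hw => by
      have := h.noc1 h1 hw e1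
      have := h.dcell h2 hw (by omega) (by simp only [Blk.len]; omega)
      simp at this; omega) (by omega)
  rcases hs with rfl | ⟨rfl, -, -⟩ <;> omega

theorem rev_uk {t : Bool} {x : ℤ} : JR.rev a b M (uk t) x ↔ M (dk t) (-x - ll a b t) := by
  cases t <;> rfl

theorem rev_dk {t : Bool} {x : ℤ} : JR.rev a b M (dk t) x ↔ M (uk t) (-x - ll a b t) := by
  cases t <;> rfl

theorem rev_c {x : ℤ} : JR.rev a b M c x ↔ M c (-x - 2 * a) := Iff.rfl

/-- adjacent up blocks -/
theorem Trip.s1' (h : Trip a b L M U) {t t' : Bool} {y : ℤ} (h1 : M (uk t) y)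
    (h2 : M (uk t') (y + ll a b t)) : t = false ∧ t' = true ∧ U ds (y + ll a b t) := by
  obtain ⟨e1, e2, e3⟩ := h.rev.s1 (t := t') (t' := t) (y := - (y + ll a b t) - ll a b t')
    (rev_dk.2 (mv h2 (by ring))) (rev_dk.2 (mv h1 (by ring)))
  refine ⟨e2, e1, mv e3 ?_⟩
  subst e1 e2
  simp only [ll, Blk.len]; ring

theorem Trip.s2' (h : Trip a b L M U) {t : Bool} {y : ℤ} (h1 : M (uk t) y)
    (h2 : M c (y + ll a b t)) : False :=
  h.rev.s2 (t := t) (y := - (y + ll a b t) - 2 * a)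
    (rev_c.2 (mv h2 (by ring))) (rev_dk.2 (mv h1 (by ring)))

theorem blk_cases (β : Blk) : (∃ t, β = uk t) ∨ (∃ t, β = dk t) ∨ β = c := by
  cases β
  · exact Or.inl ⟨false, rfl⟩
  · exact Or.inl ⟨true, rfl⟩
  · exact Or.inr (Or.inl ⟨false, rfl⟩)
  · exact Or.inr (Or.inl ⟨true, rfl⟩)
  · exact Or.inr (Or.inr rfl)

/-- After an up block: down block, or (for `us`) `ul` then a down block. -/
theorem Trip.afterU (h : Trip a b L M U) {t : Bool} {y : ℤ} (h1 : M (uk t) y) :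
    (∃ t', M (dk t') (y + ll a b t)) ∨
    (t = false ∧ M ul (y + a) ∧ ∃ t', M (dk t') (y + a + b)) := by
  obtain ⟨β, hβ⟩ := h.hM.next h1
  rw [uk_len] at hβ
  rcases blk_cases β with ⟨t', rfl⟩ | ⟨t', rfl⟩ | rfl
  · right
    obtain ⟨rfl, rfl, -⟩ := h.s1' h1 hβ
    refine ⟨rfl, hβ, ?_⟩
    obtain ⟨β, hγ⟩ := h.hM.next hβ
    rw [uk_len] at hγ
    rcases blk_cases β with ⟨t', rfl⟩ | ⟨t', rfl⟩ | rfl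
    · have := h.s1' hβ hγ; simp at this
    · exact ⟨t', hγ⟩
    · exact (h.s2' hβ hγ).elim
  · exact Or.inl ⟨t', hβ⟩
  · exact (h.s2' h1 hβ).elim

theorem Trip.noCM (h : Trip a b L M U) {y : ℤ} (h1 : M c y) : False := by
  have i1 := h.i1; have i2 := h.i2; have i3 := h.i3
  obtain ⟨β, hβ⟩ := h.hM.next h1
  simp only [Blk.len] at hβ
  rcases blk_cases β with ⟨t', rfl⟩ | ⟨t', rfl⟩ | rfl
  · have et := ll_cases a b t'
    rcases h.afterU hβ with ⟨t'', h3⟩ | ⟨rfl, h2, t'', h3⟩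
    · obtain ⟨s, hs, H⟩ := h.gap2 (h.dm_c h1) (dk_dm h3) (by omega)
        (fun t' w e1 e2 hw => by
          have := h.noc1 h1 hw e1
          have := h.noup hβ hw this
          omega) (by omega)
      rcases hs with rfl | ⟨rfl, -, -⟩ <;> omega
    · obtain ⟨s, hs, H⟩ := h.gap2 (h.dm_c h1) (dk_dm h3) (by omega)
        (fun t' w e1 e2 hw => by
          have := h.noc1 h1 hw e1
          have := h.noup hβ hw this
          have := h.noup (t := true) h2 hw this
          simp only [ll] at this
          omega) (by omega)
      rcases hs with rfl | ⟨rfl, -, -⟩ <;> omega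
  · exact h.s2 h1 hβ
  · exact h.s2c h1 hβ

/-- Before a down block: down, or (down, up), or (down, us, ul). -/
theorem Trip.beforeD (h : Trip a b L M U) {t : Bool} {z : ℤ} (h1 : M (dk t) z) :
    ∃ t', (M (dk t') (z - ll a b t')) ∨
    (∃ t'', M (dk t') (z - ll a b t'' - ll a b t') ∧ M (uk t'') (z - ll a b t'')) ∨
    (M (dk t') (z - b - a - ll a b t') ∧ M us (z - b - a) ∧ M ul (z - b)) := by
  obtain ⟨β, hβ⟩ := h.hM.prev h1
  rcases blk_cases β with ⟨t', rfl⟩ | ⟨t', rfl⟩ | rfl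
  · rw [uk_len] at hβ
    obtain ⟨γ, hγ⟩ := h.hM.prev hβ
    rcases blk_cases γ with ⟨t2, rfl⟩ | ⟨t2, rfl⟩ | rfl
    · rw [uk_len] at hγ
      obtain ⟨rfl, rfl, -⟩ := h.s1' hγ (mv hβ (by ring))
      obtain ⟨δ, hδ⟩ := h.hM.prev hγ
      rcases blk_cases δ with ⟨t3, rfl⟩ | ⟨t3, rfl⟩ | rfl
      · rw [uk_len] at hδ
        have := h.s1' hδ (mv hγ (by ring)); simp at this
      · rw [dk_len] at hδ
        exact ⟨t3, Or.inr (Or.inr ⟨hδ, hγ, hβ⟩)⟩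
      · exact (h.noCM hδ).elim
    · rw [dk_len] at hγ
      exact ⟨t2, Or.inr (Or.inl ⟨t', hγ, hβ⟩)⟩
    · exact (h.noCM hγ).elim
  · rw [dk_len] at hβ
    exact ⟨t', Or.inl hβ⟩
  · exact (h.noCM hβ).elim

theorem Trip.noCL (h : Trip a b L M U) {w : ℤ} (h1 : L c w) : False := by
  have i1 := h.i1; have i2 := h.i2; have i3 := h.i3
  have hz : M (dk false) (w + 2 * b - a) := by
    rcases (h.l1 (w + 2 * b - a)).1 (Or.inr (mv h1 (by ring))) with h2 | h2
    · exact h2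
    · exact (h.noCM h2).elim
  have key : ∀ s, ((w + 2 * b - a = s + b ∧ false = false ∧ L us s) ∨ (w + 2 * b - a = s + a + b ∧ false = true ∧ L ul s) ∨
    (w + 2 * b - a = s + 2 * b - a ∧ false = false ∧ L c s) ∨
    (w + 2 * b - a = s + 2 * b ∧ false = false ∧ L ds s ∧ L us (s + b)) ∨
    (w + 2 * b - a = s + a + 2 * b ∧ false = true ∧ L ds s ∧ L ul (s + b)) ∨
    (w + 2 * b - a = s + 3 * b - a ∧ false = false ∧ L ds s ∧ L c (s + b)) ∨
    (w + 2 * b - a = s + a + 2 * b ∧ false = false ∧ L dl s ∧ L us (s + a + b))) →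
      s = w ∨ s = w - b := by
    intro s H
    have cl : ∀ v, L us v → v = w + b - a → False := fun v hv e =>
      h.hL.clash hv h1 (Or.inl (by simp)) (by simp only [Blk.len]; omega)
        (by simp only [Blk.len]; omega)
    rcases H with H | H | H | H | H | H | H
    · exact (cl _ H.2.2 (by omega)).elim
    · simp at H
    · left; omega
    · exact (cl _ H.2.2.2 (by omega)).elim
    · simp at H
    · right; omega
    · exact (cl _ H.2.2.2 (by omega)).elim
  obtain ⟨t', H⟩ := h.beforeD hz
  have et := ll_cases a b t'
  rcases H with H | ⟨t2, H, H2⟩ | ⟨H, H2, H3⟩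
  · obtain ⟨s, hs, K⟩ := h.gap2 (dk_dm H) (dk_dm hz) (by omega)
      (fun t' w e1 e2 hw => by have := h.nofirst H hw e1; omega) (by omega)
    have := key s K
    rcases hs with rfl | ⟨rfl, rfl, -⟩ <;> (try simp at et) <;> omega
  · have et2 := ll_cases a b t2
    obtain ⟨s, hs, K⟩ := h.gap2 (dk_dm H) (dk_dm hz) (by omega)
      (fun t' w e1 e2 hw => by
        have := h.nofirst H hw e1
        have := h.noup H2 hw (by omega); omega) (by omega)
    have := key s K
    rcases hs with rfl | ⟨rfl, rfl, -⟩ <;> (try simp at et) <;> omega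
  · obtain ⟨s, hs, K⟩ := h.gap2 (dk_dm H) (dk_dm hz) (by omega)
      (fun t' w e1 e2 hw => by
        have := h.nofirst H hw e1
        have := h.noup (t := false) H2 hw (by omega)
        have := h.noup (t := true) H3 hw (by simp only [ll] at this; omega)
        simp only [ll] at this
        omega) (by omega)
    have := key s K
    rcases hs with rfl | ⟨rfl, rfl, -⟩ <;> (try simp at et) <;> omega

theorem Trip.noCU (h : Trip a b L M U) {w : ℤ} (h1 : U c w) : False :=
  h.rev.noCL (w := -w - 2 * b) (rev_c.2 (mv h1 (by ring)))

end JR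

namespace JR
open Blk
variable {a b : ℤ} {L M U : Blk → ℤ → Prop}

theorem cover_up {P : ℤ → Prop} {Q : ℤ → ℤ → Prop}
    (nx : ∀ x, P x → ∃ y, x < y ∧ P y ∧ Q x y) (w : ℤ) :
    ∀ (n : ℕ) (x : ℤ), P x → x ≤ w → w - x ≤ n → ∃ x y, P x ∧ P y ∧ Q x y ∧ x ≤ w ∧ w < y := by
  intro n
  induction n with
  | zero =>
    intro x hx h1 h2
    obtain ⟨y, hy, hP, hQ⟩ := nx x hx
    exact ⟨x, y, hx, hP, hQ, h1, by push_cast at h2; omega⟩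
  | succ n ih =>
    intro x hx h1 h2
    obtain ⟨y, hy, hP, hQ⟩ := nx x hx
    by_cases hw : w < y
    · exact ⟨x, y, hx, hP, hQ, h1, hw⟩
    · exact ih y hP (by omega) (by push_cast at h2; omega)

theorem cover_dn {P : ℤ → Prop} (pv : ∀ x, P x → ∃ y, y < x ∧ P y) (w : ℤ) :
    ∀ (n : ℕ) (x : ℤ), P x → x - w ≤ n → ∃ x, P x ∧ x ≤ w := by
  intro n
  induction n with
  | zero => intro x hx h; exact ⟨x, hx, by push_cast at h; omega⟩
  | succ n ih =>
    intro x hx h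
    obtain ⟨y, hy, hP⟩ := pv x hx
    exact ih y hP (by push_cast at h; omega)

theorem cover {P : ℤ → Prop} {Q : ℤ → ℤ → Prop} (ne : ∃ x, P x)
    (nx : ∀ x, P x → ∃ y, x < y ∧ P y ∧ Q x y) (pv : ∀ x, P x → ∃ y, y < x ∧ P y) (w : ℤ) :
    ∃ x y, P x ∧ P y ∧ Q x y ∧ x ≤ w ∧ w < y := by
  obtain ⟨x, hx⟩ := ne
  obtain ⟨y, hy, hw⟩ := cover_dn pv w (x - w).toNat x hx (by omega)
  exact cover_up nx w (w - y).toNat y hy hw (by omega)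

theorem Row.uniq {B : Blk → ℤ → Prop} (h : Row a b B) (i1 : 0 < a) (i2 : 0 < b) {β β' : Blk} {x y : ℤ}
    (h1 : B β x) (h2 : B β' y) (e : x = y) : β = β' := by
  by_contra hn
  have p1 : 0 < β.len a b := by cases β <;> simp only [Blk.len] <;> omega
  have p2 : 0 < β'.len a b := by cases β' <;> simp only [Blk.len] <;> omega
  exact h.clash h1 h2 (Or.inl hn) (by omega) (by omega)

/-- Transitions between consecutive down blocks. -/
def DT (a b : ℤ) (L M : Blk → ℤ → Prop) (t : Bool) (y z : ℤ) : Prop :=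
  (t = true ∧ z = y + b ∧ M ds (y + b) ∧ L us y) ∨
  (t = false ∧ z = y + a + b ∧ M ul (y + a) ∧ M dl (y + a + b) ∧ L ul y) ∨
  (t = true ∧ z = y + a + b ∧ M us (y + b) ∧ M dl (y + a + b) ∧ L ul y) ∨
  (t = true ∧ z = y + 2 * b ∧ M ul (y + b) ∧ M ds (y + 2 * b) ∧ L ds y ∧ L us (y + b)) ∨
  (t = true ∧ z = y + a + 2 * b ∧ M us (y + b) ∧ M ul (y + a + b) ∧ M dl (y + a + 2 * b) ∧
    L ds y ∧ L ul (y + b)) ∨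
  (t = true ∧ z = y + a + 2 * b ∧ M us (y + b) ∧ M ul (y + a + b) ∧ M ds (y + a + 2 * b) ∧
    L dl y ∧ L us (y + a + b))

theorem Trip.gap3 (h : Trip a b L M U) {y z : ℤ} {t0 t : Bool} (hy : M (dk t0) y)
    (hz : M (dk t) z) (hyz : y < z) (hno : ∀ t' w, y < w → w < z → ¬ Dm a b M t' w)
    (hd : z ≤ y + a + 2 * b) :
    ((z = y + b ∧ t = false ∧ L us y) ∨ (z = y + a + b ∧ t = true ∧ L ul y) ∨
    (z = y + 2 * b ∧ t = false ∧ L ds y ∧ L us (y + b)) ∨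
    (z = y + a + 2 * b ∧ t = true ∧ L ds y ∧ L ul (y + b)) ∨
    (z = y + a + 2 * b ∧ t = false ∧ L dl y ∧ L us (y + a + b))) := by
  obtain ⟨s, hs, K⟩ := h.gap2 (dk_dm hy) (dk_dm hz) hyz hno hd
  have : s = y := by
    rcases hs with e | ⟨-, -, e⟩
    · exact e
    · exact (h.noCL e).elim
  subst this
  rcases K with K | K | K | K | K | K | K
  · exact Or.inl K
  · exact Or.inr (Or.inl K)
  · exact (h.noCL K.2.2).elim
  · exact Or.inr (Or.inr (Or.inl K))
  · exact Or.inr (Or.inr (Or.inr (Or.inl K)))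
  · exact (h.noCL K.2.2.2).elim
  · exact Or.inr (Or.inr (Or.inr (Or.inr K)))

theorem Trip.dtrans (h : Trip a b L M U) {t : Bool} {y : ℤ} (h1 : M (dk t) y) :
    ∃ z, DT a b L M t y z := by
  have i1 := h.i1; have i2 := h.i2; have i3 := h.i3
  have et := ll_cases a b t
  obtain ⟨β, hβ⟩ := h.hM.next h1
  rw [dk_len] at hβ
  rcases blk_cases β with ⟨t', rfl⟩ | ⟨t', rfl⟩ | rfl
  · have et' := ll_cases a b t'
    rcases h.afterU hβ with ⟨t2, h3⟩ | ⟨rfl, h2, t2, h3⟩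
    · have K := h.gap3 h1 h3 (by omega)
        (fun t' w e1 e2 hw => by
          have := h.nofirst h1 hw e1
          have := h.noup hβ hw this
          omega) (by omega)
      rcases K with ⟨e, -, k⟩ | ⟨e, rfl, k⟩ | ⟨e, rfl, k⟩ | ⟨e, -, k⟩ | ⟨e, -, k⟩
      · omega
      · cases t <;> cases t' <;> simp only [ll] at *
        · omega
        · exact ⟨_, Or.inr (Or.inl ⟨rfl, rfl, hβ, h3, k⟩)⟩
        · exact ⟨_, Or.inr (Or.inr (Or.inl ⟨rfl, rfl, hβ, mv h3 (by ring), k⟩))⟩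
        · omega
      · cases t <;> cases t' <;> simp only [ll] at *
        · omega
        · omega
        · omega
        · exact ⟨_, Or.inr (Or.inr (Or.inr (Or.inl ⟨rfl, rfl, hβ, mv h3 (by ring), k⟩)))⟩
      · omega
      · omega
    · have K := h.gap3 h1 h3 (by omega)
        (fun t' w e1 e2 hw => by
          have := h.nofirst h1 hw e1
          have := h.noup hβ hw this
          have := h.noup (t := true) h2 hw this
          have e0 : ll a b false = a := rfl
          have e1 : ll a b true = b := rfl
          omega) (by omega)
      have : t = true := by
        rcases et with e | e
        · omega
        · exact e.1
      subst this
      simp only [ll] at *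
      rcases K with ⟨e, -, k⟩ | ⟨e, rfl, k⟩ | ⟨e, rfl, k⟩ | ⟨e, rfl, k⟩ | ⟨e, rfl, k⟩
      · omega
      · omega
      · omega
      · exact ⟨_, Or.inr (Or.inr (Or.inr (Or.inr (Or.inl ⟨rfl, rfl, hβ, mv h2 (by ring), mv h3 (by ring), k⟩))))⟩
      · exact ⟨_, Or.inr (Or.inr (Or.inr (Or.inr (Or.inr ⟨rfl, rfl, hβ, mv h2 (by ring), mv h3 (by ring), k⟩))))⟩
  · obtain ⟨rfl, rfl, k⟩ := h.s1 h1 hβ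
    exact ⟨_, Or.inl ⟨rfl, rfl, hβ, k⟩⟩
  · exact (h.noCM hβ).elim

def UT (a b : ℤ) (M U : Blk → ℤ → Prop) (t : Bool) (e : ℤ) : Prop :=
  (t = true ∧ M us (e - b - a) ∧ U ds (e - b)) ∨
  (t = false ∧ M dl (e - a - b) ∧ M ul (e - a - 2 * b) ∧ U dl (e - a - b)) ∨
  (t = true ∧ M ds (e - b - a) ∧ M ul (e - 2 * b - a) ∧ U dl (e - a - b)) ∨
  (t = true ∧ M dl (e - 2 * b) ∧ M us (e - 2 * b - a) ∧ U us (e - b) ∧ U ds (e - 2 * b)) ∨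
  (t = true ∧ M ds (e - b - a) ∧ M dl (e - a - 2 * b) ∧ M ul (e - a - 3 * b) ∧ U us (e - b) ∧
    U dl (e - a - 2 * b)) ∨
  (t = true ∧ M ds (e - b - a) ∧ M dl (e - a - 2 * b) ∧ M us (e - 2 * a - 2 * b) ∧ U ul (e - a - b) ∧
    U ds (e - a - 2 * b))

theorem rmv {B : Blk → ℤ → Prop} {β : Blk} {x y : ℤ} (h : JR.rev a b B β x)
    (e : -x - β.len a b = y) : B β.flip y := e ▸ h

theorem Trip.utrans (h : Trip a b L M U) {t : Bool} {e : ℤ} (h1 : M (uk t) (e - ll a b t)) :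
    UT a b M U t e := by
  obtain ⟨z, H⟩ := h.rev.dtrans (t := t) (y := -e) (rev_dk.2 (mv h1 (by ring)))
  rcases H with ⟨rfl, -, k1, k2⟩ | ⟨rfl, -, k1, k2, k3⟩ | ⟨rfl, -, k1, k2, k3⟩ |
    ⟨rfl, -, k1, k2, k3, k4⟩ | ⟨rfl, -, k1, k2, k3, k4, k5⟩ | ⟨rfl, -, k1, k2, k3, k4, k5⟩
  · exact Or.inl ⟨rfl, rmv k1 (by simp only [Blk.len]; ring), rmv k2 (by simp only [Blk.len]; ring)⟩
  · exact Or.inr (Or.inl ⟨rfl, rmv k1 (by simp only [Blk.len]; ring),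
      rmv k2 (by simp only [Blk.len]; ring), rmv k3 (by simp only [Blk.len]; ring)⟩)
  · exact Or.inr (Or.inr (Or.inl ⟨rfl, rmv k1 (by simp only [Blk.len]; ring),
      rmv k2 (by simp only [Blk.len]; ring), rmv k3 (by simp only [Blk.len]; ring)⟩))
  · exact Or.inr (Or.inr (Or.inr (Or.inl ⟨rfl, rmv k1 (by simp only [Blk.len]; ring),
      rmv k2 (by simp only [Blk.len]; ring), rmv k3 (by simp only [Blk.len]; ring),
      rmv k4 (by simp only [Blk.len]; ring)⟩)))
  · exact Or.inr (Or.inr (Or.inr (Or.inr (Or.inl ⟨rfl, rmv k1 (by simp only [Blk.len]; ring),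
      rmv k2 (by simp only [Blk.len]; ring), rmv k3 (by simp only [Blk.len]; ring),
      rmv k4 (by simp only [Blk.len]; ring), rmv k5 (by simp only [Blk.len]; ring)⟩))))
  · exact Or.inr (Or.inr (Or.inr (Or.inr (Or.inr ⟨rfl, rmv k1 (by simp only [Blk.len]; ring),
      rmv k2 (by simp only [Blk.len]; ring), rmv k3 (by simp only [Blk.len]; ring),
      rmv k4 (by simp only [Blk.len]; ring), rmv k5 (by simp only [Blk.len]; ring)⟩))))

/-- `us` is preceded by `ul dl` -/
theorem Trip.beforeUs (h : Trip a b L M U) {x : ℤ} (h1 : M us x) : M dl (x - b) ∧ M ul (x - 2 * b) := by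
  have H := h.utrans (t := false) (e := x + a) (mv h1 (by simp only [ll]; ring))
  unfold UT at H
  simp at H
  exact ⟨mv H.1 (by ring), mv H.2.1 (by ring)⟩

/-- `ds` is followed by `ul dl` -/
theorem Trip.afterDs (h : Trip a b L M U) {x : ℤ} (h1 : M ds x) : M ul (x + a) ∧ M dl (x + a + b) := by
  obtain ⟨z, H⟩ := h.dtrans (t := false) h1
  unfold DT at H
  simp at H
  exact ⟨H.2.1, H.2.2.1⟩

/-- The derived blocks. -/
def NB (a b : ℤ) (M : Blk → ℤ → Prop) : Blk → ℤ → Prop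
  | us, x => M ul (x - b) ∧ M dl x ∧ M ds (x + b) ∧ M ul (x + a + b) ∧ M dl (x + a + 2 * b)
  | ds, x => M ul (x - b) ∧ M dl x ∧ M us (x + b) ∧ M ul (x + a + b) ∧ M dl (x + a + 2 * b)
  | dl, x => M ul (x - b) ∧ M dl x ∧ M us (x + b) ∧ M ul (x + a + b) ∧ M ds (x + a + 2 * b) ∧
      M ul (x + 2 * a + 2 * b) ∧ M dl (x + 2 * a + 3 * b)
  | ul, x => M ul (x - b) ∧ M dl x ∧ M us (x + b) ∧ M dl (x + a + b) ∧ M ds (x + a + 2 * b) ∧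
      M ul (x + 2 * a + 2 * b) ∧ M dl (x + 2 * a + 3 * b)
  | c, x => M ul (x - b) ∧ M dl x ∧ M us (x + b) ∧ M dl (x + a + b) ∧ M ul (x + a + 2 * b) ∧
      M ds (x + a + 3 * b) ∧ M ul (x + 2 * a + 3 * b) ∧ M dl (x + 2 * a + 4 * b)

theorem Trip.cut (h : Trip a b L M U) {x : ℤ} (h0 : M ul (x - b)) (h1 : M dl x) :
    ∃ β, NB a b M β x := by
  have i1 := h.i1; have i2 := h.i2; have i3 := h.i3
  obtain ⟨z, H⟩ := h.dtrans (t := true) h1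
  rcases H with ⟨-, -, k1, k2⟩ | ⟨k, -⟩ | ⟨-, -, k1, k2, k3⟩ |
    ⟨-, -, k1, k2, k3, k4⟩ | ⟨-, -, k1, k2, k3, k4, k5⟩ | ⟨-, -, k1, k2, k3, k4, k5⟩
  · obtain ⟨m1, m2⟩ := h.afterDs k1
    exact ⟨us, h0, h1, k1, mv m1 (by ring), mv m2 (by ring)⟩
  · simp at k
  · have no : M us (x + a + b + b) → False := fun hu => by
      have := (h.beforeUs hu).2
      exact h.hM.clash this h1 (by simp) (by simp only [Blk.len]; omega) (by simp only [Blk.len]; omega)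
    obtain ⟨z, H⟩ := h.dtrans (t := true) k2
    rcases H with ⟨-, -, m1, m2⟩ | ⟨m, -⟩ | ⟨-, -, m1, m2, m3⟩ |
      ⟨-, -, m1, m2, m3, m4⟩ | ⟨-, -, m1, m2, m3, m4, m5⟩ | ⟨-, -, m1, m2, m3, m4, m5⟩
    · obtain ⟨n1, n2⟩ := h.afterDs m1
      exact ⟨ul, h0, h1, k1, k2, mv m1 (by ring), mv n1 (by ring), mv n2 (by ring)⟩
    · simp at m
    · exact (no m1).elim
    · obtain ⟨n1, n2⟩ := h.afterDs m2
      exact ⟨c, h0, h1, k1, k2, mv m1 (by ring), mv m2 (by ring), mv n1 (by ring), mv n2 (by ring)⟩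
    · exact (no m1).elim
    · exact (no m1).elim
  · exfalso
    have H := h.utrans (t := true) (e := x + 2 * b) (mv k1 (by simp only [ll]; ring))
    have cl : ∀ {β y}, M β y → y = x + b - a → False := fun {β y} hh e => by
      rcases h.hM.sep hh h1 with e' | e' | e'
      · omega
      · have : 0 < β.len a b := by cases β <;> simp only [Blk.len] <;> omega
        omega
      · simp only [Blk.len] at e'; omega
    rcases H with ⟨-, m, -⟩ | ⟨m, -⟩ | ⟨-, m, -⟩ | ⟨-, -, m, -⟩ | ⟨-, m, -⟩ | ⟨-, m, -⟩
    · exact cl m (by ring)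
    · simp at m
    · exact cl m (by ring)
    · exact h.hM.clash m h0 (by simp) (by simp only [Blk.len]; omega) (by simp only [Blk.len]; omega)
    · exact cl m (by ring)
    · exact cl m (by ring)
  · exact ⟨ds, h0, h1, k1, k2, k3⟩
  · obtain ⟨n1, n2⟩ := h.afterDs k3
    exact ⟨dl, h0, h1, k1, k2, k3, mv n1 (by ring), mv n2 (by ring)⟩

theorem NB_cut {β : Blk} {x : ℤ} (h : NB a b M β x) : M ul (x - b) ∧ M dl x := by
  cases β <;> exact ⟨h.1, h.2.1⟩

theorem NB_cut' {β : Blk} {x : ℤ} (h : NB a b M β x) :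
    M ul (x + β.len (a + 2 * b) (2 * a + 3 * b) - b) ∧ M dl (x + β.len (a + 2 * b) (2 * a + 3 * b)) := by
  cases β <;> simp only [Blk.len]
  · exact ⟨mv h.2.2.2.1 (by ring), mv h.2.2.2.2 (by ring)⟩
  · exact ⟨mv h.2.2.2.2.2.1 (by ring), mv h.2.2.2.2.2.2 (by ring)⟩
  · exact ⟨mv h.2.2.2.1 (by ring), mv h.2.2.2.2 (by ring)⟩
  · exact ⟨mv h.2.2.2.2.2.1 (by ring), mv h.2.2.2.2.2.2 (by ring)⟩
  · exact ⟨mv h.2.2.2.2.2.2.1 (by ring), mv h.2.2.2.2.2.2.2 (by ring)⟩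

theorem Trip.exCut (h : Trip a b L M U) : ∃ x, M ul (x - b) ∧ M dl x := by
  have fromDs : ∀ y, M ds y → ∃ x, M ul (x - b) ∧ M dl x := fun y hy =>
    ⟨y + a + b, mv (h.afterDs hy).1 (by ring), (h.afterDs hy).2⟩
  have fromUs : ∀ y, M us y → ∃ x, M ul (x - b) ∧ M dl x := fun y hy =>
    ⟨y - b, mv (h.beforeUs hy).2 (by ring), (h.beforeUs hy).1⟩
  have fromD : ∀ t y, M (dk t) y → ∃ x, M ul (x - b) ∧ M dl x := by
    intro t y hy
    obtain ⟨z, H⟩ := h.dtrans hy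
    rcases H with ⟨-, -, k, -⟩ | ⟨-, -, k1, k2, -⟩ | ⟨-, -, k, -⟩ | ⟨-, -, -, k, -⟩ | ⟨-, -, k, -⟩ | ⟨-, -, k, -⟩
    · exact fromDs _ k
    · exact ⟨_, mv k1 (by ring), k2⟩
    · exact fromUs _ k
    · exact fromDs _ k
    · exact fromUs _ k
    · exact fromUs _ k
  obtain ⟨β, x, hx⟩ := h.hM.ne
  rcases blk_cases β with ⟨t, rfl⟩ | ⟨t, rfl⟩ | rfl
  · rcases h.afterU hx with ⟨t', h'⟩ | ⟨-, -, t', h'⟩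
    · exact fromD _ _ h'
    · exact fromD _ _ h'
  · exact fromD _ _ hx
  · exact (h.noCM hx).elim

theorem NB_rev {β : Blk} {x : ℤ} (h : NB a b (JR.rev a b M) β x) :
    NB a b M β.flip (-x - β.len (a + 2 * b) (2 * a + 3 * b)) := by
  cases β
  · obtain ⟨h1, h2, h3, h4, h5⟩ := h
    exact ⟨rmv h5 (by simp only [Blk.len]; ring), rmv h4 (by simp only [Blk.len]; ring),
      rmv h3 (by simp only [Blk.len]; ring), rmv h2 (by simp only [Blk.len]; ring),
      rmv h1 (by simp only [Blk.len]; ring)⟩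
  · obtain ⟨h1, h2, h3, h4, h5, h6, h7⟩ := h
    exact ⟨rmv h7 (by simp only [Blk.len]; ring), rmv h6 (by simp only [Blk.len]; ring),
      rmv h5 (by simp only [Blk.len]; ring), rmv h4 (by simp only [Blk.len]; ring),
      rmv h3 (by simp only [Blk.len]; ring), rmv h2 (by simp only [Blk.len]; ring),
      rmv h1 (by simp only [Blk.len]; ring)⟩
  · obtain ⟨h1, h2, h3, h4, h5⟩ := h
    exact ⟨rmv h5 (by simp only [Blk.len]; ring), rmv h4 (by simp only [Blk.len]; ring),
      rmv h3 (by simp only [Blk.len]; ring), rmv h2 (by simp only [Blk.len]; ring),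
      rmv h1 (by simp only [Blk.len]; ring)⟩
  · obtain ⟨h1, h2, h3, h4, h5, h6, h7⟩ := h
    exact ⟨rmv h7 (by simp only [Blk.len]; ring), rmv h6 (by simp only [Blk.len]; ring),
      rmv h5 (by simp only [Blk.len]; ring), rmv h4 (by simp only [Blk.len]; ring),
      rmv h3 (by simp only [Blk.len]; ring), rmv h2 (by simp only [Blk.len]; ring),
      rmv h1 (by simp only [Blk.len]; ring)⟩
  · obtain ⟨h1, h2, h3, h4, h5, h6, h7, h8⟩ := h
    exact ⟨rmv h8 (by simp only [Blk.len]; ring), rmv h7 (by simp only [Blk.len]; ring),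
      rmv h6 (by simp only [Blk.len]; ring),
      rmv h5 (by simp only [Blk.len]; ring), rmv h4 (by simp only [Blk.len]; ring),
      rmv h3 (by simp only [Blk.len]; ring), rmv h2 (by simp only [Blk.len]; ring),
      rmv h1 (by simp only [Blk.len]; ring)⟩

theorem rev_rev (a b : ℤ) (M : Blk → ℤ → Prop) : JR.rev a b (JR.rev a b M) = M := by
  funext β x
  simp only [JR.rev, Blk.flip_flip, Blk.len_flip]
  congr 1; ring

theorem NB_rev' {β : Blk} {x : ℤ} (h : NB a b M β x) :
    NB a b (JR.rev a b M) β.flip (-x - β.len (a + 2 * b) (2 * a + 3 * b)) := by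
  apply NB_rev
  rwa [rev_rev]

theorem Trip.nsep (h : Trip a b L M U) {β : Blk} {x y : ℤ} (hx : NB a b M β x)
    (h0 : M ul (y - b)) (h1 : M dl y) (hxy : x < y) : x + β.len (a + 2 * b) (2 * a + 3 * b) ≤ y := by
  have i1 := h.i1; have i2 := h.i2; have i3 := h.i3
  have key : ∀ {γ p}, M γ p → (p = y ∧ γ = dl) ∨ p + γ.len a b ≤ y ∨ y + b ≤ p := fun {γ p} hp =>
    h.hM.sep hp h1
  have key0 : ∀ {γ p}, M γ p → (p = y - b ∧ γ = ul) ∨ p + γ.len a b ≤ y - b ∨ y - b + b ≤ p := fun {γ p} hp =>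
    h.hM.sep hp h0
  cases β
  · obtain ⟨-, h2, h3, h4, h5⟩ := hx
    have k2 := key h2; have k3 := key h3; have k4 := key h4
    simp only [Blk.len, reduceCtorEq, and_false, false_or] at *
    omega
  · obtain ⟨-, h2, h3, h4, h5, h6, h7⟩ := hx
    have k2 := key h2; have k3 := key h3; have k4 := key h4; have k5 := key h5; have k6 := key h6
    have m := key0 h3
    simp only [Blk.len, reduceCtorEq, and_false, false_or] at *
    omega
  · obtain ⟨-, h2, h3, h4, h5⟩ := hx
    have k2 := key h2; have k3 := key h3; have k4 := key h4
    simp only [Blk.len, reduceCtorEq, and_false, false_or] at *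
    omega
  · obtain ⟨-, h2, h3, h4, h5, h6, h7⟩ := hx
    have k2 := key h2; have k3 := key h3; have k4 := key h4; have k5 := key h5; have k6 := key h6
    simp only [Blk.len, reduceCtorEq, and_false, false_or] at *
    omega
  · obtain ⟨-, h2, h3, h4, h5, h6, h7, h8⟩ := hx
    have k2 := key h2; have k3 := key h3; have k4 := key h4; have k5 := key h5; have k6 := key h6
    have k7 := key h7
    have m := key0 h3
    simp only [Blk.len, reduceCtorEq, and_false, false_or] at *
    omega

theorem Trip.nuniq (h : Trip a b L M U) {β β' : Blk} {x : ℤ} (hx : NB a b M β x)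
    (hy : NB a b M β' x) : β = β' := by
  have i1 := h.i1; have i2 := h.i2; have i3 := h.i3
  have key : ∀ {γ γ' : Blk} {p}, M γ p → M γ' p → γ = γ' := fun {γ γ' p} hp hp' =>
    h.hM.uniq i1 (by omega) hp hp' rfl
  cases β <;> cases β' <;> first | rfl | (exfalso; first
    | (have := key hx.2.2.1 hy.2.2.1; simp at this; done)
    | (have := key hx.2.2.2.1 hy.2.2.2.1; simp at this; done)
    | (have := key hx.2.2.2.2 hy.2.2.2.2.1; simp at this; done)
    | (have := key hx.2.2.2.2.1 hy.2.2.2.2; simp at this; done)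
    | (have := key hx.2.2.2.2.1 hy.2.2.2.2.1; simp at this; done))

theorem Trip.rowN (h : Trip a b L M U) : Row (a + 2 * b) (2 * a + 3 * b) (NB a b M) where
  next := by
    intro β x hx
    obtain ⟨h1, h2⟩ := NB_cut' hx
    exact h.cut h1 h2
  prev := by
    intro β x hx
    obtain ⟨h1, h2⟩ := NB_cut hx
    obtain ⟨β', h'⟩ := h.rev.cut (x := -x) ((rev_uk (t := true)).2 (mv h2 (by simp only [ll]; ring)))
      ((rev_dk (t := true)).2 (mv h1 (by simp only [ll]; ring)))
    refine ⟨β'.flip, ?_⟩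
    rw [Blk.len_flip]
    exact mv (NB_rev h') (by ring)
  sep := by
    intro β x β' y hx hy
    rcases lt_trichotomy x y with e | e | e
    · exact Or.inr (Or.inl (h.nsep hx (NB_cut hy).1 (NB_cut hy).2 e))
    · subst e; exact Or.inl ⟨rfl, h.nuniq hx hy⟩
    · exact Or.inr (Or.inr (h.nsep hy (NB_cut hx).1 (NB_cut hx).2 e))
  ne := by
    obtain ⟨x, h1, h2⟩ := h.exCut
    obtain ⟨β, hβ⟩ := h.cut h1 h2
    exact ⟨β, x, hβ⟩

theorem Trip.dcov (h : Trip a b L M U) (w : ℤ) : ∃ t y z, M (dk t) y ∧ DT a b L M t y z ∧ y ≤ w ∧ w < z := by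
  have i1 := h.i1; have i2 := h.i2; have i3 := h.i3
  obtain ⟨x, y, -, -, ⟨t, h1, h2⟩, h3, h4⟩ := cover (P := fun x => ∃ t, M (dk t) x)
    (Q := fun x y => ∃ t, M (dk t) x ∧ DT a b L M t x y)
    (by obtain ⟨x, -, hx⟩ := h.exCut; exact ⟨x, true, hx⟩)
    (by
      rintro x ⟨t, hx⟩
      obtain ⟨z, H⟩ := h.dtrans hx
      refine ⟨z, ?_, ?_, t, hx, H⟩
      · unfold DT at H; omega
      · rcases H with ⟨-, e, k, -⟩ | ⟨-, e, -, k, -⟩ | ⟨-, e, -, k, -⟩ | ⟨-, e, -, k, -⟩ | ⟨-, e, -, -, k, -⟩ | ⟨-, e, -, -, k, -⟩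
        · exact ⟨false, e ▸ k⟩
        · exact ⟨true, e ▸ k⟩
        · exact ⟨true, e ▸ k⟩
        · exact ⟨false, e ▸ k⟩
        · exact ⟨true, e ▸ k⟩
        · exact ⟨false, e ▸ k⟩)
    (by
      rintro x ⟨t, hx⟩
      obtain ⟨t', H⟩ := h.beforeD hx
      have := ll_cases a b t'
      rcases H with H | ⟨t2, H, -⟩ | ⟨H, -⟩
      · exact ⟨_, by omega, t', H⟩
      · have := ll_cases a b t2
        exact ⟨_, by omega, t', H⟩
      · exact ⟨_, by omega, t', H⟩) w
  exact ⟨t, x, y, h1, h2, h3, h4⟩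

theorem Trip.nds (h : Trip a b L M U) (y : ℤ) : L ds y ↔ NB a b M ds y ∨ NB a b M c (y - (a + b)) := by
  have i1 := h.i1; have i2 := h.i2; have i3 := h.i3
  constructor
  · intro hy
    have cl : ∀ {γ p}, L γ p → (p = y ∧ γ = ds) ∨ p + γ.len b (a + b) ≤ y ∨ y + b ≤ p := fun {γ p} hp =>
      h.hL.sep hp hy
    obtain ⟨t, y0, z, hd, H, e1, e2⟩ := h.dcov y
    rcases H with ⟨-, e, k, k2⟩ | ⟨-, e, -, k, k2⟩ | ⟨-, e, -, k, k2⟩ | ⟨rfl, e, k1, k2, k3, k4⟩ |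
      ⟨rfl, e, k1, k2, k3, k4, k5⟩ | ⟨-, e, -, -, k, k2, k3⟩
    · have := cl k2; simp [Blk.len] at this; omega
    · have := cl k2; simp [Blk.len] at this; omega
    · have := cl k2; simp [Blk.len] at this; omega
    · have m1 := cl k3; have m2 := cl k4
      simp [Blk.len] at m1 m2
      have : y0 = y := by omega
      subst this
      right
      have H := h.utrans (t := true) (e := y0 + 2 * b) (mv k1 (by simp only [ll]; ring))
      have no : ∀ {β p}, M β p → p = y0 + b - a → False := fun {β p} hh e => by
        have := h.hM.sep hh (show M dl y0 from hd)
        have : 0 < β.len a b := by cases β <;> simp only [Blk.len] <;> omega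
        simp only [Blk.len] at *; omega
      rcases H with ⟨-, m, -⟩ | ⟨m, -⟩ | ⟨-, m, -⟩ | ⟨-, -, m, -⟩ | ⟨-, m, -⟩ | ⟨-, m, -⟩
      · exact (no m (by ring)).elim
      · simp at m
      · exact (no m (by ring)).elim
      · obtain ⟨n1, n2⟩ := h.beforeUs m
        obtain ⟨o1, o2⟩ := h.afterDs k2
        exact ⟨mv n2 (by ring), mv n1 (by ring), mv m (by ring), mv hd (by ring), mv k1 (by ring),
          mv k2 (by ring), mv o1 (by ring), mv o2 (by ring)⟩
      · exact (no m (by ring)).elim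
      · exact (no m (by ring)).elim
    · have m1 := cl k4; have m2 := cl k5
      simp [Blk.len] at m1 m2
      have : y0 = y := by omega
      subst this
      left
      exact ⟨mv (h.beforeUs k1).2 (by ring), hd, k1, k2, k3⟩
    · have m1 := cl k2; have m2 := cl k3
      simp [Blk.len] at m1 m2; omega
  · rintro (H | H)
    · obtain ⟨-, h2, h3, h4, h5⟩ := H
      obtain ⟨z, H⟩ := h.dtrans (t := true) h2
      have key : ∀ {γ γ' : Blk} {p}, M γ p → M γ' p → γ = γ' := fun {γ γ' p} hp hp' =>
        h.hM.uniq i1 (by omega) hp hp' rfl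
      rcases H with ⟨-, e, k, -⟩ | ⟨k, -⟩ | ⟨-, e, -, k, -⟩ | ⟨-, e, k1, k2, k3, k4⟩ |
        ⟨-, e, k1, k2, k3, k4, k5⟩ | ⟨-, e, -, -, k, k2, k3⟩
      · simpa using key k h3
      · simp at k
      · simpa using key k h4
      · exact k3
      · exact k4
      · simpa using key k h5
    · obtain ⟨-, h2, h3, h4, h5, -⟩ := H
      obtain ⟨z, H⟩ := h.dtrans (t := true) (y := y) (mv h4 (by ring))
      have key : ∀ {γ γ' : Blk} {p q}, M γ p → M γ' q → p = q → γ = γ' := fun {γ γ' p q} hp hp' e =>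
        h.hM.uniq i1 (by omega) hp hp' e
      rcases H with ⟨-, e, k, -⟩ | ⟨k, -⟩ | ⟨-, e, k, -⟩ | ⟨-, e, k1, k2, k3, k4⟩ |
        ⟨-, e, k, k2, k3, k4, k5⟩ | ⟨-, e, k, -, -, k2, k3⟩
      · simpa using key k h5 (by ring)
      · simp at k
      · simpa using key k h5 (by ring)
      · exact k3
      · simpa using key k h5 (by ring)
      · simpa using key k h5 (by ring)

theorem Trip.ndl (h : Trip a b L M U) (y : ℤ) : L dl y ↔ NB a b M dl y := by
  have i1 := h.i1; have i2 := h.i2; have i3 := h.i3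
  constructor
  · intro hy
    have cl : ∀ {γ p}, L γ p → (p = y ∧ γ = dl) ∨ p + γ.len b (a + b) ≤ y ∨ y + (a + b) ≤ p := fun {γ p} hp =>
      h.hL.sep hp hy
    obtain ⟨t, y0, z, hd, H, e1, e2⟩ := h.dcov y
    rcases H with ⟨-, e, k, k2⟩ | ⟨-, e, -, k, k2⟩ | ⟨-, e, -, k, k2⟩ | ⟨rfl, e, k1, k2, k3, k4⟩ |
      ⟨rfl, e, k1, k2, k3, k4, k5⟩ | ⟨rfl, e, k1, k2, k3, k4, k5⟩
    · have := cl k2; simp [Blk.len] at this; omega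
    · have := cl k2; simp [Blk.len] at this; omega
    · have := cl k2; simp [Blk.len] at this; omega
    · have m1 := cl k3; have m2 := cl k4
      simp [Blk.len] at m1 m2; omega
    · have m1 := cl k4; have m2 := cl k5
      simp [Blk.len] at m1 m2; omega
    · have m1 := cl k4; have m2 := cl k5
      simp [Blk.len] at m1 m2
      have : y0 = y := by omega
      subst this
      obtain ⟨o1, o2⟩ := h.afterDs k3
      exact ⟨mv (h.beforeUs k1).2 (by ring), hd, k1, k2, k3, mv o1 (by ring), mv o2 (by ring)⟩
  · intro H
    obtain ⟨-, h2, h3, h4, h5, -⟩ := H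
    obtain ⟨z, H⟩ := h.dtrans (t := true) h2
    have key : ∀ {γ γ' : Blk} {p}, M γ p → M γ' p → γ = γ' := fun {γ γ' p} hp hp' =>
      h.hM.uniq i1 (by omega) hp hp' rfl
    rcases H with ⟨-, e, k, -⟩ | ⟨k, -⟩ | ⟨-, e, -, k, -⟩ | ⟨-, e, k, k2, k3, k4⟩ |
      ⟨-, e, k1, k2, k3, k4, k5⟩ | ⟨-, e, -, -, k, k2, k3⟩
    · simpa using key k h3
    · simp at k
    · simpa using key k h4
    · simpa using key k h3
    · simpa using key k3 h5
    · exact k2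

theorem NB_rev_iff {β : Blk} {x : ℤ} : NB a b (JR.rev a b M) β x ↔
    NB a b M β.flip (-x - β.len (a + 2 * b) (2 * a + 3 * b)) := by
  constructor
  · exact NB_rev
  · intro h
    have := NB_rev' h
    rw [Blk.flip_flip, Blk.len_flip] at this
    exact mv this (by ring)

theorem Trip.nus (h : Trip a b L M U) (y : ℤ) : U us (y - b) ↔
    NB a b M us (y - (a + 2 * b)) ∨ NB a b M c (y + (a + b) - 2 * (a + 2 * b)) := by
  have := h.rev.nds (-y)
  rw [NB_rev_iff, NB_rev_iff] at this
  simp only [JR.rev, Blk.flip, Blk.len, neg_neg] at this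
  rw [this, show -(-y - (a + b)) - 2 * (a + 2 * b) = y + (a + b) - 2 * (a + 2 * b) by ring]

theorem Trip.nul (h : Trip a b L M U) (y : ℤ) : U ul (y - (a + b)) ↔
    NB a b M ul (y - (2 * a + 3 * b)) := by
  have := h.rev.ndl (-y)
  rw [NB_rev_iff] at this
  simpa only [JR.rev, Blk.flip, Blk.len, neg_neg] using this

theorem Trip.lds (h : Trip a b L M U) {y : ℤ} (hy : L ds y) : L us (y + b) ∨ L ul (y + b) := by
  have i1 := h.i1; have i2 := h.i2; have i3 := h.i3
  have hd : M (dk true) y := by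
    rcases (h.nds y).1 hy with H | H
    · exact H.2.1
    · exact mv H.2.2.2.1 (by ring)
  have key : ∀ {γ γ' : Blk} {p}, L γ p → L γ' p → γ = γ' := fun {γ γ' p} hp hp' =>
    h.hL.uniq (by omega) (by omega) hp hp' rfl
  obtain ⟨z, H⟩ := h.dtrans hd
  rcases H with ⟨-, e, k, k2⟩ | ⟨-, e, -, k, k2⟩ | ⟨-, e, -, k, k2⟩ | ⟨-, e, k1, k2, k3, k4⟩ |
      ⟨-, e, k1, k2, k3, k4, k5⟩ | ⟨-, e, -, -, k, k2, k3⟩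
  · simpa using key k2 hy
  · simpa using key k2 hy
  · simpa using key k2 hy
  · exact Or.inl k4
  · exact Or.inr k5
  · simpa using key k2 hy

theorem Trip.ldl (h : Trip a b L M U) {y : ℤ} (hy : L dl y) : L us (y + (a + b)) := by
  have i1 := h.i1; have i2 := h.i2; have i3 := h.i3
  have hd : M (dk true) y := ((h.ndl y).1 hy).2.1
  have key : ∀ {γ γ' : Blk} {p}, L γ p → L γ' p → γ = γ' := fun {γ γ' p} hp hp' =>
    h.hL.uniq (by omega) (by omega) hp hp' rfl
  obtain ⟨z, H⟩ := h.dtrans hd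
  rcases H with ⟨-, e, k, k2⟩ | ⟨-, e, -, k, k2⟩ | ⟨-, e, -, k, k2⟩ | ⟨-, e, k1, k2, k3, k4⟩ |
      ⟨-, e, k1, k2, k3, k4, k5⟩ | ⟨-, e, -, -, k, k2, k3⟩
  · simpa using key k2 hy
  · simpa using key k2 hy
  · simpa using key k2 hy
  · simpa using key k3 hy
  · simpa using key k4 hy
  · exact mv k3 (by ring)

/-- An up block of the top strip is preceded by a down block. -/
theorem Trip.uup (h : Trip a b L M U) {t : Bool} {y : ℤ} (hy : U (uk t) y) :
    ∃ t', U (dk t') (y - ll b (a + b) t') := by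
  cases t
  · rcases h.rev.lds (y := -y - b) ((rev_dk (t := false)).2 (mv hy (by simp only [ll]; ring))) with H | H
    · exact ⟨false, rmv H (by simp only [Blk.len, ll]; ring)⟩
    · exact ⟨true, rmv H (by simp only [Blk.len, ll]; ring)⟩
  · have H := h.rev.ldl (y := -y - (a + b)) ((rev_dk (t := true)).2 (mv hy (by simp only [ll]; ring)))
    exact ⟨false, rmv H (by simp only [Blk.len, ll]; ring)⟩

/-- Two consecutive triples sharing their outer strips are impossible. -/
theorem Trip.no_five {K M1 M2 L1 U2 : Blk → ℤ → Prop} {d : ℤ} (h1 : Trip a b L1 M1 K)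
    (h2 : Trip a b (fun β x => K β (x + d)) M2 U2) : False := by
  have i1 := h1.i1; have i2 := h1.i2; have i3 := h1.i3
  have ends : ∀ {t y}, M2 (dk t) y → K (uk t) (y + d - ll b (a + b) t) := by
    intro t y hy
    cases t
    · rcases (h2.l1 y).2 (Or.inl hy) with k | k
      · exact mv k (by simp only [ll]; ring)
      · exact (h2.noCL k).elim
    · exact mv ((h2.l2 y).2 hy) (by simp only [ll]; ring)
  have noend : ∀ {t t' y}, M2 (dk t) y → K (dk t') (y + d - ll b (a + b) t') → False := by
    intro t t' y hy hk
    have e1 := ll_cases b (a + b) t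
    have e2 := ll_cases b (a + b) t'
    exact h1.hU.clash (ends hy) hk (by cases t <;> cases t' <;> simp [uk, dk])
      (by rw [dk_len]; omega) (by rw [uk_len]; omega)
  have noup : ∀ {t t' y}, M2 (dk t) y → K (uk t') (y + d) → False := by
    intro t t' y hy hk
    obtain ⟨t2, h⟩ := h1.uup hk
    exact noend hy h
  have nods : ∀ {y}, M2 ds y → False := by
    intro y hy
    obtain ⟨z, H⟩ := h2.dtrans (t := false) hy
    unfold DT at H
    simp at H
    exact noup (t := false) (t' := true) hy H.2.2.2
  obtain ⟨x, -, hx⟩ := h2.exCut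
  obtain ⟨z, H⟩ := h2.dtrans (t := true) hx
  rcases H with ⟨-, e, k, k2⟩ | ⟨-, e, -, k, k2⟩ | ⟨-, e, -, k, k2⟩ | ⟨-, e, k1, k2, k3, k4⟩ |
      ⟨-, e, k1, k2, k3, k4, k5⟩ | ⟨-, e, -, -, k, k2, k3⟩
  · exact nods k
  · exact noup (t := true) (t' := true) hx k2
  · exact noup (t := true) (t' := true) hx k2
  · exact nods k2
  · rcases (h1.u1 (x + d)).2 (Or.inl k4) with m | m
    · have H := h1.utrans (t := false) (e := x + d) m
      unfold UT at H
      simp at H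
      exact noend (t := true) (t' := true) hx (mv H.2.2 (by simp only [ll]; ring))
    · exact h1.noCM m
  · exact nods k

end JR

namespace JR
open Blk

/-- Mark predicates on an interface: `true` = large mark, `false` = small mark. -/
abbrev Marks := Bool → ℤ → Prop

/-- The strip relation between the lower and upper interface marks. -/
def R (a b i j : ℤ) (I J : Marks) : Prop :=
  ∃ B : Blk → ℤ → Prop, Row a b B ∧
    (∀ x, I false (x + i) ↔ B ds x ∨ B c (x - (b - a))) ∧
    (∀ x, I true (x + i) ↔ B dl x) ∧
    (∀ x, J false (x + j) ↔ B us (x - a) ∨ B c (x + (b - a) - 2 * a)) ∧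
    (∀ x, J true (x + j) ↔ B ul (x - b))

theorem Row.shift {a b : ℤ} {B : Blk → ℤ → Prop} (h : Row a b B) (d : ℤ) :
    Row a b (fun β x => B β (x + d)) where
  next := by
    intro β x hx
    obtain ⟨β', h'⟩ := h.next hx
    exact ⟨β', mv h' (by ring)⟩
  prev := by
    intro β x hx
    obtain ⟨β', h'⟩ := h.prev hx
    exact ⟨β', mv h' (by ring)⟩
  sep := by
    intro β x β' y hx hy
    rcases h.sep hx hy with ⟨e, e'⟩ | e | e
    · exact Or.inl ⟨by omega, e'⟩
    · exact Or.inr (Or.inl (by omega))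
    · exact Or.inr (Or.inr (by omega))
  ne := by
    obtain ⟨β, x, hx⟩ := h.ne
    exact ⟨β, x - d, mv hx (by ring)⟩

structure Good (a b : ℤ) : Prop where
  i1 : 0 < a
  i2 : 3 * a < 2 * b
  i3 : 3 * b < 5 * a

theorem Good.step {a b : ℤ} (h : Good a b) : Good b (a + b) :=
  ⟨by have := h.i1; have := h.i2; omega, by have := h.i1; have := h.i3; omega,
    by have := h.i2; omega⟩

theorem mkTrip {a b i0 j0 i1 j1 : ℤ} (g : Good a b) {L M U : Blk → ℤ → Prop} {J1 J2 : Marks}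
    (hL : Row b (a + b) L)
    (l1 : ∀ x, J1 false (x + j1) ↔ L us (x - b) ∨ L c (x + (a + b - b) - 2 * b))
    (l2 : ∀ x, J1 true (x + j1) ↔ L ul (x - (a + b)))
    (hM : Row a b M)
    (m1 : ∀ x, J1 false (x + i0) ↔ M ds x ∨ M c (x - (b - a)))
    (m2 : ∀ x, J1 true (x + i0) ↔ M dl x)
    (m3 : ∀ x, J2 false (x + j0) ↔ M us (x - a) ∨ M c (x + (b - a) - 2 * a))
    (m4 : ∀ x, J2 true (x + j0) ↔ M ul (x - b))
    (hU : Row b (a + b) U)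
    (u1 : ∀ x, J2 false (x + i1) ↔ U ds x ∨ U c (x - (a + b - b)))
    (u2 : ∀ x, J2 true (x + i1) ↔ U dl x) :
    Trip a b (fun β x => L β (x + (i0 - j1))) M (fun β x => U β (x + (j0 - i1))) where
  hL := hL.shift _
  hM := hM
  hU := hU.shift _
  i1 := g.i1
  i2 := g.i2
  i3 := g.i3
  l1 := by
    intro y
    have e1 := l1 (y + i0 - j1)
    have e2 := m1 y
    rw [show y + i0 - j1 + j1 = y + i0 by ring, e2] at e1
    rw [e1, show y + i0 - j1 - b = y - b + (i0 - j1) by ring,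
      show y + i0 - j1 + (a + b - b) - 2 * b = y + a - 2 * b + (i0 - j1) by ring]
  l2 := by
    intro y
    have e1 := l2 (y + i0 - j1)
    have e2 := m2 y
    rw [show y + i0 - j1 + j1 = y + i0 by ring, e2] at e1
    rw [e1, show y + i0 - j1 - (a + b) = y - (a + b) + (i0 - j1) by ring]
  u1 := by
    intro y
    have e1 := u1 (y + j0 - i1)
    have e2 := m3 y
    rw [show y + j0 - i1 + i1 = y + j0 by ring, e2] at e1
    rw [e1, show y + j0 - i1 - (a + b - b) = y - a + (j0 - i1) by ring,
      show y + j0 - i1 = y + (j0 - i1) by ring]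
  u2 := by
    intro y
    have e1 := u2 (y + j0 - i1)
    have e2 := m4 y
    rw [show y + j0 - i1 + i1 = y + j0 by ring, e2] at e1
    rw [e1, show y + j0 - i1 = y + (j0 - i1) by ring]

theorem R.comp {a b i0 j0 i1 j1 : ℤ} (g : Good a b) {I J1 J2 J : Marks}
    (h1 : R b (a + b) i1 j1 I J1) (h0 : R a b i0 j0 J1 J2) (h2 : R b (a + b) i1 j1 J2 J) :
    R (a + 2 * b) (2 * a + 3 * b) (i0 - j1 + i1) (j0 - i1 + j1) I J := by
  obtain ⟨L, hL, L1, L2, L3, L4⟩ := h1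
  obtain ⟨M, hM, M1, M2, M3, M4⟩ := h0
  obtain ⟨U, hU, U1, U2, U3, U4⟩ := h2
  have T := mkTrip g hL L3 L4 hM M1 M2 M3 M4 hU U1 U2
  refine ⟨NB a b M, T.rowN, ?_, ?_, ?_, ?_⟩
  · intro x
    have e := L1 (x + (i0 - j1))
    rw [show x + (i0 - j1 + i1) = x + (i0 - j1) + i1 by ring, e,
      show 2 * a + 3 * b - (a + 2 * b) = a + b by ring, ← T.nds]
    constructor
    · rintro (k | k)
      · exact k
      · exact (T.noCL (w := x - a) (mv k (by ring))).elim
    · exact Or.inl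
  · intro x
    have e := L2 (x + (i0 - j1))
    rw [show x + (i0 - j1 + i1) = x + (i0 - j1) + i1 by ring, e, ← T.ndl]
  · intro x
    have e := U3 (x + (j0 - i1))
    rw [show x + (j0 - i1 + j1) = x + (j0 - i1) + j1 by ring, e,
      show 2 * a + 3 * b - (a + 2 * b) = a + b by ring, ← T.nus,
      show x + (j0 - i1) - b = x - b + (j0 - i1) by ring]
    constructor
    · rintro (k | k)
      · exact k
      · exact (T.noCU (w := x + a - 2 * b) (mv k (by ring))).elim
    · exact Or.inl
  · intro x
    have e := U4 (x + (j0 - i1))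
    rw [show x + (j0 - i1 + j1) = x + (j0 - i1) + j1 by ring, e, ← T.nul,
      show x + (j0 - i1) - (a + b) = x - (a + b) + (j0 - i1) by ring]

theorem R.no_five {a b i0 j0 i1 j1 : ℤ} (g : Good a b) {I J1 J2 J3 J4 J : Marks}
    (h1 : R b (a + b) i1 j1 I J1) (h2 : R a b i0 j0 J1 J2) (h3 : R b (a + b) i1 j1 J2 J3)
    (h4 : R a b i0 j0 J3 J4) (h5 : R b (a + b) i1 j1 J4 J) : False := by
  obtain ⟨L, hL, L1, L2, L3, L4⟩ := h1
  obtain ⟨M, hM, M1, M2, M3, M4⟩ := h2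
  obtain ⟨K, hK, K1, K2, K3, K4⟩ := h3
  obtain ⟨P, hP, P1, P2, P3, P4⟩ := h4
  obtain ⟨U, hU, U1, U2, U3, U4⟩ := h5
  have T1 := mkTrip g hL L3 L4 hM M1 M2 M3 M4 hK K1 K2
  have T2 := mkTrip g hK K3 K4 hP P1 P2 P3 P4 hU U1 U2
  refine Trip.no_five (d := i0 - j1 - j0 + i1) T1 ?_ (M2 := P) (U2 := fun β x => U β (x + (j0 - i1)))
  have : (fun (β : Blk) (x : ℤ) => K β (x + (i0 - j1 - j0 + i1) + (j0 - i1))) =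
      fun β x => K β (x + (i0 - j1)) := by
    funext β x; congr 1; ring
  simpa only [this] using T2

def Per (p : ℤ) (I : Marks) : Prop := ∀ t x, I t x ↔ I t (x + p)

theorem R.per {a b i j p : ℤ} (g : Good a b) {I J : Marks} (h : R a b i j I J) (hI : Per p I)
    (hJ : Per p J) (hp : 0 < p) : a ≤ p := by
  have i1 := g.i1; have i2 := g.i2; have i3 := g.i3
  by_contra hlt
  obtain ⟨B, hB, B1, B2, B3, B4⟩ := h
  have key : ∀ {β β' x y}, B β x → B β' y →
    (x = y ∧ β = β') ∨ x + β.len a b ≤ y ∨ y + β'.len a b ≤ x := fun h h' => hB.sep h h'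
  have down : ∀ x, B ds x ∨ B c (x - (b - a)) → False := by
    intro x hx
    have h2 := (B1 (x + p)).1 (by
      have := (hI false (x + i)).1 ((B1 x).2 hx)
      rwa [show x + i + p = x + p + i by ring] at this)
    rcases hx with hx | hx <;> rcases h2 with h2 | h2 <;> have := key hx h2 <;>
      simp only [Blk.len, reduceCtorEq, and_false, false_or] at this <;> omega
  have up : ∀ x, B us (x - a) ∨ B c (x + (b - a) - 2 * a) → False := by
    intro x hx
    have h2 := (B3 (x + p)).1 (by
      have := (hJ false (x + j)).1 ((B3 x).2 hx)
      rwa [show x + j + p = x + p + j by ring] at this)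
    rcases hx with hx | hx <;> rcases h2 with h2 | h2 <;> have := key hx h2 <;>
      simp only [Blk.len, reduceCtorEq, and_false, false_or] at this <;> omega
  obtain ⟨β, x, hx⟩ := hB.ne
  cases β
  · exact up (x + a) (Or.inl (mv hx (by ring)))
  · have h2 := (B4 (x + b + p)).1 (by
      have := (hJ true (x + b + j)).1 ((B4 (x + b)).2 (mv hx (by ring)))
      rwa [show x + b + j + p = x + b + p + j by ring] at this)
    have := key hx h2
    simp only [Blk.len] at this; omega
  · exact down x (Or.inl hx)
  · have h2 := (B2 (x + p)).1 (by
      have := (hI true (x + i)).1 ((B2 x).2 hx)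
      rwa [show x + i + p = x + p + i by ring] at this)
    have := key hx h2
    simp only [Blk.len] at this; omega
  · exact down (x + (b - a)) (Or.inr (mv hx (by ring)))

/-- A bottom-infinite stack of strips at a given level, with horizontal period `p`. -/
def Lev (p a b i0 j0 i1 j1 i2 j2 : ℤ) : Prop :=
  ∃ (I I' : ℕ → Marks) (X : ℕ → Bool), ∀ k,
    Per p (I k) ∧ Per p (I' k) ∧ R b (a + b) i1 j1 (I k) (I' k) ∧
    (X k = true → R (a + b) (a + 2 * b) i2 j2 (I' k) (I (k + 1))) ∧
    (X k = false → R a b i0 j0 (I' k) (I (k + 1)))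

theorem Lev.step {p a b i0 j0 i1 j1 i2 j2 : ℤ} (g : Good a b) (h : Lev p a b i0 j0 i1 j1 i2 j2) :
    Lev p b (a + b) i1 j1 i2 j2 (i0 - j1 + i1) (j0 - i1 + j1) := by
  obtain ⟨I, I', X, h⟩ := h
  have no2 : ∀ k, X k = false → X (k + 1) = true := by
    intro k h1
    by_contra h2
    exact R.no_five g (h k).2.2.1 ((h k).2.2.2.2 h1) (h (k + 1)).2.2.1
      ((h (k + 1)).2.2.2.2 (by simpa using h2)) (h (k + 2)).2.2.1
  let nx : ℕ → ℕ := fun k => if X (k + 1) = true then k + 1 else k + 2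
  have hnx : ∀ k, X (nx k) = true := by
    intro k
    by_cases e : X (k + 1) = true
    · simp only [nx, if_pos e, e]
    · simp only [nx, if_neg e]
      exact no2 _ (by simpa using e)
  let f : ℕ → ℕ := fun n => nx^[n + 1] 0
  have hf : ∀ n, X (f n) = true := by
    intro n
    simp only [f, Function.iterate_succ_apply', hnx]
  have hf' : ∀ n, f (n + 1) = nx (f n) := by
    intro n
    simp only [f, Function.iterate_succ_apply' nx (n + 1)]
  refine ⟨fun k => I' (f k), fun k => I (f k + 1), fun k => !X (f k + 1), fun k => ⟨(h _).2.1, (h _).1,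
    ?_, ?_, ?_⟩⟩
  · have := (h (f k)).2.2.2.1 (hf k)
    rwa [show b + (a + b) = a + 2 * b by ring]
  · intro e
    have e' : X (f k + 1) = false := by simpa using e
    have e2 : f (k + 1) = f k + 2 := by rw [hf']; simp [nx, e']
    have := R.comp g (h (f k + 1)).2.2.1 ((h (f k + 1)).2.2.2.2 e') (h (f k + 2)).2.2.1
    simp only [e2]
    rwa [show b + (a + b) = a + 2 * b by ring, show b + 2 * (a + b) = 2 * a + 3 * b by ring]
  · intro e
    have e' : X (f k + 1) = true := by simpa using e
    have e2 : f (k + 1) = f k + 1 := by rw [hf']; simp [nx, e']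
    simp only [e2]
    exact (h _).2.2.1

theorem Lev.absurd {p a b i0 j0 i1 j1 i2 j2 : ℤ} (g : Good a b) (hp : 0 < p)
    (h : Lev p a b i0 j0 i1 j1 i2 j2) : False := by
  have key : ∀ n : ℕ, ∃ a b i0 j0 i1 j1 i2 j2 : ℤ, Good a b ∧ (n : ℤ) ≤ a ∧ Lev p a b i0 j0 i1 j1 i2 j2 := by
    intro n
    induction n with
    | zero => exact ⟨a, b, i0, j0, i1, j1, i2, j2, g, by have := g.i1; push_cast; omega, h⟩
    | succ n ih =>
      obtain ⟨a, b, i0, j0, i1, j1, i2, j2, g, h1, h2⟩ := ih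
      refine ⟨b, a + b, i1, j1, i2, j2, _, _, g.step, ?_, h2.step g⟩
      have := g.i1; have := g.i2; push_cast; omega
  obtain ⟨a, b, i0, j0, i1, j1, i2, j2, g, h1, I, I', X, h⟩ := key (p.toNat + 1)
  have h0 := h 0
  have := h0.2.2.1.per g.step h0.1 h0.2.1 hp
  have := g.i1; have := g.i2
  push_cast at h1
  omega

end JR

namespace JR
open Blk

/-- A transition `(p, i, o, q)` of a transducer. -/
abbrev Edge := ℕ × ℕ × ℕ × ℕ

def Run (G : List Edge) (st i o : ℤ → ℕ) : Prop := ∀ x, (st x, i x, o x, st (x + 1)) ∈ G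

def Rel (G : List Edge) (i o : ℤ → ℕ) : Prop := ∃ st, Run G st i o

def comp (K : ℕ) (G H : List Edge) : List Edge :=
  G.flatMap fun e => (H.filter fun f => Nat.beq e.2.2.1 f.2.1).map fun f =>
    (Nat.add (Nat.mul e.1 K) f.1, e.2.1, f.2.2.1, Nat.add (Nat.mul e.2.2.2 K) f.2.2.2)

theorem Rel.comp {K : ℕ} {G H : List Edge} {i m o : ℤ → ℕ} (h1 : Rel G i m) (h2 : Rel H m o) :
    Rel (comp K G H) i o := by
  obtain ⟨s, hs⟩ := h1
  obtain ⟨t, ht⟩ := h2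
  refine ⟨fun x => s x * K + t x, fun x => ?_⟩
  unfold JR.comp
  rw [List.mem_flatMap]
  refine ⟨_, hs x, ?_⟩
  rw [List.mem_map]
  exact ⟨_, List.mem_filter.2 ⟨ht x, by simp⟩, rfl⟩

/-- the set of values of `φ`, as a bit mask -/
def mask (φ : Edge → ℕ) (G : List Edge) : ℕ := G.foldr (fun e m => Nat.lor m (Nat.shiftLeft 1 (φ e))) 0

def bit (m k : ℕ) : Bool := Nat.beq (Nat.land (Nat.shiftRight m k) 1) 1

theorem bit_eq (m k : ℕ) : bit m k = m.testBit k := by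
  have h1 : bit m k = decide ((m >>> k) &&& 1 = 1) := by
    unfold bit
    rw [Bool.eq_iff_iff, Nat.beq_eq, decide_eq_true_iff]
    rfl
  rw [h1, Nat.testBit, Nat.and_comm, Bool.eq_iff_iff, decide_eq_true_iff, bne_iff_ne]
  have := Nat.and_le_left (n := 1) (m := m >>> k)
  omega

theorem mask_spec (φ : Edge → ℕ) {G : List Edge} {e : Edge} (h : e ∈ G) : bit (mask φ G) (φ e) = true := by
  rw [bit_eq]
  induction G with
  | nil => simp at h
  | cons f G ih =>
    have h1 : mask φ (f :: G) = mask φ G ||| 1 <<< φ f := rfl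
    rw [h1, Nat.testBit_or]
    rcases List.mem_cons.1 h with e1 | e1
    · subst e1; simp
    · rw [ih e1]; simp

def trim1 (G : List Edge) : List Edge :=
  (fun s t => G.filter fun e => and (bit t e.1) (bit s e.2.2.2)) (mask (fun e => e.1) G) (mask (fun e => e.2.2.2) G)

theorem Run.trim1 {G : List Edge} {st i o : ℤ → ℕ} (h : Run G st i o) : Run (trim1 G) st i o := by
  intro x
  unfold JR.trim1
  refine List.mem_filter.2 ⟨h x, ?_⟩
  rw [Bool.and_eq_true]
  refine ⟨?_, mask_spec (fun e => e.1) (h (x + 1))⟩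
  have := mask_spec (fun e => e.2.2.2) (h (x - 1))
  simpa using this

/-- rename the states -/
def ren (M : ℕ) (G : List Edge) : List Edge := G.map fun e => (Nat.mod e.1 M, e.2.1, e.2.2.1, Nat.mod e.2.2.2 M)

theorem Rel.ren {i o : ℤ → ℕ} (M : ℕ) {G : List Edge} (h : Rel G i o) : Rel (ren M G) i o := by
  obtain ⟨st, h⟩ := h
  exact ⟨fun x => Nat.mod (st x) M, fun x => List.mem_map.2 ⟨_, h x, rfl⟩⟩

def trim : ℕ → List Edge → List Edge
  | 0, G => G
  | n + 1, G => trim n (trim1 G)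

theorem Rel.trim {i o : ℤ → ℕ} (n : ℕ) : ∀ {G : List Edge}, Rel G i o → Rel (trim n G) i o := by
  induction n with
  | zero => intro G h; exact h
  | succ n ih =>
    intro G h
    obtain ⟨st, h⟩ := h
    exact ih ⟨st, h.trim1⟩

/-- Keep only the transitions whose output is `0` or `1`. -/
def out01 (G : List Edge) : List Edge := G.filter fun e => or (Nat.beq e.2.2.1 0) (Nat.beq e.2.2.1 1)

theorem Rel.out01 {G : List Edge} {i o : ℤ → ℕ} (h : Rel G i o) (ho : ∀ x, o x = 0 ∨ o x = 1) :
    Rel (out01 G) i o := by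
  obtain ⟨st, h⟩ := h
  refine ⟨st, fun x => List.mem_filter.2 ⟨h x, ?_⟩⟩
  rcases ho x with e | e <;> simp [e]

theorem Rel.nil {i o : ℤ → ℕ} (h : Rel [] i o) : False := by
  obtain ⟨st, h⟩ := h
  exact absurd (h 0) (by simp)

def tiles : List (ℕ × ℕ × ℕ × ℕ) :=
  [(2,1,2,4), (2,0,2,2), (3,1,1,1), (3,2,1,2), (3,3,3,1), (3,1,0,1), (0,1,0,0), (0,2,3,1),
   (1,2,0,2), (1,4,1,2), (1,2,3,3)]

def row1 : List Edge := (tiles.filter fun t => t.1 == 2).map fun t => (t.1, t.2.1, t.2.2.2, t.2.2.1)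
def row0 : List Edge := (tiles.filter fun t => !(t.1 == 2)).map fun t => (t.1, t.2.1, t.2.2.2, t.2.2.1)

end JR

namespace JR
open Blk

def seg {α : Type} (W : ℤ → α) : ℤ → ℕ → List α
  | _, 0 => []
  | x, k + 1 => W x :: seg W (x + 1) k

theorem seg_length {α : Type} (W : ℤ → α) (k : ℕ) : ∀ x, (seg W x k).length = k := by
  induction k with
  | zero => intro x; rfl
  | succ k ih => intro x; simp [seg, ih]

theorem seg_add {α : Type} (W : ℤ → α) (m : ℕ) (k : ℕ) : ∀ x, seg W x (k + m) = seg W x k ++ seg W (x + k) m := by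
  induction k with
  | zero => intro x; simp [seg]
  | succ k ih =>
    intro x
    rw [show k + 1 + m = (k + m) + 1 by ring]
    simp only [seg, ih, List.cons_append]
    rw [show x + 1 + (k : ℤ) = x + ((k + 1 : ℕ) : ℤ) by push_cast; ring]

theorem seg_map {α β : Type} (f : α → β) (W : ℤ → α) (k : ℕ) : ∀ x, (seg W x k).map f = seg (fun x => f (W x)) x k := by
  induction k with
  | zero => intro x; rfl
  | succ k ih => intro x; simp [seg, ih]

/-- the pattern `l` occurs in `W` at position `x` -/
def At (W : ℤ → ℕ) : ℤ → List ℕ → Prop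
  | _, [] => True
  | x, d :: l => W x = d ∧ At W (x + 1) l

theorem At_iff (W : ℤ → ℕ) (l : List ℕ) : ∀ (n : ℕ) x, l.length ≤ n → (At W x l ↔ l.isPrefixOf (seg W x n) = true) := by
  induction l with
  | nil => intro n x _; simp [At]
  | cons d l ih =>
    intro n x hn
    cases n with
    | zero => simp at hn
    | succ n =>
      simp only [At, seg, List.isPrefixOf, Bool.and_eq_true, beq_iff_eq]
      rw [ih n (x + 1) (by simpa using hn)]
      constructor
      · rintro ⟨h1, h2⟩; exact ⟨h1.symm, h2⟩
      · rintro ⟨h1, h2⟩; exact ⟨h1.symm, h2⟩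

theorem nbeq (a b : ℕ) : Nat.beq a b = (a == b) := by
  rw [Bool.eq_iff_iff, Nat.beq_eq, beq_iff_eq]

def chk (G : List Edge) (h : ℕ) (ws : List (List (ℕ × ℕ))) : ℕ → ℕ → List (ℕ × ℕ) → Bool
  | 0, _, _ => false
  | n + 1, s, acc => G.all fun e => or (not (Nat.beq e.1 s))
      (cond (Nat.beq e.2.2.2 h) (ws.contains (acc ++ [(e.2.1, e.2.2.1)]))
        (chk G h ws n e.2.2.2 (acc ++ [(e.2.1, e.2.2.1)])))

def hits (G : List Edge) (h : ℕ) : ℕ → ℕ → Bool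
  | 0, _ => false
  | n + 1, s => G.all fun e => or (not (Nat.beq e.1 s)) (or (Nat.beq e.2.2.2 h) (hits G h n e.2.2.2))

theorem chk_sound {G : List Edge} {st i o : ℤ → ℕ} {h : ℕ} {ws : List (List (ℕ × ℕ))}
    (hr : Run G st i o) : ∀ (n : ℕ) (x : ℤ) (acc : List (ℕ × ℕ)), chk G h ws n (st x) acc = true →
    ∃ k : ℕ, 0 < k ∧ st (x + k) = h ∧ (∀ j : ℤ, 0 < j → j < k → st (x + j) ≠ h) ∧
      acc ++ seg (fun x => (i x, o x)) x k ∈ ws := by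
  intro n
  induction n with
  | zero => intro x acc h; simp [chk] at h
  | succ n ih =>
    intro x acc hc
    simp only [chk, List.all_eq_true] at hc
    have := hc _ (hr x)
    simp only [nbeq, beq_self_eq_true, Bool.not_true, Bool.false_or] at this
    by_cases e : st (x + 1) = h
    · simp only [e, beq_self_eq_true, cond_true] at this
      refine ⟨1, by norm_num, by simpa using e, fun j h1 h2 => by push_cast at h2; omega, ?_⟩
      simpa [seg] using this
    · rw [show (st (x + 1) == h) = false by simpa using e, cond_false] at this
      obtain ⟨k, hk, h1, h2, h3⟩ := ih (x + 1) _ this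
      refine ⟨k + 1, by omega, ?_, ?_, ?_⟩
      · rw [← h1]; congr 1; push_cast; ring
      · intro j hj1 hj2
        by_cases ej : j = 1
        · subst ej; exact e
        · have := h2 (j - 1) (by omega) (by push_cast at hj2; omega)
          rwa [show x + 1 + (j - 1) = x + j by ring] at this
      · simpa [seg] using h3

theorem hits_sound {G : List Edge} {st i o : ℤ → ℕ} {h : ℕ}
    (hr : Run G st i o) : ∀ (n : ℕ) (x : ℤ), hits G h n (st x) = true →
    ∃ k : ℕ, 0 < k ∧ k ≤ n ∧ st (x + k) = h := by
  intro n
  induction n with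
  | zero => intro x h; simp [hits] at h
  | succ n ih =>
    intro x hc
    simp only [hits, List.all_eq_true] at hc
    have := hc _ (hr x)
    simp only [nbeq, beq_self_eq_true, Bool.not_true, Bool.false_or, Bool.or_eq_true, beq_iff_eq] at this
    rcases this with e | e
    · exact ⟨1, by norm_num, by omega, by simpa using e⟩
    · obtain ⟨k, hk, h1, h2⟩ := ih (x + 1) e
      refine ⟨k + 1, by omega, by omega, ?_⟩
      rw [← h2]; congr 1; push_cast; ring

def allB : List Blk := [us, ul, ds, dl, c]

theorem mem_allB (β : Blk) : β ∈ allB := by cases β <;> simp [allB]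

def wlist (wd : Blk → List (ℕ × ℕ)) : List (List (ℕ × ℕ)) := allB.map wd

/-- the checks for a transducer with a hub -/
structure HubOK (G : List Edge) (h : ℕ) (N : ℕ) (wd : Blk → List (ℕ × ℕ)) : Prop where
  c1 : chk G h (wlist wd) N h [] = true
  c2 : (G.all fun e => hits G h N e.1) = true
  c3 : (allB.all fun β => allB.all fun β' => β == β' || !(wd β == wd β')) = true

def BB (st i o : ℤ → ℕ) (h : ℕ) (wd : Blk → List (ℕ × ℕ)) : Blk → ℤ → Prop := fun β x =>
  st x = h ∧ st (x + (wd β).length) = h ∧ (∀ j : ℤ, 0 < j → j < (wd β).length → st (x + j) ≠ h) ∧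
  0 < (wd β).length ∧ seg (fun x => (i x, o x)) x (wd β).length = wd β

section
variable {G : List Edge} {st i o : ℤ → ℕ} {h N : ℕ} {wd : Blk → List (ℕ × ℕ)}

theorem HubOK.start (H : HubOK G h N wd) (hr : Run G st i o) {x : ℤ} (hx : st x = h) :
    ∃ β, BB st i o h wd β x := by
  obtain ⟨k, h1, h2, h3, h4⟩ := chk_sound hr N x [] (by rw [hx]; exact H.c1)
  simp only [List.nil_append, wlist, List.mem_map] at h4
  obtain ⟨β, -, hβ⟩ := h4
  have : (wd β).length = k := by rw [hβ, seg_length]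
  refine ⟨β, hx, ?_, ?_, ?_, ?_⟩
  · rw [this]; exact h2
  · rw [this]; exact h3
  · omega
  · rw [this, hβ]

theorem HubOK.ex (H : HubOK G h N wd) (hr : Run G st i o) (x : ℤ) : ∃ k : ℕ, 0 < k ∧ k ≤ N ∧ st (x + k) = h :=
  hits_sound hr N x (by
    have := H.c2
    rw [List.all_eq_true] at this
    exact this _ (hr x))

theorem HubOK.cov (H : HubOK G h N wd) (hr : Run G st i o) (w : ℤ) :
    ∃ β x, BB st i o h wd β x ∧ x ≤ w ∧ w < x + (wd β).length := by
  obtain ⟨x, y, h1, h2, ⟨β, h3, h4⟩, h5, h6⟩ := cover (P := fun x => st x = h)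
    (Q := fun x y => ∃ β, BB st i o h wd β x ∧ y = x + (wd β).length)
    (by obtain ⟨k, -, -, e⟩ := H.ex hr 0; exact ⟨_, e⟩)
    (by
      intro x hx
      obtain ⟨β, hβ⟩ := H.start hr hx
      have := hβ.2.2.2.1
      exact ⟨_, by omega, hβ.2.1, β, hβ, rfl⟩)
    (by
      intro x hx
      obtain ⟨k, h1, h2, e⟩ := H.ex hr (x - N - 1)
      exact ⟨_, by omega, e⟩) w
  exact ⟨β, x, h3, h5, h4 ▸ h6⟩

theorem HubOK.row (H : HubOK G h N wd) (hr : Run G st i o) {a b : ℤ}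
    (hlen : ∀ β, ((wd β).length : ℤ) = β.len a b) : Row a b (BB st i o h wd) where
  next := by
    intro β x hx
    rw [← hlen]
    exact H.start hr hx.2.1
  prev := by
    intro β x hx
    obtain ⟨γ, y, h1, h2, h3⟩ := H.cov hr (x - 1)
    refine ⟨γ, ?_⟩
    have : x = y + (wd γ).length := by
      by_contra hne
      refine h1.2.2.1 (x - y) (by omega) (by omega) ?_
      rw [show y + (x - y) = x by ring]; exact hx.1
    rw [← hlen, this]
    simpa using h1
  sep := by
    have key : ∀ {β x β' y}, BB st i o h wd β x → BB st i o h wd β' y → x < y → x + β.len a b ≤ y := by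
      intro β x β' y hx hy hxy
      by_contra hlt
      refine hx.2.2.1 (y - x) (by omega) (by rw [hlen]; omega) ?_
      rw [show x + (y - x) = y by ring]; exact hy.1
    intro β x β' y hx hy
    rcases lt_trichotomy x y with e | e | e
    · exact Or.inr (Or.inl (key hx hy e))
    · subst e
      refine Or.inl ⟨rfl, ?_⟩
      have el : (wd β).length = (wd β').length := by
        rcases lt_trichotomy (wd β).length (wd β').length with e | e | e
        · exact (hy.2.2.1 (wd β).length (by have := hx.2.2.2.1; omega) (by omega) hx.2.1).elim
        · exact e
        · exact (hx.2.2.1 (wd β').length (by have := hy.2.2.2.1; omega) (by omega) hy.2.1).elim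
      have ew : wd β = wd β' := by rw [← hx.2.2.2.2, ← hy.2.2.2.2, el]
      have := H.c3
      rw [List.all_eq_true] at this
      have := this β (mem_allB β)
      rw [List.all_eq_true] at this
      have := this β' (mem_allB β')
      simpa [ew] using this
    · exact Or.inr (Or.inr (key hy hx e))
  ne := by
    obtain ⟨β, x, h1, -⟩ := H.cov hr 0
    exact ⟨β, x, h1⟩

/-- check that the occurrences of a pattern are exactly those listed -/
def patOK (wf : Blk → List ℕ) (l : List ℕ) (ex : List (Blk × ℕ)) : Bool :=
  (allB.all fun β => decide (l.length ≤ (wf β).length)) &&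
  (allB.all fun β => allB.all fun β' => (List.range (wf β).length).all fun k =>
    (l.isPrefixOf ((wf β ++ wf β').drop k)) == ex.contains (β, k)) &&
  (ex.all fun e => decide (e.2 < (wf e.1).length))

theorem HubOK.pat (H : HubOK G h N wd) (hr : Run G st i o) (f : ℕ × ℕ → ℕ) {l : List ℕ} {ex : List (Blk × ℕ)}
    (hp : patOK (fun β => (wd β).map f) l ex = true) (x : ℤ) :
    At (fun x => f (i x, o x)) x l ↔ ∃ e ∈ ex, BB st i o h wd e.1 (x - e.2) := by
  simp only [patOK, Bool.and_eq_true, List.all_eq_true, decide_eq_true_eq, List.length_map, List.mem_range,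
    beq_iff_eq] at hp
  obtain ⟨⟨hp0, hp1⟩, hp2⟩ := hp
  have key : ∀ β y (k : ℕ), BB st i o h wd β y → k < (wd β).length → y + k = x →
      (At (fun x => f (i x, o x)) x l ↔ (β, k) ∈ ex) := by
    intro β y k hβ hk e
    obtain ⟨β', hβ'⟩ := H.start hr hβ.2.1
    have h1 := hp1 β (mem_allB _) β' (mem_allB _) k hk
    have h2 := hp0 β' (mem_allB _)
    have hs : List.drop k (List.map f (wd β) ++ List.map f (wd β')) =
        seg (fun x => f (i x, o x)) x ((wd β).length - k + (wd β').length) := by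
      have e1 : wd β ++ wd β' = seg (fun x => (i x, o x)) y ((wd β).length + (wd β').length) := by
        rw [seg_add, hβ.2.2.2.2, hβ'.2.2.2.2]
      rw [← List.map_append, e1, seg_map, show (wd β).length + (wd β').length =
        k + ((wd β).length - k + (wd β').length) by omega, seg_add, List.drop_left' (seg_length _ _ _), e]
    rw [hs] at h1
    rw [At_iff _ l ((wd β).length - k + (wd β').length) x (by omega), h1, List.contains_iff_mem]
  constructor
  · intro hA
    obtain ⟨β, y, h1, h2, h3⟩ := H.cov hr x
    have := (key β y (x - y).toNat h1 (by omega) (by omega)).1 hA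
    refine ⟨_, this, ?_⟩
    simp only
    rwa [show x - ((x - y).toNat : ℤ) = y by omega]
  · rintro ⟨⟨β, k⟩, he, hB⟩
    exact (key β _ k hB (hp2 _ he) (by ring)).2 he
end

/-- filters -/
def f1 : List Edge := [(0,0,0,0),(0,1,1,1),(1,1,1,2),(2,1,1,3),(2,0,0,0),(3,0,0,0)]
def f0 : List Edge := [(0,1,1,0),(0,0,0,1),(1,0,0,2),(2,0,0,3),(2,1,1,0),(3,1,1,0)]

theorem f1_rel {W : ℤ → ℕ} (h01 : ∀ x, W x = 0 ∨ W x = 1) (h1 : ∀ x, ¬ At W x [0, 1, 0])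
    (h2 : ∀ x, ¬ At W x [1, 1, 1, 1]) : Rel f1 W W := by
  refine ⟨fun x => if W (x - 1) = 0 then 0 else if W (x - 2) = 0 then 1 else if W (x - 3) = 0 then 2 else 3,
    fun x => ?_⟩
  have k1 := h1 (x - 2)
  have k2 := h2 (x - 3)
  simp only [At, show x - 2 + 1 = x - 1 by ring, show x - 1 + 1 = x by ring,
    show x - 3 + 1 = x - 2 by ring] at k1 k2
  simp only [show x + 1 - 1 = x by ring, show x + 1 - 2 = x - 1 by ring, show x + 1 - 3 = x - 2 by ring]
  rcases h01 x with e0 | e0 <;> rcases h01 (x - 1) with e1 | e1 <;> rcases h01 (x - 2) with e2 | e2 <;>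
    rcases h01 (x - 3) with e3 | e3 <;> simp [e0, e1, e2, e3] at k1 k2 ⊢ <;> simp [f1]

theorem f0_rel {W : ℤ → ℕ} (h01 : ∀ x, W x = 0 ∨ W x = 1) (h1 : ∀ x, ¬ At W x [1, 0, 1])
    (h2 : ∀ x, ¬ At W x [0, 0, 0, 0]) : Rel f0 W W := by
  refine ⟨fun x => if W (x - 1) = 1 then 0 else if W (x - 2) = 1 then 1 else if W (x - 3) = 1 then 2 else 3,
    fun x => ?_⟩
  have k1 := h1 (x - 2)
  have k2 := h2 (x - 3)
  simp only [At, show x - 2 + 1 = x - 1 by ring, show x - 1 + 1 = x by ring,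
    show x - 3 + 1 = x - 2 by ring] at k1 k2
  simp only [show x + 1 - 1 = x by ring, show x + 1 - 2 = x - 1 by ring, show x + 1 - 3 = x - 2 by ring]
  rcases h01 x with e0 | e0 <;> rcases h01 (x - 1) with e1 | e1 <;> rcases h01 (x - 2) with e2 | e2 <;>
    rcases h01 (x - 3) with e3 | e3 <;> simp [e0, e1, e2, e3] at k1 k2 ⊢ <;> simp [f0]

end JR

namespace JR
open Blk

theorem Rel.cast {G H : List Edge} {i o : ℤ → ℕ} (e : G = H) (h : Rel G i o) : Rel H i o := e ▸ h

def g00 : List Edge :=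
  [(1,1,1,5), (1,1,1,4), (12,1,0,4), (1,2,2,5), (12,2,1,7), (13,2,2,4), (13,2,3,7), (1,3,1,13), (1,3,1,12),
   (12,3,0,12), (1,1,1,0), (12,1,0,0), (3,2,1,13), (3,2,1,12), (0,2,0,12), (4,2,1,3), (5,2,2,0), (5,2,3,3),
   (7,4,2,5), (4,4,1,7), (5,4,2,4), (5,4,3,7), (7,2,1,1)]

theorem g00_eq : ren 14 (trim 1 (comp 4 row0 row0)) = g00 := by decide +kernel

theorem rel_g00 {i m o : ℤ → ℕ} (h1 : Rel row0 i m) (h2 : Rel row0 m o) : Rel g00 i o :=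
  Rel.cast g00_eq (((h1.comp h2).trim _).ren _)

def g000 : List Edge :=
  [(10,1,0,18), (10,1,0,14), (10,2,1,21), (11,2,2,18), (11,2,3,21), (20,2,0,4), (2,2,1,17), (3,2,2,14),
   (3,2,3,17), (10,3,0,2), (10,3,0,20), (1,2,1,3), (1,2,1,2), (12,2,0,2), (1,2,1,20), (12,2,0,20),
   (17,2,1,12), (14,2,0,12), (21,2,1,1), (15,4,2,19), (4,4,1,21), (5,4,2,18), (5,4,3,21), (17,4,1,5),
   (17,4,1,4), (14,4,0,4), (18,4,1,17), (19,4,2,14), (19,4,3,17), (21,4,1,15), (15,2,1,11), (15,2,1,10),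
   (4,2,0,10)]

theorem g000_eq : ren 22 (trim 1 (comp 14 row0 g00)) = g000 := by decide +kernel

theorem rel_g000 {i m o : ℤ → ℕ} (h1 : Rel row0 i m) (h2 : Rel g00 m o) : Rel g000 i o :=
  Rel.cast g000_eq (((h1.comp h2).trim _).ren _)

def g0000 : List Edge :=
  [(8,2,0,26), (29,2,1,0), (2,2,0,34), (10,2,0,2), (26,2,0,10), (32,4,1,4), (3,4,0,26), (24,4,1,0),
   (25,4,2,36), (25,4,3,0), (23,4,1,25), (23,4,1,24), (34,4,0,24), (23,4,1,3), (34,4,0,3), (0,4,1,34),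
   (36,4,0,34), (4,4,1,23), (26,4,0,32), (32,2,0,29), (32,2,0,8)]

theorem g0000_eq : ren 39 (trim 2 (comp 22 row0 g000)) = g0000 := by decide +kernel

theorem rel_g0000 {i m o : ℤ → ℕ} (h1 : Rel row0 i m) (h2 : Rel g000 m o) : Rel g0000 i o :=
  Rel.cast g0000_eq (((h1.comp h2).trim _).ren _)

def g4 : List Edge :=
  [(0,1,1,5), (1,1,1,0), (5,1,1,11), (6,0,1,5), (4,0,0,0), (10,0,1,1), (9,0,1,10), (8,0,0,10), (9,0,1,4),
   (8,0,0,4), (1,0,1,8), (5,0,1,9), (11,0,1,6), (0,0,0,6)]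

theorem g4_eq : ren 12 (trim 1 (out01 (comp 22 row1 g000))) = g4 := by decide +kernel

theorem rel_g4 {i m o : ℤ → ℕ} (h1 : Rel row1 i m) (h2 : Rel g000 m o) (h : ∀ x, o x = 0 ∨ o x = 1) : Rel g4 i o :=
  Rel.cast g4_eq ((((h1.comp h2).out01 h).trim _).ren _)

def g5 : List Edge :=
  [(11,1,1,16), (15,1,0,5), (3,1,1,12), (2,1,1,3), (13,1,0,3), (2,1,1,15), (13,1,0,15), (12,1,1,13),
   (16,1,1,2), (5,1,0,11), (20,0,0,5), (8,0,1,12), (14,0,0,13), (22,0,0,14), (5,0,0,22), (11,0,0,8),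
   (11,0,0,20)]

theorem g5_eq : ren 33 (trim 1 (out01 (comp 39 row1 g0000))) = g5 := by decide +kernel

theorem rel_g5 {i m o : ℤ → ℕ} (h1 : Rel row1 i m) (h2 : Rel g0000 m o) (h : ∀ x, o x = 0 ∨ o x = 1) : Rel g5 i o :=
  Rel.cast g5_eq ((((h1.comp h2).out01 h).trim _).ren _)

def t2 : List Edge :=
  [(60,1,0,57), (60,1,0,69), (59,1,1,67), (52,1,0,65), (43,1,0,21), (26,1,0,29), (32,1,0,15), (32,1,0,27),
   (22,1,1,16), (33,1,0,16), (78,1,1,33), (3,1,1,22), (48,1,0,33), (2,1,0,26), (71,1,0,32), (39,1,0,43),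
   (16,1,0,39), (65,1,1,3), (69,1,0,71), (57,1,1,78), (67,1,0,2), (27,1,0,52), (15,1,1,59), (21,1,0,60),
   (29,1,0,61), (50,0,0,21), (40,0,0,16), (10,0,0,48), (20,0,0,10), (27,0,0,20), (61,0,0,40), (52,0,0,50)]

theorem t2_eq : ren 79 (trim 5 (comp 33 g5 g5)) = t2 := by decide +kernel

theorem rel_t2 {i m o : ℤ → ℕ} (h1 : Rel g5 i m) (h2 : Rel g5 m o) : Rel t2 i o :=
  Rel.cast t2_eq (((h1.comp h2).trim _).ren _)

def g45 : List Edge :=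
  [(11,1,1,181), (15,1,0,170), (3,1,1,177), (2,1,1,168), (13,1,0,168), (2,1,1,180), (13,1,0,180),
   (12,1,1,178), (16,1,1,167), (5,1,0,176), (44,1,1,16), (48,1,0,5), (36,1,1,12), (35,1,1,3), (46,1,0,3),
   (35,1,1,15), (46,1,0,15), (45,1,1,13), (49,1,1,2), (38,1,0,11), (176,1,1,164), (180,1,0,153),
   (168,1,1,160), (167,1,1,151), (178,1,0,151), (167,1,1,163), (178,1,0,163), (177,1,1,161), (181,1,1,150),
   (170,1,0,159), (209,0,1,181), (213,0,0,170), (201,0,1,177), (200,0,1,168), (211,0,0,168), (200,0,1,180),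
   (211,0,0,180), (210,0,1,178), (214,0,1,167), (203,0,0,176), (152,0,0,5), (140,0,1,12), (154,0,0,14),
   (143,0,0,8), (143,0,0,20), (126,0,1,49), (130,0,0,38), (118,0,1,45), (117,0,1,36), (128,0,0,36),
   (117,0,1,48), (128,0,0,48), (127,0,1,46), (131,0,1,35), (120,0,0,44), (93,0,1,131), (97,0,0,120),
   (85,0,1,127), (84,0,1,118), (95,0,0,118), (84,0,1,130), (95,0,0,130), (94,0,1,128), (98,0,1,117),
   (87,0,0,126), (87,0,0,143), (54,0,0,154), (60,0,0,140), (60,0,0,152), (48,0,0,54), (38,0,0,60),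
   (176,0,1,98), (180,0,0,87), (168,0,1,94), (167,0,1,85), (178,0,0,85), (167,0,1,97), (178,0,0,97),
   (177,0,1,95), (181,0,1,84), (170,0,0,93), (159,0,1,214), (163,0,0,203), (151,0,1,210), (150,0,1,201),
   (161,0,0,201), (150,0,1,213), (161,0,0,213), (160,0,1,211), (164,0,1,200), (153,0,0,209), (20,0,0,203),
   (8,0,1,210), (14,0,0,211)]

theorem g45_eq : ren 215 (trim 3 (comp 33 g4 g5)) = g45 := by decide +kernel

theorem rel_g45 {i m o : ℤ → ℕ} (h1 : Rel g4 i m) (h2 : Rel g5 m o) : Rel g45 i o :=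
  Rel.cast g45_eq (((h1.comp h2).trim _).ren _)

def g454 : List Edge :=
  [(29,1,1,256), (70,1,1,198), (202,1,1,70), (205,1,1,29), (198,1,1,53), (254,1,1,314), (253,1,0,314),
   (102,1,1,5), (226,1,1,50), (211,0,1,257), (238,0,0,101), (244,0,1,102), (107,0,1,256), (238,0,0,245),
   (244,0,1,246), (235,0,1,253), (239,0,1,254), (222,0,1,226), (148,0,1,198), (301,0,1,70), (325,0,1,178),
   (317,0,1,176), (321,0,1,177), (316,0,0,174), (194,0,1,97), (185,0,1,248), (189,0,1,249), (364,0,1,205),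
   (39,0,1,79), (260,0,1,204), (9,0,1,202), (15,0,1,199), (247,0,1,39), (362,0,1,9), (367,0,1,15),
   (27,0,1,260), (288,0,1,364), (284,0,1,189), (288,0,1,185), (286,0,0,194), (271,0,1,321), (269,0,0,316),
   (275,0,1,317), (270,0,1,325), (342,0,1,301), (199,0,1,270), (202,0,1,275), (202,0,1,269), (204,0,1,271),
   (79,0,1,342), (198,0,1,27), (254,0,1,288), (253,0,0,288), (246,0,1,286), (256,0,1,284), (245,0,0,284),
   (101,0,1,367), (102,0,1,362), (257,0,1,247), (50,0,1,148), (5,0,1,239), (53,0,1,107), (314,0,1,211),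
   (249,0,1,148), (248,0,0,148), (97,0,1,222), (174,0,1,239), (178,0,1,235), (177,0,1,244), (176,0,0,244),
   (177,0,1,238), (176,0,0,238)]

theorem g454_eq : ren 383 (trim 9 (comp 12 g45 g4)) = g454 := by decide +kernel

theorem rel_g454 {i m o : ℤ → ℕ} (h1 : Rel g45 i m) (h2 : Rel g4 m o) : Rel g454 i o :=
  Rel.cast g454_eq (((h1.comp h2).trim _).ren _)

def g4545 : List Edge :=
  [(968,1,1,2080), (972,1,0,2069), (960,1,1,2076), (959,1,1,2067), (970,1,0,2067), (959,1,1,2079),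
   (970,1,0,2079), (969,1,1,2077), (973,1,1,2066), (962,1,0,2075), (193,1,1,166), (197,1,0,155),
   (185,1,1,162), (184,1,1,153), (195,1,0,153), (184,1,1,165), (195,1,0,165), (194,1,1,163), (198,1,1,152),
   (187,1,0,161), (293,1,1,198), (297,1,0,187), (285,1,1,194), (284,1,1,185), (295,1,0,185), (284,1,1,197),
   (295,1,0,197), (294,1,1,195), (298,1,1,184), (287,1,0,193), (392,1,1,973), (396,1,0,962), (384,1,1,969),
   (383,1,1,960), (394,1,0,960), (383,1,1,972), (394,1,0,972), (393,1,1,970), (397,1,1,959), (386,1,0,968),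
   (161,1,1,1765), (165,1,0,1754), (153,1,1,1761), (152,1,1,1752), (163,1,0,1752), (152,1,1,1764),
   (163,1,0,1764), (162,1,1,1762), (166,1,1,1751), (155,1,0,1760), (2009,1,1,1866), (2013,1,0,1855),
   (2001,1,1,1862), (2000,1,1,1853), (2011,1,0,1853), (2000,1,1,1865), (2011,1,0,1865), (2010,1,1,1863),
   (2014,1,1,1852), (2003,1,0,1861), (1249,1,1,181), (1253,1,0,170), (1241,1,1,177), (1240,1,1,168),
   (1251,1,0,168), (1240,1,1,180), (1251,1,0,180), (1250,1,1,178), (1254,1,1,167), (1243,1,0,176),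
   (590,0,1,2113), (594,0,0,2102), (582,0,1,2109), (581,0,1,2100), (592,0,0,2100), (581,0,1,2112),
   (592,0,0,2112), (591,0,1,2110), (595,0,1,2099), (584,0,0,2108), (1679,0,1,1254), (1683,0,0,1243),
   (1671,0,1,1250), (1670,0,1,1241), (1681,0,0,1241), (1670,0,1,1253), (1681,0,0,1253), (1680,0,1,1251),
   (1684,0,1,1240), (1673,0,0,1249), (1414,0,1,2080), (1418,0,0,2069), (1406,0,1,2076), (1405,0,1,2067),
   (1416,0,0,2067), (1405,0,1,2079), (1416,0,0,2079), (1415,0,1,2077), (1419,0,1,2066), (1408,0,0,2075),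
   (1492,0,0,1715), (1481,0,0,1709), (1481,0,0,1721), (1514,0,1,2014), (1518,0,0,2003), (1506,0,1,2010),
   (1505,0,1,2001), (1516,0,0,2001), (1505,0,1,2013), (1516,0,0,2013), (1515,0,1,2011), (1519,0,1,2000),
   (1508,0,0,2009), (639,0,1,166), (643,0,0,155), (631,0,1,162), (630,0,1,153), (641,0,0,153), (630,0,1,165),
   (641,0,0,165), (640,0,1,163), (644,0,1,152), (633,0,0,161), (1432,0,1,198), (1436,0,0,187), (1424,0,1,194),
   (1423,0,1,185), (1434,0,0,185), (1423,0,1,197), (1434,0,0,197), (1433,0,1,195), (1437,0,1,184),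
   (1426,0,0,193), (1964,0,0,1557), (2092,0,1,1601), (2096,0,0,1590), (2084,0,1,1597), (2083,0,1,1588),
   (2094,0,0,1588), (2083,0,1,1600), (2094,0,0,1600), (2093,0,1,1598), (2097,0,1,1587), (2086,0,0,1596),
   (1936,0,0,1491), (1924,0,1,1498), (1992,0,1,1849), (1996,0,0,1838), (1984,0,1,1845), (1983,0,1,1836),
   (1994,0,0,1836), (1983,0,1,1848), (1994,0,0,1848), (1993,0,1,1846), (1997,0,1,1835), (1986,0,0,1844),
   (1383,0,1,397), (1387,0,0,386), (1375,0,1,393), (1374,0,1,384), (1385,0,0,384), (1374,0,1,396),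
   (1385,0,0,396), (1384,0,1,394), (1388,0,1,383), (1377,0,0,392), (1298,0,1,495), (1302,0,0,484),
   (1290,0,1,491), (1289,0,1,482), (1300,0,0,482), (1289,0,1,494), (1300,0,0,494), (1299,0,1,492),
   (1303,0,1,481), (1292,0,0,490), (79,0,1,364), (83,0,0,353), (71,0,1,360), (70,0,1,351), (81,0,0,351),
   (70,0,1,363), (81,0,0,363), (80,0,1,361), (84,0,1,350), (73,0,0,359), (308,0,1,298), (312,0,0,287),
   (300,0,1,294), (299,0,1,285), (310,0,0,285), (299,0,1,297), (310,0,0,297), (309,0,1,295), (313,0,1,284),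
   (302,0,0,293), (1778,0,1,1303), (1782,0,0,1292), (1770,0,1,1299), (1769,0,1,1290), (1780,0,0,1290),
   (1769,0,1,1302), (1780,0,0,1302), (1779,0,1,1300), (1783,0,1,1289), (1772,0,0,1298), (1317,0,1,313),
   (1321,0,0,302), (1309,0,1,309), (1308,0,1,300), (1319,0,0,300), (1308,0,1,312), (1319,0,0,312),
   (1318,0,1,310), (1322,0,1,299), (1311,0,0,308), (902,0,1,84), (906,0,0,73), (894,0,1,80), (893,0,1,71),
   (904,0,0,71), (893,0,1,83), (904,0,0,83), (903,0,1,81), (907,0,1,70), (896,0,0,79), (1003,0,1,1388),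
   (1007,0,0,1377), (995,0,1,1384), (994,0,1,1375), (1005,0,0,1375), (994,0,1,1387), (1005,0,0,1387),
   (1004,0,1,1385), (1008,0,1,1374), (997,0,0,1383), (871,0,1,1997), (875,0,0,1986), (863,0,1,1993),
   (862,0,1,1984), (873,0,0,1984), (862,0,1,1996), (873,0,0,1996), (872,0,1,1994), (876,0,1,1983),
   (865,0,0,1992), (442,0,1,2097), (446,0,0,2086), (434,0,1,2093), (433,0,1,2084), (444,0,0,2084),
   (433,0,1,2096), (444,0,0,2096), (443,0,1,2094), (447,0,1,2083), (436,0,0,2092), (376,0,0,1924),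
   (376,0,0,1936), (565,0,1,1964), (576,0,0,1964), (657,0,1,1437), (661,0,0,1426), (649,0,1,1433),
   (648,0,1,1424), (659,0,0,1424), (648,0,1,1436), (659,0,0,1436), (658,0,1,1434), (662,0,1,1423),
   (651,0,0,1432), (294,0,1,576), (298,0,1,565), (287,0,0,376), (359,0,1,447), (363,0,0,436), (351,0,1,443),
   (350,0,1,434), (361,0,0,434), (350,0,1,446), (361,0,0,446), (360,0,1,444), (364,0,1,433), (353,0,0,442),
   (490,0,1,662), (494,0,0,651), (482,0,1,658), (481,0,1,649), (492,0,0,649), (481,0,1,661), (492,0,0,661),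
   (491,0,1,659), (495,0,1,648), (484,0,0,657), (161,0,1,907), (165,0,0,896), (153,0,1,903), (152,0,1,894),
   (163,0,0,894), (152,0,1,906), (163,0,0,906), (162,0,1,904), (166,0,1,893), (155,0,0,902), (2009,0,1,1008),
   (2013,0,0,997), (2001,0,1,1004), (2000,0,1,995), (2011,0,0,995), (2000,0,1,1007), (2011,0,0,1007),
   (2010,0,1,1005), (2014,0,1,994), (2003,0,0,1003), (2075,0,1,876), (2079,0,0,865), (2067,0,1,872),
   (2066,0,1,863), (2077,0,0,863), (2066,0,1,875), (2077,0,0,875), (2076,0,1,873), (2080,0,1,862),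
   (2069,0,0,871), (1721,0,0,865), (1709,0,1,872), (1715,0,0,873), (1249,0,1,1322), (1253,0,0,1311),
   (1241,0,1,1318), (1240,0,1,1309), (1251,0,0,1309), (1240,0,1,1321), (1251,0,0,1321), (1250,0,1,1319),
   (1254,0,1,1308), (1243,0,0,1317), (2108,0,1,1783), (2112,0,0,1772), (2100,0,1,1779), (2099,0,1,1770),
   (2110,0,0,1770), (2099,0,1,1782), (2110,0,0,1782), (2109,0,1,1780), (2113,0,1,1769), (2102,0,0,1778),
   (176,0,1,1519), (180,0,0,1508), (168,0,1,1515), (167,0,1,1506), (178,0,0,1506), (167,0,1,1518),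
   (178,0,0,1518), (177,0,1,1516), (181,0,1,1505), (170,0,0,1514), (1760,0,1,1419), (1764,0,0,1408),
   (1752,0,1,1415), (1751,0,1,1406), (1762,0,0,1406), (1751,0,1,1418), (1762,0,0,1418), (1761,0,1,1416),
   (1765,0,1,1405), (1754,0,0,1414), (1861,0,1,595), (1865,0,0,584), (1853,0,1,591), (1852,0,1,582),
   (1863,0,0,582), (1852,0,1,594), (1863,0,0,594), (1862,0,1,592), (1866,0,1,581), (1855,0,0,590),
   (1844,0,1,644), (1848,0,0,633), (1836,0,1,640), (1835,0,1,631), (1846,0,0,631), (1835,0,1,643),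
   (1846,0,0,643), (1845,0,1,641), (1849,0,1,630), (1838,0,0,639), (1498,0,1,1516), (1491,0,0,1514),
   (1596,0,1,1684), (1600,0,0,1673), (1588,0,1,1680), (1587,0,1,1671), (1598,0,0,1671), (1587,0,1,1683),
   (1598,0,0,1683), (1597,0,1,1681), (1601,0,1,1670), (1590,0,0,1679), (1590,0,0,1481), (1557,0,0,1492)]

theorem g4545_eq : ren 2128 (trim 14 (comp 33 g454 g5)) = g4545 := by decide +kernel

theorem rel_g4545 {i m o : ℤ → ℕ} (h1 : Rel g454 i m) (h2 : Rel g5 m o) : Rel g4545 i o :=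
  Rel.cast g4545_eq (((h1.comp h2).trim _).ren _)

def fg : List Edge :=
  [(6,0,1,5), (4,0,0,0), (10,0,1,1), (9,0,1,10), (8,0,0,10), (9,0,1,4), (8,0,0,4), (1,0,1,8), (5,0,1,9),
   (0,0,0,6), (0,1,1,17), (1,1,1,12), (12,1,1,7), (17,1,1,13), (7,1,1,3), (7,0,1,9), (13,0,1,6), (3,0,1,6)]

theorem fg_eq : ren 22 (trim 3 (comp 12 f1 g4)) = fg := by decide +kernel

theorem rel_fg {i m o : ℤ → ℕ} (h1 : Rel f1 i m) (h2 : Rel g4 m o) : Rel fg i o :=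
  Rel.cast fg_eq (((h1.comp h2).trim _).ren _)

def f45 : List Edge :=
  [(209,0,1,181), (213,0,0,170), (201,0,1,177), (200,0,1,168), (211,0,0,168), (200,0,1,180), (211,0,0,180),
   (210,0,1,178), (214,0,1,167), (203,0,0,176), (152,0,0,5), (140,0,1,12), (154,0,0,14), (143,0,0,8),
   (143,0,0,20), (93,0,1,49), (97,0,0,38), (85,0,1,45), (84,0,1,36), (95,0,0,36), (84,0,1,48), (95,0,0,48),
   (94,0,1,46), (98,0,1,35), (87,0,0,44), (60,0,1,98), (64,0,0,87), (52,0,1,94), (51,0,1,85), (62,0,0,85),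
   (51,0,1,97), (62,0,0,97), (61,0,1,95), (65,0,1,84), (54,0,0,93), (54,0,0,143), (21,0,0,154), (27,0,0,140),
   (27,0,0,152), (48,0,0,21), (38,0,0,27), (176,0,1,65), (180,0,0,54), (168,0,1,61), (167,0,1,52),
   (178,0,0,52), (167,0,1,64), (178,0,0,64), (177,0,1,62), (181,0,1,51), (170,0,0,60), (20,0,0,203),
   (8,0,1,210), (14,0,0,211), (12,1,1,78), (5,1,0,76), (44,1,1,164), (48,1,0,153), (36,1,1,160), (35,1,1,151),
   (46,1,0,151), (35,1,1,163), (46,1,0,163), (45,1,1,161), (49,1,1,150), (38,1,0,159), (159,1,1,247),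
   (163,1,0,236), (151,1,1,243), (150,1,1,234), (161,1,0,234), (150,1,1,246), (161,1,0,246), (160,1,1,244),
   (164,1,1,233), (153,1,0,242), (76,1,1,197), (78,1,0,184), (78,1,0,196), (242,1,1,115), (246,1,0,104),
   (234,1,1,111), (233,1,1,102), (244,1,0,102), (233,1,1,114), (244,1,0,114), (243,1,1,112), (247,1,1,101),
   (236,1,0,110), (242,0,1,65), (246,0,0,54), (234,0,1,61), (233,0,1,52), (244,0,0,52), (233,0,1,64),
   (244,0,0,64), (243,0,1,62), (247,0,1,51), (236,0,0,60), (196,0,0,203), (184,0,1,210), (197,0,1,200),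
   (110,0,1,214), (114,0,0,203), (102,0,1,210), (101,0,1,201), (112,0,0,201), (101,0,1,213), (112,0,0,213),
   (111,0,1,211), (115,0,1,200), (104,0,0,209)]

theorem f45_eq : ren 248 (trim 5 (comp 33 fg g5)) = f45 := by decide +kernel

theorem rel_f45 {i m o : ℤ → ℕ} (h1 : Rel fg i m) (h2 : Rel g5 m o) : Rel f45 i o :=
  Rel.cast f45_eq (((h1.comp h2).trim _).ren _)

def f454 : List Edge :=
  [(66,0,0,40), (72,0,1,41), (182,0,1,195), (66,0,0,184), (63,0,1,192), (67,0,1,193), (223,0,1,137),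
   (128,0,1,178), (120,0,1,176), (124,0,1,177), (119,0,0,174), (235,0,1,1), (239,0,1,2), (129,0,1,94),
   (25,0,1,93), (157,0,1,91), (163,0,1,88), (238,0,1,157), (243,0,1,163), (39,0,1,25), (164,0,1,129),
   (160,0,1,239), (164,0,1,235), (11,0,1,124), (9,0,0,119), (15,0,1,120), (10,0,1,128), (88,0,1,10),
   (91,0,1,15), (91,0,1,9), (93,0,1,11), (137,0,1,39), (193,0,1,164), (192,0,0,164), (195,0,1,160),
   (184,0,0,160), (40,0,1,243), (41,0,1,238), (2,0,1,223), (1,0,0,223), (174,0,1,67), (178,0,1,63),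
   (177,0,1,72), (176,0,0,72), (177,0,1,66), (176,0,0,66), (91,1,1,117), (94,1,1,76), (76,1,1,246),
   (117,1,1,188), (188,1,1,145), (188,0,1,39), (246,0,1,160), (145,0,1,182)]

theorem f454_eq : ren 247 (trim 16 (comp 12 f45 g4)) = f454 := by decide +kernel

theorem rel_f454 {i m o : ℤ → ℕ} (h1 : Rel f45 i m) (h2 : Rel g4 m o) : Rel f454 i o :=
  Rel.cast f454_eq (((h1.comp h2).trim _).ren _)

def t3 : List Edge :=
  [(26,0,1,33), (73,0,1,125), (2,0,0,82), (3,0,0,83), (6,0,1,117), (106,0,1,24), (87,0,1,49), (103,0,1,53),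
   (84,0,0,43), (39,0,1,8), (123,0,1,114), (100,0,1,110), (104,0,1,102), (35,0,1,104), (25,0,1,100),
   (1,0,1,123), (116,0,1,39), (118,0,1,39), (119,0,1,39), (44,0,1,103), (36,0,0,84), (60,0,1,87),
   (102,0,1,60), (102,0,1,36), (110,0,1,44), (24,0,1,25), (117,0,1,1), (125,0,1,116), (82,0,0,118),
   (83,0,0,119), (33,0,1,35), (8,0,1,106), (43,0,1,6), (53,0,1,26), (53,0,1,2), (49,0,0,3), (102,1,1,75),
   (114,1,1,42), (42,1,1,67), (75,1,1,97), (97,1,1,56), (97,0,1,25), (67,0,1,116), (56,0,1,73)]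

theorem t3_eq : ren 131 (trim 10 (comp 4 f454 f0)) = t3 := by decide +kernel

theorem rel_t3 {i m o : ℤ → ℕ} (h1 : Rel f454 i m) (h2 : Rel f0 m o) : Rel t3 i o :=
  Rel.cast t3_eq (((h1.comp h2).trim _).ren _)

def t1 : List Edge :=
  [(24,0,1,20), (26,0,1,20), (27,0,1,20), (16,0,0,1), (17,0,0,2), (11,0,1,4), (7,0,1,11), (7,0,1,16),
   (3,0,0,17), (4,0,1,3), (20,0,1,7), (1,0,0,26), (2,0,0,27), (2,1,1,10), (4,1,1,19), (19,1,1,28),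
   (10,1,1,23), (28,1,1,12), (28,0,1,7), (23,0,1,24), (12,0,1,24)]

theorem t1_eq : ren 29 (trim 3 (comp 4 fg f0)) = t1 := by decide +kernel

theorem rel_t1 {i m o : ℤ → ℕ} (h1 : Rel fg i m) (h2 : Rel f0 m o) : Rel t1 i o :=
  Rel.cast t1_eq (((h1.comp h2).trim _).ren _)

theorem e00000_eq : trim 3 (comp 39 row0 g0000) = [] := by decide +kernel

theorem rel_e00000 {i m o : ℤ → ℕ} (h1 : Rel row0 i m) (h2 : Rel g0000 m o) : False :=
  (Rel.cast e00000_eq ((h1.comp h2).trim _)).nil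

theorem e11_eq : trim 0 (comp 4 row1 row1) = [] := by decide +kernel

theorem rel_e11 {i m o : ℤ → ℕ} (h1 : Rel row1 i m) (h2 : Rel row1 m o) : False :=
  (Rel.cast e11_eq ((h1.comp h2).trim _)).nil

def g10 : List Edge :=
  [(1,1,2,1), (3,0,2,1), (0,0,1,3), (1,0,2,0), (1,0,3,3)]

theorem g10_eq : ren 4 (trim 0 (comp 4 row1 row0)) = g10 := by decide +kernel

theorem rel_g10 {i m o : ℤ → ℕ} (h1 : Rel row1 i m) (h2 : Rel row0 m o) : Rel g10 i o :=
  Rel.cast g10_eq (((h1.comp h2).trim _).ren _)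

theorem e101_eq : trim 1 (comp 4 g10 row1) = [] := by decide +kernel

theorem rel_e101 {i m o : ℤ → ℕ} (h1 : Rel g10 i m) (h2 : Rel row1 m o) : False :=
  (Rel.cast e101_eq ((h1.comp h2).trim _)).nil

def g100 : List Edge :=
  [(7,1,2,5), (4,1,1,7), (5,1,2,4), (5,1,3,7), (1,0,2,5), (12,0,1,7), (13,0,2,4), (13,0,3,7), (3,0,1,13),
   (3,0,1,12), (0,0,0,12), (4,0,1,3), (5,0,2,0), (5,0,3,3), (7,0,1,1)]

theorem g100_eq : ren 14 (trim 1 (comp 4 g10 row0)) = g100 := by decide +kernel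

theorem rel_g100 {i m o : ℤ → ℕ} (h1 : Rel g10 i m) (h2 : Rel row0 m o) : Rel g100 i o :=
  Rel.cast g100_eq (((h1.comp h2).trim _).ren _)

theorem e1001_eq : trim 2 (comp 4 g100 row1) = [] := by decide +kernel

theorem rel_e1001 {i m o : ℤ → ℕ} (h1 : Rel g100 i m) (h2 : Rel row1 m o) : False :=
  (Rel.cast e1001_eq ((h1.comp h2).trim _)).nil

theorem e44_eq : trim 6 (comp 12 g4 g4) = [] := by decide +kernel

theorem rel_e44 {i m o : ℤ → ℕ} (h1 : Rel g4 i m) (h2 : Rel g4 m o) : False :=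
  (Rel.cast e44_eq ((h1.comp h2).trim _)).nil

theorem e555_eq : trim 9 (comp 33 t2 g5) = [] := by decide +kernel

theorem rel_e555 {i m o : ℤ → ℕ} (h1 : Rel t2 i m) (h2 : Rel g5 m o) : False :=
  (Rel.cast e555_eq ((h1.comp h2).trim _)).nil

theorem e45454_eq : trim 17 (comp 12 g4545 g4) = [] := by decide +kernel

theorem rel_e45454 {i m o : ℤ → ℕ} (h1 : Rel g4545 i m) (h2 : Rel g4 m o) : False :=
  (Rel.cast e45454_eq ((h1.comp h2).trim _)).nil

def w1 : Blk → List (ℕ × ℕ)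
  | us => List.zip [0, 0, 0, 0, 0]
      [1, 0, 0, 1, 1]
  | ul => List.zip [0, 0, 0, 0, 0, 0, 0, 0]
      [1, 1, 1, 0, 0, 0, 1, 1]
  | ds => List.zip [0, 0, 1, 1, 0]
      [1, 1, 1, 1, 1]
  | dl => List.zip [0, 0, 1, 1, 1, 0, 0, 0]
      [1, 1, 1, 1, 1, 1, 1, 1]
  | c => List.zip [0, 0, 0, 0, 0, 1, 1, 0, 0, 0]
      [1, 1, 1, 0, 0, 1, 1, 1, 1, 1]

theorem w1_ok : HubOK t1 7 11 w1 := ⟨by decide +kernel, by decide +kernel, by decide +kernel⟩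

def w2 : Blk → List (ℕ × ℕ)
  | us => List.zip [1, 1, 1, 1, 1, 1, 1, 1]
      [0, 1, 1, 0, 0, 0, 0, 0]
  | ul => List.zip [1, 1, 1, 1, 1, 1, 1, 1, 1, 1, 1, 1, 1]
      [0, 0, 0, 0, 0, 0, 1, 1, 1, 0, 0, 0, 0]
  | ds => List.zip [1, 1, 1, 1, 1, 0, 0, 1]
      [0, 0, 0, 0, 0, 0, 0, 0]
  | dl => List.zip [1, 1, 1, 1, 0, 0, 0, 1, 1, 1, 1, 1, 1]
      [0, 0, 0, 0, 0, 0, 0, 0, 0, 0, 0, 0, 0]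
  | c => List.zip [1, 1, 1, 1, 1, 1, 1, 1, 1, 1, 0, 0, 1, 1, 1, 1]
      [0, 0, 0, 0, 1, 1, 0, 0, 0, 0, 0, 0, 0, 0, 0, 0]

theorem w2_ok : HubOK t2 60 17 w2 := ⟨by decide +kernel, by decide +kernel, by decide +kernel⟩

def w3 : Blk → List (ℕ × ℕ)
  | us => List.zip [0, 0, 0, 0, 0, 0, 0, 0, 0, 0, 0, 0, 0]
      [1, 1, 1, 1, 0, 0, 1, 1, 1, 1, 1, 1, 1]
  | ul => List.zip [0, 0, 0, 0, 0, 0, 0, 0, 0, 0, 0, 0, 0, 0, 0, 0, 0, 0, 0, 0, 0]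
      [1, 1, 1, 1, 1, 1, 1, 1, 1, 1, 1, 0, 0, 0, 1, 1, 1, 1, 1, 1, 1]
  | ds => List.zip [0, 0, 0, 0, 0, 0, 0, 0, 1, 1, 0, 0, 0]
      [1, 1, 1, 1, 1, 1, 1, 1, 1, 1, 1, 1, 1]
  | dl => List.zip [0, 0, 0, 0, 0, 0, 0, 0, 1, 1, 1, 0, 0, 0, 0, 0, 0, 0, 0, 0, 0]
      [1, 1, 1, 1, 1, 1, 1, 1, 1, 1, 1, 1, 1, 1, 1, 1, 1, 1, 1, 1, 1]
  | c => List.zip [0, 0, 0, 0, 0, 0, 0, 0, 0, 0, 0, 0, 0, 0, 0, 0, 1, 1, 0, 0, 0, 0, 0, 0, 0, 0]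
      [1, 1, 1, 1, 1, 1, 1, 1, 1, 0, 0, 1, 1, 1, 1, 1, 1, 1, 1, 1, 1, 1, 1, 1, 1, 1]

theorem w3_ok : HubOK t3 110 27 w3 := ⟨by decide +kernel, by decide +kernel, by decide +kernel⟩

def MI1 (W : ℤ → ℕ) : Marks
  | false, x => At W x [0, 1, 1, 0]
  | true, x => At W x [0, 1, 1, 1, 0]

def MI0 (W : ℤ → ℕ) : Marks
  | false, x => At W (x - 2) [1, 0, 0, 1]
  | true, x => At W (x - 3) [1, 0, 0, 0, 1]


end JR

namespace JR
open Blk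

theorem R_t1 {W V : ℤ → ℕ} (h : Rel t1 W V) : R 5 8 1 (-3) (MI1 W) (MI0 V) := by
  obtain ⟨st, hr⟩ := h
  refine ⟨_, w1_ok.row hr (fun β => by cases β <;> rfl), fun x => ?_, fun x => ?_, fun x => ?_, fun x => ?_⟩
  · have := w1_ok.pat hr Prod.fst (l := [0, 1, 1, 0]) (ex := [(ds, 1), (c, 4)]) (by decide +kernel) (x + 1)
    simp only [List.mem_cons, List.not_mem_nil, or_false, exists_eq_or_imp, exists_eq_left] at this
    refine this.trans ?_
    push_cast
    ring_nf
  · have := w1_ok.pat hr Prod.fst (l := [0, 1, 1, 1, 0]) (ex := [(dl, 1)]) (by decide +kernel) (x + 1)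
    simp only [List.mem_cons, List.not_mem_nil, or_false, exists_eq_left] at this
    refine this.trans ?_
    push_cast
    ring_nf
  · have := w1_ok.pat hr Prod.snd (l := [1, 0, 0, 1]) (ex := [(us, 0), (c, 2)]) (by decide +kernel) (x + -3 - 2)
    simp only [List.mem_cons, List.not_mem_nil, or_false, exists_eq_or_imp, exists_eq_left] at this
    refine this.trans ?_
    push_cast
    ring_nf
  · have := w1_ok.pat hr Prod.snd (l := [1, 0, 0, 0, 1]) (ex := [(ul, 2)]) (by decide +kernel) (x + -3 - 3)
    simp only [List.mem_cons, List.not_mem_nil, or_false, exists_eq_left] at this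
    refine this.trans ?_
    push_cast
    ring_nf

theorem R_t2 {W V : ℤ → ℕ} (h : Rel t2 W V) : R 8 13 6 (-8) (MI0 W) (MI1 V) := by
  obtain ⟨st, hr⟩ := h
  refine ⟨_, w2_ok.row hr (fun β => by cases β <;> rfl), fun x => ?_, fun x => ?_, fun x => ?_, fun x => ?_⟩
  · have := w2_ok.pat hr Prod.fst (l := [1, 0, 0, 1]) (ex := [(ds, 4), (c, 9)]) (by decide +kernel) (x + 6 - 2)
    simp only [List.mem_cons, List.not_mem_nil, or_false, exists_eq_or_imp, exists_eq_left] at this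
    refine this.trans ?_
    push_cast
    ring_nf
  · have := w2_ok.pat hr Prod.fst (l := [1, 0, 0, 0, 1]) (ex := [(dl, 3)]) (by decide +kernel) (x + 6 - 3)
    simp only [List.mem_cons, List.not_mem_nil, or_false, exists_eq_left] at this
    refine this.trans ?_
    push_cast
    ring_nf
  · have := w2_ok.pat hr Prod.snd (l := [0, 1, 1, 0]) (ex := [(us, 0), (c, 3)]) (by decide +kernel) (x + -8)
    simp only [List.mem_cons, List.not_mem_nil, or_false, exists_eq_or_imp, exists_eq_left] at this
    refine this.trans ?_
    push_cast
    ring_nf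
  · have := w2_ok.pat hr Prod.snd (l := [0, 1, 1, 1, 0]) (ex := [(ul, 5)]) (by decide +kernel) (x + -8)
    simp only [List.mem_cons, List.not_mem_nil, or_false, exists_eq_left] at this
    refine this.trans ?_
    push_cast
    ring_nf

theorem R_t3 {W V : ℤ → ℕ} (h : Rel t3 W V) : R 13 21 7 (-8) (MI1 W) (MI0 V) := by
  obtain ⟨st, hr⟩ := h
  refine ⟨_, w3_ok.row hr (fun β => by cases β <;> rfl), fun x => ?_, fun x => ?_, fun x => ?_, fun x => ?_⟩
  · have := w3_ok.pat hr Prod.fst (l := [0, 1, 1, 0]) (ex := [(ds, 7), (c, 15)]) (by decide +kernel) (x + 7)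
    simp only [List.mem_cons, List.not_mem_nil, or_false, exists_eq_or_imp, exists_eq_left] at this
    refine this.trans ?_
    push_cast
    ring_nf
  · have := w3_ok.pat hr Prod.fst (l := [0, 1, 1, 1, 0]) (ex := [(dl, 7)]) (by decide +kernel) (x + 7)
    simp only [List.mem_cons, List.not_mem_nil, or_false, exists_eq_left] at this
    refine this.trans ?_
    push_cast
    ring_nf
  · have := w3_ok.pat hr Prod.snd (l := [1, 0, 0, 1]) (ex := [(us, 3), (c, 8)]) (by decide +kernel) (x + -8 - 2)
    simp only [List.mem_cons, List.not_mem_nil, or_false, exists_eq_or_imp, exists_eq_left] at this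
    refine this.trans ?_
    push_cast
    ring_nf
  · have := w3_ok.pat hr Prod.snd (l := [1, 0, 0, 0, 1]) (ex := [(ul, 10)]) (by decide +kernel) (x + -8 - 3)
    simp only [List.mem_cons, List.not_mem_nil, or_false, exists_eq_left] at this
    refine this.trans ?_
    push_cast
    ring_nf

theorem t2_in {W V : ℤ → ℕ} (h : Rel t2 W V) : (∀ x, ¬ At W x [1, 0, 1]) ∧ ∀ x, ¬ At W x [0, 0, 0, 0] := by
  obtain ⟨st, hr⟩ := h
  refine ⟨fun x hx => ?_, fun x hx => ?_⟩
  · have := (w2_ok.pat hr Prod.fst (l := [1, 0, 1]) (ex := []) (by decide +kernel) x).1 hx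
    simp at this
  · have := (w2_ok.pat hr Prod.fst (l := [0, 0, 0, 0]) (ex := []) (by decide +kernel) x).1 hx
    simp at this

theorem t2_out {W V : ℤ → ℕ} (h : Rel t2 W V) : (∀ x, ¬ At V x [0, 1, 0]) ∧ ∀ x, ¬ At V x [1, 1, 1, 1] := by
  obtain ⟨st, hr⟩ := h
  refine ⟨fun x hx => ?_, fun x hx => ?_⟩
  · have := (w2_ok.pat hr Prod.snd (l := [0, 1, 0]) (ex := []) (by decide +kernel) x).1 hx
    simp at this
  · have := (w2_ok.pat hr Prod.snd (l := [1, 1, 1, 1]) (ex := []) (by decide +kernel) x).1 hx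
    simp at this

theorem MI1.per {p : ℤ} {W : ℤ → ℕ} (h : ∀ x, W (x + p) = W x) : Per p (MI1 W) := by
  intro t x
  cases t <;> simp only [MI1, At, show ∀ y : ℤ, x + p + y = x + y + p from fun y => by ring,
    show ∀ y z : ℤ, x + y + p + z = x + y + z + p from fun y z => by ring,
    show ∀ y z u : ℤ, x + y + z + p + u = x + y + z + u + p from fun y z u => by ring,
    show ∀ y z u v : ℤ, x + y + z + u + p + v = x + y + z + u + v + p from fun y z u v => by ring, h]

theorem MI0.per {p : ℤ} {W : ℤ → ℕ} (h : ∀ x, W (x + p) = W x) : Per p (MI0 W) := by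
  intro t x
  cases t <;> simp only [MI0, At, show ∀ y : ℤ, x + p - y = x - y + p from fun y => by ring,
    show ∀ y z : ℤ, x - y + p + z = x - y + z + p from fun y z => by ring,
    show ∀ y z u : ℤ, x - y + z + p + u = x - y + z + u + p from fun y z u => by ring,
    show ∀ y z u v : ℤ, x - y + z + u + p + v = x - y + z + u + v + p from fun y z u v => by ring,
    show ∀ y z u v w : ℤ, x - y + z + u + v + p + w = x - y + z + u + v + w + p from
      fun y z u v w => by ring, h]

/-- the sequence of interfaces with gaps `4` and `5` is impossible -/
theorem no_seq {p : ℤ} (hp : 0 < p) (W : ℕ → ℤ → ℕ) (T : ℕ → Bool)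
    (h01 : ∀ k x, W k x = 0 ∨ W k x = 1) (hper : ∀ k x, W k (x + p) = W k x)
    (hR : ∀ k, (T k = true → Rel g5 (W k) (W (k + 1))) ∧ (T k = false → Rel g4 (W k) (W (k + 1)))) : False := by
  have n44 : ∀ k, T k = false → T (k + 1) = true := by
    intro k h
    by_contra h'
    exact rel_e44 ((hR k).2 h) ((hR (k + 1)).2 (by simpa using h'))
  have n555 : ∀ k, T k = true → T (k + 1) = true → T (k + 2) = false := by
    intro k h h1
    by_contra h'
    exact rel_e555 (rel_t2 ((hR k).1 h) ((hR (k + 1)).1 h1)) ((hR (k + 2)).1 (by simpa using h'))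
  have n45454 : ∀ k, T k = false → T (k + 1) = true → T (k + 2) = false → T (k + 3) = true → T (k + 4) = true := by
    intro k h h1 h2 h3
    by_contra h'
    exact rel_e45454 (rel_g4545 (rel_g454 (rel_g45 ((hR k).2 h) ((hR (k + 1)).1 h1)) ((hR (k + 2)).2 h2))
      ((hR (k + 3)).1 h3)) ((hR (k + 4)).2 (by simpa using h'))
  -- a first `55`
  have e0 : ∃ k, T k = true ∧ T (k + 1) = true := by
    by_contra hno
    have alt : ∀ k, T k = true → T (k + 1) = false := by
      intro k h
      by_contra h'
      exact hno ⟨k, h, by simpa using h'⟩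
    have : ∃ k, T k = false := by
      cases h : T 0 with
      | false => exact ⟨0, h⟩
      | true => exact ⟨1, alt 0 h⟩
    obtain ⟨k, h⟩ := this
    have h1 := n44 k h
    have h2 := alt _ h1
    have h3 := n44 _ h2
    have h4 := n45454 k h h1 h2 h3
    have h5 := alt _ h3
    simp only [add_assoc] at h4 h5
    norm_num at h4 h5
    rw [h4] at h5
    exact absurd h5 (by simp)
  -- successor
  have nx : ∀ k, T k = true → T (k + 1) = true → T (k + 2) = false ∧ T (k + 3) = true ∧
      ((T (k + 4) = true) ∨ (T (k + 4) = false ∧ T (k + 5) = true ∧ T (k + 6) = true)) := by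
    intro k h h1
    have h2 := n555 k h h1
    have h3 : T (k + 3) = true := n44 _ h2
    refine ⟨h2, h3, ?_⟩
    cases h4 : T (k + 4) with
    | true => exact Or.inl rfl
    | false =>
      have h5 : T (k + 5) = true := n44 _ h4
      exact Or.inr ⟨rfl, h5, n45454 (k + 2) h2 h3 h4 h5⟩
  obtain ⟨k0, hk0⟩ := e0
  let nxt : ℕ → ℕ := fun k => if T (k + 4) = true then k + 3 else k + 5
  let s : ℕ → ℕ := fun n => nxt^[n] k0
  have hs1 : ∀ n, s (n + 1) = nxt (s n) := fun n => Function.iterate_succ_apply' nxt n k0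
  have hs : ∀ n, T (s n) = true ∧ T (s n + 1) = true := by
    intro n
    induction n with
    | zero => exact hk0
    | succ n ih =>
      rw [hs1]
      obtain ⟨h2, h3, h4⟩ := nx _ ih.1 ih.2
      by_cases e : T (s n + 4) = true
      · simp only [nxt, e, if_true]
        exact ⟨h3, trivial⟩
      · simp only [nxt, e]
        rcases h4 with h4 | ⟨-, h5, h6⟩
        · exact absurd h4 e
        · exact ⟨h5, h6⟩
  have ht2 : ∀ n, Rel t2 (W (s n)) (W (s n + 2)) := fun n => rel_t2 ((hR _).1 (hs n).1) ((hR _).1 (hs n).2)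
  refine Lev.absurd (p := p) (a := 5) (b := 8) (i0 := 1) (j0 := -3) (i1 := 6) (j1 := -8) (i2 := 7) (j2 := -8)
    ⟨by norm_num, by norm_num, by norm_num⟩ hp ?_
  refine ⟨fun n => MI0 (W (s n)), fun n => MI1 (W (s n + 2)), fun n => !T (s n + 4), fun n =>
    ⟨MI0.per (hper _), MI1.per (hper _), R_t2 (ht2 n), ?_, ?_⟩⟩
  · intro hX
    have e : T (s n + 4) = false := by simpa using hX
    obtain ⟨h2, h3, h4⟩ := nx _ (hs n).1 (hs n).2
    have hn : s (n + 1) = s n + 5 := by rw [hs1]; simp [nxt, e]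
    have r1 := f1_rel (h01 _) (t2_out (ht2 n)).1 (t2_out (ht2 n)).2
    have r2 := f0_rel (h01 _) (t2_in (ht2 (n + 1))).1 (t2_in (ht2 (n + 1))).2
    rw [hn] at r2
    beta_reduce
    rw [hn]
    exact R_t3 (rel_t3 (rel_f454 (rel_f45 (rel_fg r1 ((hR _).2 h2)) ((hR _).1 h3)) ((hR _).2 e)) r2)
  · intro hX
    have e : T (s n + 4) = true := by simpa using hX
    obtain ⟨h2, h3, h4⟩ := nx _ (hs n).1 (hs n).2
    have hn : s (n + 1) = s n + 3 := by rw [hs1]; simp [nxt, e]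
    have r1 := f1_rel (h01 _) (t2_out (ht2 n)).1 (t2_out (ht2 n)).2
    have r2 := f0_rel (h01 _) (t2_in (ht2 (n + 1))).1 (t2_in (ht2 (n + 1))).2
    rw [hn] at r2
    beta_reduce
    rw [hn]
    exact R_t1 (rel_t1 (rel_fg r1 ((hR _).2 h2)) r2)

end JR

namespace JR

theorem tile_facts : ∀ t ∈ tiles, (t.1 = 2 ↔ t.2.2.1 = 2) ∧ (t.1 = 2 → t.2.1 = 0 ∨ t.2.1 = 1) := by decide

/-- there is no tiling with a horizontal period -/
theorem no_hper {f : ℤ × ℤ → WangTile} (hf : ∀ q, f q ∈ tiles) (hm : WangMatch f) {p : ℤ} (hp : 0 < p)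
    (hper : ∀ x y, f (x + p, y) = f (x, y)) : False := by
  have hW : ∀ x y, (f (x, y)).2.2.1 = (f (x + 1, y)).1 := fun x y => (hm x y).1
  have hS : ∀ x y, (f (x, y)).2.2.2 = (f (x, y + 1)).2.1 := fun x y => (hm x y).2
  have row : ∀ y x, (f (x, y)).1 = 2 ↔ (f (0, y)).1 = 2 := by
    intro y x
    induction x using Int.induction_on with
    | zero => rfl
    | succ k ih => rw [← hW, ← (tile_facts _ (hf _)).1, ih]
    | pred k ih =>
      have := hW (-(k : ℤ) - 1) y
      rw [sub_add_cancel] at this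
      rw [(tile_facts _ (hf _)).1, this, ih]
  let Sw : ℤ → ℤ → ℕ := fun y x => (f (x, y)).2.1
  let ty : ℤ → Prop := fun y => (f (0, y)).1 = 2
  have r1 : ∀ y, ty y → Rel row1 (Sw y) (Sw (y + 1)) := by
    intro y h
    refine ⟨fun x => (f (x, y)).1, fun x => ?_⟩
    refine List.mem_map.2 ⟨f (x, y), List.mem_filter.2 ⟨hf _, ?_⟩, ?_⟩
    · simpa using (row y x).2 h
    · simp only [Sw, ← hS, ← hW]
  have r0 : ∀ y, ¬ ty y → Rel row0 (Sw y) (Sw (y + 1)) := by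
    intro y h
    refine ⟨fun x => (f (x, y)).1, fun x => ?_⟩
    refine List.mem_map.2 ⟨f (x, y), List.mem_filter.2 ⟨hf _, ?_⟩, ?_⟩
    · simpa using fun h' => h ((row y x).1 h')
    · simp only [Sw, ← hS, ← hW]
  have s01 : ∀ y, ty y → ∀ x, Sw y x = 0 ∨ Sw y x = 1 := fun y h x =>
    (tile_facts _ (hf _)).2 ((row y x).2 h)
  have q : ∀ y z : ℤ, y + 1 = z → (ty y → Rel row1 (Sw y) (Sw z)) ∧ (¬ ty y → Rel row0 (Sw y) (Sw z)) := by
    rintro y z rfl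
    exact ⟨r1 y, r0 y⟩
  have z1 : ∀ y, ty y → ¬ ty (y + 1) := fun y h h' => rel_e11 (r1 _ h) (r1 _ h')
  have z2 : ∀ y, ty y → ¬ ty (y + 2) := fun y h h' =>
    rel_e101 (rel_g10 ((q y (y + 1) rfl).1 h) ((q (y + 1) (y + 2) (by ring)).2 (z1 y h)))
      ((q (y + 2) (y + 3) (by ring)).1 h')
  have z3 : ∀ y, ty y → ¬ ty (y + 3) := fun y h h' =>
    rel_e1001 (rel_g100 (rel_g10 ((q y (y + 1) rfl).1 h) ((q (y + 1) (y + 2) (by ring)).2 (z1 y h)))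
      ((q (y + 2) (y + 3) (by ring)).2 (z2 y h))) ((q (y + 3) (y + 4) (by ring)).1 h')
  have z5 : ∀ y, ¬ ty y → ¬ ty (y + 1) → ¬ ty (y + 2) → ¬ ty (y + 3) → ty (y + 4) := by
    intro y h0 h1 h2 h3
    by_contra h4
    exact rel_e00000 ((q y (y + 1) rfl).2 h0) (rel_g0000 ((q (y + 1) (y + 2) (by ring)).2 h1)
      (rel_g000 ((q (y + 2) (y + 3) (by ring)).2 h2) (rel_g00 ((q (y + 3) (y + 4) (by ring)).2 h3)
        ((q (y + 4) (y + 5) (by ring)).2 h4))))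
  have e0 : ∃ y, ty y := by
    by_contra hno
    push Not at hno
    exact hno _ (z5 0 (hno _) (hno _) (hno _) (hno _))
  obtain ⟨y0, hy0⟩ := e0
  classical
  let nxt : ℤ → ℤ := fun y => if ty (y + 4) then y + 4 else y + 5
  let s : ℕ → ℤ := fun n => nxt^[n] y0
  have hs1 : ∀ n, s (n + 1) = nxt (s n) := fun n => Function.iterate_succ_apply' nxt n y0
  have hs : ∀ n, ty (s n) := by
    intro n
    induction n with
    | zero => exact hy0
    | succ n ih =>
      rw [hs1]
      by_cases e : ty (s n + 4)
      · simp only [nxt, if_pos e]; exact e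
      · simp only [nxt, if_neg e]
        have := z5 (s n + 1) (z1 _ ih) (by convert z2 _ ih using 1; ring_nf) (by convert z3 _ ih using 1; ring_nf)
          (by convert e using 1; ring_nf)
        convert this using 1; ring_nf
  refine no_seq hp (fun n => Sw (s n)) (fun n => decide (¬ ty (s n + 4))) (fun n => s01 _ (hs n))
    (fun n x => by simp only [Sw, hper]) (fun n => ⟨fun h => ?_, fun h => ?_⟩)
  · have e : ¬ ty (s n + 4) := by simpa using h
    have hn : s (n + 1) = s n + 5 := by rw [hs1]; exact if_neg e
    have h0 := hs n
    have h5 := s01 _ (hs (n + 1))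
    rw [hn] at h5
    rw [hn]
    exact rel_g5 ((q _ (s n + 1) rfl).1 h0) (rel_g0000 ((q (s n + 1) (s n + 2) (by ring)).2 (z1 _ h0))
      (rel_g000 ((q (s n + 2) (s n + 3) (by ring)).2 (z2 _ h0))
       (rel_g00 ((q (s n + 3) (s n + 4) (by ring)).2 (z3 _ h0)) ((q (s n + 4) (s n + 5) (by ring)).2 e)))) h5
  · have e : ty (s n + 4) := by simpa using h
    have hn : s (n + 1) = s n + 4 := by rw [hs1]; exact if_pos e
    have h0 := hs n
    have h5 := s01 _ (hs (n + 1))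
    rw [hn] at h5
    rw [hn]
    exact rel_g4 ((q _ (s n + 1) rfl).1 h0)
      (rel_g000 ((q (s n + 1) (s n + 2) (by ring)).2 (z1 _ h0))
       (rel_g00 ((q (s n + 2) (s n + 3) (by ring)).2 (z2 _ h0)) ((q (s n + 3) (s n + 4) (by ring)).2 (z3 _ h0)))) h5

end JR

namespace JR

theorem pigeon {f : ℤ × ℤ → WangTile} (hf : ∀ q, f q ∈ tiles) (U h : ℕ) :
    ∃ x d : ℤ, (U : ℤ) < d ∧ ∀ k j : ℤ, -(U : ℤ) ≤ k → k ≤ U → 0 ≤ j → j < h → f (x + k + d, j) = f (x + k, j) := by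
  let g : ℕ → (Fin (2 * U + 1) → Fin h → {t : WangTile // t ∈ tiles}) := fun n i j =>
    ⟨f ((n : ℤ) * (U + 1) + i, j), hf _⟩
  obtain ⟨n, m, hne, he⟩ := Finite.exists_ne_map_eq_of_infinite g
  have main : ∀ n m : ℕ, n < m → g n = g m →
      ∃ x d : ℤ, (U : ℤ) < d ∧ ∀ k j : ℤ, -(U : ℤ) ≤ k → k ≤ U → 0 ≤ j → j < h →
        f (x + k + d, j) = f (x + k, j) := by
    intro n m hlt he
    refine ⟨n * (U + 1) + U, (m - n) * (U + 1), ?_, ?_⟩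
    · have : (1 : ℤ) ≤ m - n := by omega
      nlinarith
    · intro k j h1 h2 h3 h4
      have := congrFun (congrFun he ⟨(k + U).toNat, by omega⟩) ⟨j.toNat, by omega⟩
      simp only [g, Subtype.mk.injEq, Int.toNat_of_nonneg h3, Int.toNat_of_nonneg (show 0 ≤ k + U by omega)] at this
      rw [show (n : ℤ) * (U + 1) + U + k + (m - n) * (U + 1) = m * (U + 1) + (k + U) by ring,
        show (n : ℤ) * (U + 1) + U + k = n * (U + 1) + (k + U) by ring, this]
  rcases lt_or_gt_of_ne hne with e | e
  · exact main n m e he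
  · exact main m n e he.symm

theorem no_vper {f : ℤ × ℤ → WangTile} (hf : ∀ q, f q ∈ tiles) (hm : WangMatch f) {u h : ℤ} (hh : 0 < h)
    (hper : ∀ x y, f (x + u, y + h) = f (x, y)) : False := by
  obtain ⟨x0, d, hd, hw⟩ := pigeon hf u.natAbs h.toNat
  have hd0 : 0 < d := by omega
  let S : ℤ → ℤ → WangTile := fun X r => f (x0 + X % d, r)
  have hS : ∀ k j : ℤ, -|u| ≤ k → k ≤ d + |u| → 0 ≤ j → j < h → S k j = f (x0 + k, j) := by
    intro k j h1 h2 h3 h4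
    simp only [S]
    have hu : |u| = u.natAbs := (Int.natCast_natAbs u).symm
    rcases lt_or_ge k 0 with e | e
    · have : k % d = k + d := by
        rw [← Int.add_emod_right]
        exact Int.emod_eq_of_lt (by omega) (by omega)
      rw [this, ← hw k j (by omega) (by omega) h3 (by omega), add_assoc]
    · rcases lt_or_ge k d with e' | e'
      · rw [Int.emod_eq_of_lt e e']
      · by_cases ee : k - d < d
        · have : k % d = k - d := by
            rw [← Int.sub_emod_right]
            exact Int.emod_eq_of_lt (by omega) ee
          rw [this, ← hw (k - d) j (by omega) (by omega) h3 (by omega)]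
          congr 2; ring
        · omega
  have hSp : ∀ X r, S (X + d) r = S X r := fun X r => by simp only [S, Int.add_emod_right]
  have hSm : ∀ X r, S (X % d) r = S X r := fun X r => by simp only [S, Int.emod_emod]
  have hSx : ∀ X r, 0 ≤ r → r < h → (S X r).east = (S (X + 1) r).west := by
    intro X r h1 h2
    have e1 := Int.emod_nonneg X hd0.ne'
    have e2 := Int.emod_lt_of_pos X hd0
    have e3 := abs_nonneg u
    rw [← hSm (X + 1), ← Int.emod_add_emod, hSm, hS (X % d + 1) r (by omega) (by omega) h1 h2]
    exact (hm _ _).1.trans (by rw [add_assoc])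
  have hSy : ∀ X r, 0 ≤ r → r + 1 < h → (S X r).north = (S X (r + 1)).south := fun X r _ _ => (hm _ _).2
  have hSz : ∀ X, (S X (h - 1)).north = (S (X - u) 0).south := by
    intro X
    have e1 := Int.emod_nonneg X hd0.ne'
    have e2 := Int.emod_lt_of_pos X hd0
    have e3 := neg_abs_le u
    have e4 := le_abs_self u
    rw [← hSm (X - u), ← Int.emod_sub_emod, hSm, hS (X % d - u) 0 (by omega) (by omega) le_rfl hh]
    have := (hm (x0 + X % d) (h - 1)).2
    simp only [S]
    rw [this, ← hper (x0 + (X % d - u)) 0]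
    congr 3 <;> ring
  let g : ℤ × ℤ → WangTile := fun q => S (q.1 - q.2 / h * u) (q.2 % h)
  refine no_hper (f := g) (fun q => hf _) ?_ hd0 ?_
  · intro x y
    have e1 := Int.emod_nonneg y hh.ne'
    have e2 := Int.emod_lt_of_pos y hh
    refine ⟨?_, ?_⟩
    · simp only [g]
      rw [hSx _ _ e1 e2]
      congr 2; ring
    · simp only [g]
      by_cases e : y % h + 1 < h
      · have e3 : (y + 1) % h = y % h + 1 := by
          rw [← Int.emod_add_emod]; exact Int.emod_eq_of_lt (by omega) e
        have e4 : (y + 1) / h = y / h := by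
          have h1 := Int.mul_ediv_add_emod y h
          have h2 := Int.mul_ediv_add_emod (y + 1) h
          have : h * ((y + 1) / h) = h * (y / h) := by omega
          exact mul_left_cancel₀ hh.ne' this
        rw [e3, e4]
        exact hSy _ _ e1 e
      · have e5 : y % h = h - 1 := by omega
        have e3 : (y + 1) % h = 0 := by
          rw [← Int.emod_add_emod, e5]; simp
        have e4 : (y + 1) / h = y / h + 1 := by
          have h1 := Int.mul_ediv_add_emod y h
          have h2 := Int.mul_ediv_add_emod (y + 1) h
          have : h * ((y + 1) / h) = h * (y / h + 1) := by rw [mul_add, mul_one]; omega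
          exact mul_left_cancel₀ hh.ne' this
        rw [e3, e4, e5, hSz]
        congr 2; ring
  · intro x y
    simp only [g]
    rw [← hSp (x - y / h * u)]
    congr 1; ring

theorem not_periodic {f : ℤ × ℤ → WangTile} (hf : ∀ q, f q ∈ tiles) (hm : WangMatch f) : ¬ WangPeriodic f := by
  rintro ⟨⟨u, h⟩, hv, hp⟩
  have hp1 : ∀ x y, f (x + u, y + h) = f (x, y) := fun x y => hp (x, y)
  have hp2 : ∀ x y, f (x + -u, y + -h) = f (x, y) := fun x y => by
    rw [← hp1]; congr 2 <;> ring
  rcases lt_trichotomy h 0 with e | e | e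
  · exact no_vper hf hm (by omega) hp2
  · subst e
    simp only [add_zero, neg_zero] at hp1 hp2
    rcases lt_trichotomy u 0 with e | e | e
    · exact no_hper hf hm (by omega) hp2
    · subst e; exact hv rfl
    · exact no_hper hf hm e hp1
  · exact no_vper hf hm e hp1

end JR

namespace JR
open Blk

/-! ### Existence: substituted rows -/

def offs (a b : ℤ) : ℤ → List Blk → List (Blk × ℤ)
  | _, [] => []
  | s, β :: l => (β, s) :: offs a b (s + β.len a b) l

def wsum (a b : ℤ) : List Blk → ℤ
  | [] => 0
  | β :: l => β.len a b + wsum a b l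

section
variable {a b : ℤ}

theorem len_pos (ha : 0 < a) (hb : 0 < b) (β : Blk) : 0 < β.len a b := by
  cases β <;> simp only [Blk.len] <;> omega

theorem wsum_nonneg (ha : 0 < a) (hb : 0 < b) (l : List Blk) : 0 ≤ wsum a b l := by
  induction l with
  | nil => exact le_rfl
  | cons β l ih => have := len_pos ha hb β; simp only [wsum]; omega

theorem offs_bd (ha : 0 < a) (hb : 0 < b) {γ : Blk} {k : ℤ} (l : List Blk) : ∀ s, (γ, k) ∈ offs a b s l →
    s ≤ k ∧ k + γ.len a b ≤ s + wsum a b l := by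
  induction l with
  | nil => intro s h; simp [offs] at h
  | cons β l ih =>
    intro s h
    simp only [offs, List.mem_cons, Prod.mk.injEq] at h
    have h1 := len_pos ha hb β
    have h2 := wsum_nonneg ha hb l
    simp only [wsum]
    rcases h with ⟨rfl, rfl⟩ | h
    · exact ⟨le_rfl, by omega⟩
    · have := ih _ h; omega

theorem offs_first (l : List Blk) (hl : l ≠ []) (s : ℤ) : ∃ γ, (γ, s) ∈ offs a b s l := by
  cases l with
  | nil => exact absurd rfl hl
  | cons β l => exact ⟨β, by simp [offs]⟩

theorem offs_last (l : List Blk) : ∀ (_ : l ≠ []) (s : ℤ),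
    ∃ γ : Blk, (γ, s + wsum a b l - γ.len a b) ∈ offs a b s l := by
  induction l with
  | nil => intro hl; exact absurd rfl hl
  | cons β l ih =>
    intro _ s
    by_cases e : l = []
    · subst e; exact ⟨β, by simp [offs, wsum]⟩
    · obtain ⟨γ, h⟩ := ih e (s + β.len a b)
      refine ⟨γ, ?_⟩
      simp only [offs, wsum, List.mem_cons]
      right
      rwa [← add_assoc]

theorem offs_next {γ : Blk} {k : ℤ} (l : List Blk) : ∀ s, (γ, k) ∈ offs a b s l →
    (∃ γ', (γ', k + γ.len a b) ∈ offs a b s l) ∨ k + γ.len a b = s + wsum a b l := by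
  induction l with
  | nil => intro s h; simp [offs] at h
  | cons β l ih =>
    intro s h
    simp only [offs, List.mem_cons, Prod.mk.injEq] at h
    rcases h with ⟨rfl, rfl⟩ | h
    · by_cases e : l = []
      · subst e; right; simp [wsum]
      · obtain ⟨γ', h⟩ := offs_first (a := a) (b := b) l e (k + γ.len a b)
        exact Or.inl ⟨γ', List.mem_cons_of_mem _ h⟩
    · rcases ih _ h with ⟨γ', h'⟩ | h'
      · exact Or.inl ⟨γ', List.mem_cons_of_mem _ h'⟩
      · right; simp only [wsum]; omega

theorem offs_prev {γ : Blk} {k : ℤ} (l : List Blk) : ∀ s, (γ, k) ∈ offs a b s l →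
    (∃ γ' : Blk, (γ', k - γ'.len a b) ∈ offs a b s l) ∨ k = s := by
  induction l with
  | nil => intro s h; simp [offs] at h
  | cons β l ih =>
    intro s h
    simp only [offs, List.mem_cons, Prod.mk.injEq] at h
    rcases h with ⟨rfl, rfl⟩ | h
    · right; rfl
    · left
      rcases ih _ h with ⟨γ', h'⟩ | h'
      · exact ⟨γ', List.mem_cons_of_mem _ h'⟩
      · exact ⟨β, by simp [offs, h']⟩

theorem offs_sep (ha : 0 < a) (hb : 0 < b) {γ γ' : Blk} {k k' : ℤ} (l : List Blk) :
    ∀ s, (γ, k) ∈ offs a b s l → (γ', k') ∈ offs a b s l →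
    (k = k' ∧ γ = γ') ∨ k + γ.len a b ≤ k' ∨ k' + γ'.len a b ≤ k := by
  induction l with
  | nil => intro s h; simp [offs] at h
  | cons β l ih =>
    intro s h h'
    simp only [offs, List.mem_cons, Prod.mk.injEq] at h h'
    rcases h with ⟨rfl, rfl⟩ | h <;> rcases h' with ⟨rfl, rfl⟩ | h'
    · exact Or.inl ⟨rfl, rfl⟩
    · have := offs_bd ha hb l _ h'; omega
    · have := offs_bd ha hb l _ h; omega
    · exact ih _ h h'

/-- the row obtained by a substitution -/
def Sub (a b : ℤ) (τ : Blk → List Blk) (B : Blk → ℤ → Prop) : Blk → ℤ → Prop := fun γ y =>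
  ∃ β x, B β x ∧ (γ, y - x) ∈ offs a b 0 (τ β)

theorem Row.sub {a' b' : ℤ} {B : Blk → ℤ → Prop} (h : Row a' b' B) (hc : ∀ x, ¬ B c x) (ha : 0 < a) (hb : 0 < b)
    {τ : Blk → List Blk} (h1 : ∀ β, β ≠ c → τ β ≠ []) (h2 : ∀ β, β ≠ c → wsum a b (τ β) = β.len a' b') :
    Row a b (Sub a b τ B) := by
  have nc : ∀ {β x}, B β x → β ≠ c := fun hx e => hc _ (e ▸ hx)
  refine ⟨?_, ?_, ?_, ?_⟩
  · rintro γ y ⟨β, x, hB, hm⟩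
    rcases offs_next _ _ hm with ⟨γ', h'⟩ | h'
    · exact ⟨γ', β, x, hB, by rwa [show y + γ.len a b - x = y - x + γ.len a b by ring]⟩
    · obtain ⟨β', hB'⟩ := h.next hB
      rw [h2 β (nc hB)] at h'
      obtain ⟨γ', h3⟩ := offs_first (a := a) (b := b) (τ β') (h1 β' (nc hB')) 0
      exact ⟨γ', β', _, hB', by rwa [show y + γ.len a b - (x + β.len a' b') = 0 by omega]⟩
  · rintro γ y ⟨β, x, hB, hm⟩
    rcases offs_prev _ _ hm with ⟨γ', h'⟩ | h'
    · exact ⟨γ', β, x, hB, by rwa [show y - γ'.len a b - x = y - x - γ'.len a b by ring]⟩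
    · obtain ⟨β', hB'⟩ := h.prev hB
      obtain ⟨γ', h3⟩ := offs_last (a := a) (b := b) (τ β') (h1 β' (nc hB')) 0
      rw [h2 β' (nc hB')] at h3
      refine ⟨γ', β', _, hB', ?_⟩
      rwa [show y - γ'.len a b - (x - β'.len a' b') = 0 + β'.len a' b' - γ'.len a b by omega]
  · rintro γ y γ' y' ⟨β, x, hB, hm⟩ ⟨β', x', hB', hm'⟩
    rcases h.sep hB hB' with ⟨e, e'⟩ | e | e
    · subst e; subst e'
      rcases offs_sep ha hb _ _ hm hm' with ⟨e, e'⟩ | e | e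
      · exact Or.inl ⟨by omega, e'⟩
      · exact Or.inr (Or.inl (by omega))
      · exact Or.inr (Or.inr (by omega))
    · have b1 := offs_bd ha hb _ _ hm
      have b2 := offs_bd ha hb _ _ hm'
      rw [h2 β (nc hB)] at b1
      exact Or.inr (Or.inl (by omega))
    · have b1 := offs_bd ha hb _ _ hm
      have b2 := offs_bd ha hb _ _ hm'
      rw [h2 β' (nc hB')] at b2
      exact Or.inr (Or.inr (by omega))
  · obtain ⟨β, x, hB⟩ := h.ne
    obtain ⟨γ', h3⟩ := offs_first (a := a) (b := b) (τ β) (h1 β (nc hB)) 0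
    exact ⟨γ', x, β, x, hB, by rwa [sub_self]⟩

end

def tL : Blk → List Blk
  | us => [us, ul]
  | ds => [ds, ul]
  | dl => [dl, us, ul]
  | ul => [ul, us, ul]
  | c => []

def tM : Blk → List Blk
  | us => [dl, ds, ul]
  | ds => [dl, us, ul]
  | dl => [dl, us, ul, ds, ul]
  | ul => [dl, us, dl, ds, ul]
  | c => []

def tU : Blk → List Blk
  | us => [dl, us]
  | ds => [dl, ds]
  | dl => [dl, ds, dl]
  | ul => [dl, ds, ul]
  | c => []

section
variable {a b : ℤ} {B : Blk → ℤ → Prop}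

theorem Sub_congr {a b a' b' : ℤ} {τ τ' : Blk → List Blk} {γ γ' : Blk} {y y' : ℤ}
    (h : ∀ β x, (γ, y - x) ∈ offs a b 0 (τ β) ↔ (γ', y' - x) ∈ offs a' b' 0 (τ' β)) :
    Sub a b τ B γ y ↔ Sub a' b' τ' B γ' y' := by
  simp only [Sub, h]

theorem Sub_one {τ : Blk → List Blk} {γ β0 : Blk} {y y' : ℤ}
    (h : ∀ β x, (γ, y - x) ∈ offs a b 0 (τ β) ↔ β = β0 ∧ x = y') :
    Sub a b τ B γ y ↔ B β0 y' := by
  simp only [Sub, h]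
  constructor
  · rintro ⟨β, x, hB, rfl, rfl⟩; exact hB
  · intro hB; exact ⟨_, _, hB, rfl, rfl⟩

theorem Sub_nc {τ : Blk → List Blk} (h : ∀ β, c ∉ τ β) (x : ℤ) : ¬ Sub a b τ B c x := by
  rintro ⟨β, y, -, hm⟩
  have : ∀ (l : List Blk) (s k : ℤ) (γ : Blk), (γ, k) ∈ offs a b s l → γ ∈ l := by
    intro l
    induction l with
    | nil => intro s k γ h; simp [offs] at h
    | cons β l ih =>
      intro s k γ h
      simp only [offs, List.mem_cons, Prod.mk.injEq] at h ⊢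
      rcases h with h | h
      · exact Or.inl h.1
      · exact Or.inr (ih _ _ _ h)
  exact h β (this _ _ _ _ hm)

theorem m1 (y : ℤ) : Sub b (a + b) tL B us (y - b) ↔ Sub a b tM B ds y := by
  apply Sub_congr
  intro β x
  cases β <;> simp [offs, tL, tM, Blk.len] <;> omega

theorem m3 (y : ℤ) : Sub a b tM B us (y - a) ↔ Sub b (a + b) tU B ds y := by
  apply Sub_congr
  intro β x
  cases β <;> simp [offs, tU, tM, Blk.len] <;> omega

theorem m5s (y : ℤ) : Sub b (a + b) tL B ds y ↔ B ds y := by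
  apply Sub_one
  intro β x
  cases β <;> simp [offs, tL, Blk.len] <;> omega

theorem m5l (y : ℤ) : Sub b (a + b) tL B dl y ↔ B dl y := by
  apply Sub_one
  intro β x
  cases β <;> simp [offs, tL, Blk.len] <;> omega

theorem m6s (y : ℤ) : Sub b (a + b) tU B us (y - b) ↔ B us (y - (a + 2 * b)) := by
  apply Sub_one
  intro β x
  cases β <;> simp [offs, tU, Blk.len] <;> omega

theorem m6l (y : ℤ) : Sub b (a + b) tU B ul (y - (a + b)) ↔ B ul (y - (2 * a + 3 * b)) := by
  apply Sub_one
  intro β x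
  cases β <;> simp [offs, tU, Blk.len] <;> omega

theorem Row.start_iff {a' b' : ℤ} (h : Row a' b' B) (y : ℤ) :
    (∃ β x, B β x ∧ y = x) ↔ ∃ β x, B β x ∧ y = x + β.len a' b' := by
  constructor
  · rintro ⟨β, x, hB, rfl⟩
    obtain ⟨β', h'⟩ := h.prev hB
    exact ⟨β', _, h', by ring⟩
  · rintro ⟨β, x, hB, rfl⟩
    obtain ⟨β', h'⟩ := h.next hB
    exact ⟨β', _, h', rfl⟩

theorem m2 (h : Row (a + 2 * b) (2 * a + 3 * b) B) (hc : ∀ x, ¬ B c x) (y : ℤ) :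
    Sub b (a + b) tL B ul (y - (a + b)) ↔ Sub a b tM B dl y := by
  have e1 : Sub b (a + b) tL B ul (y - (a + b)) ↔
      (∃ β x, B β x ∧ y = x + β.len (a + 2 * b) (2 * a + 3 * b)) ∨ B ul (y - (a + b)) := by
    have : ∀ β x, β ≠ c → ((ul, y - (a + b) - x) ∈ offs b (a + b) 0 (tL β) ↔
        y = x + β.len (a + 2 * b) (2 * a + 3 * b) ∨ (β = ul ∧ x = y - (a + b))) := by
      intro β x hβ
      cases β <;> simp [offs, tL, Blk.len] at hβ ⊢ <;> omega
    constructor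
    · rintro ⟨β, x, hB, hm⟩
      rcases (this β x (fun e => hc _ (e ▸ hB))).1 hm with e | ⟨rfl, rfl⟩
      · exact Or.inl ⟨β, x, hB, e⟩
      · exact Or.inr hB
    · rintro (⟨β, x, hB, e⟩ | hB)
      · exact ⟨β, x, hB, (this β x (fun e => hc _ (e ▸ hB))).2 (Or.inl e)⟩
      · exact ⟨_, _, hB, (this _ _ (by simp)).2 (Or.inr ⟨rfl, rfl⟩)⟩
  have e2 : Sub a b tM B dl y ↔ (∃ β x, B β x ∧ y = x) ∨ B ul (y - (a + b)) := by
    have : ∀ β x, β ≠ c → ((dl, y - x) ∈ offs a b 0 (tM β) ↔ y = x ∨ (β = ul ∧ x = y - (a + b))) := by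
      intro β x hβ
      cases β <;> simp [offs, tM, Blk.len] at hβ ⊢ <;> omega
    constructor
    · rintro ⟨β, x, hB, hm⟩
      rcases (this β x (fun e => hc _ (e ▸ hB))).1 hm with e | ⟨rfl, rfl⟩
      · exact Or.inl ⟨β, x, hB, e⟩
      · exact Or.inr hB
    · rintro (⟨β, x, hB, e⟩ | hB)
      · exact ⟨β, x, hB, (this β x (fun e => hc _ (e ▸ hB))).2 (Or.inl e)⟩
      · exact ⟨_, _, hB, (this _ _ (by simp)).2 (Or.inr ⟨rfl, rfl⟩)⟩
  rw [e1, e2, h.start_iff]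

theorem m4 (h : Row (a + 2 * b) (2 * a + 3 * b) B) (hc : ∀ x, ¬ B c x) (y : ℤ) :
    Sub a b tM B ul (y - b) ↔ Sub b (a + b) tU B dl y := by
  have e1 : Sub a b tM B ul (y - b) ↔
      (∃ β x, B β x ∧ y = x + β.len (a + 2 * b) (2 * a + 3 * b)) ∨ B dl (y - (a + 2 * b)) := by
    have : ∀ β x, β ≠ c → ((ul, y - b - x) ∈ offs a b 0 (tM β) ↔
        y = x + β.len (a + 2 * b) (2 * a + 3 * b) ∨ (β = dl ∧ x = y - (a + 2 * b))) := by
      intro β x hβ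
      cases β <;> simp [offs, tM, Blk.len] at hβ ⊢ <;> omega
    constructor
    · rintro ⟨β, x, hB, hm⟩
      rcases (this β x (fun e => hc _ (e ▸ hB))).1 hm with e | ⟨rfl, rfl⟩
      · exact Or.inl ⟨β, x, hB, e⟩
      · exact Or.inr hB
    · rintro (⟨β, x, hB, e⟩ | hB)
      · exact ⟨β, x, hB, (this β x (fun e => hc _ (e ▸ hB))).2 (Or.inl e)⟩
      · exact ⟨_, _, hB, (this _ _ (by simp)).2 (Or.inr ⟨rfl, rfl⟩)⟩
  have e2 : Sub b (a + b) tU B dl y ↔ (∃ β x, B β x ∧ y = x) ∨ B dl (y - (a + 2 * b)) := by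
    have : ∀ β x, β ≠ c → ((dl, y - x) ∈ offs b (a + b) 0 (tU β) ↔ y = x ∨ (β = dl ∧ x = y - (a + 2 * b))) := by
      intro β x hβ
      cases β <;> simp [offs, tU, Blk.len] at hβ ⊢ <;> omega
    constructor
    · rintro ⟨β, x, hB, hm⟩
      rcases (this β x (fun e => hc _ (e ▸ hB))).1 hm with e | ⟨rfl, rfl⟩
      · exact Or.inl ⟨β, x, hB, e⟩
      · exact Or.inr hB
    · rintro (⟨β, x, hB, e⟩ | hB)
      · exact ⟨β, x, hB, (this β x (fun e => hc _ (e ▸ hB))).2 (Or.inl e)⟩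
      · exact ⟨_, _, hB, (this _ _ (by simp)).2 (Or.inr ⟨rfl, rfl⟩)⟩
  rw [e1, e2, h.start_iff]

end

def mkI (B : Blk → ℤ → Prop) (i : ℤ) : Marks
  | false, y => B ds (y - i)
  | true, y => B dl (y - i)

def mkJ (a b : ℤ) (B : Blk → ℤ → Prop) (j : ℤ) : Marks
  | false, y => B us (y - j - a)
  | true, y => B ul (y - j - b)

/-- one row of tiles with given south and north words -/
def RowRel (W V : ℤ → ℕ) : Prop := ∃ r : ℤ → WangTile, ∀ x, r x ∈ tiles ∧ (r x).east = (r (x + 1)).west ∧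
  (r x).south = W x ∧ (r x).north = V x

inductive Chain : ℕ → (ℤ → ℕ) → (ℤ → ℕ) → Prop
  | zero (W) : Chain 0 W W
  | succ {n W V V'} : Chain n W V → RowRel V V' → Chain (n + 1) W V'

theorem Chain.trans {n m : ℕ} {W V V' : ℤ → ℕ} (h1 : Chain n W V) (h2 : Chain m V V') : Chain (n + m) W V' := by
  induction h2 with
  | zero => exact h1
  | succ _ hr ih => exact (ih h1).succ hr

/-- words from marks: two ways, see `enc` -/
abbrev Kind := ℕ × List ℤ × List ℤ

open Classical in
noncomputable def enc (K : Kind) (I : Marks) : ℤ → ℕ := fun x =>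
  if (∃ d ∈ K.2.1, I false (x - d)) ∨ (∃ d ∈ K.2.2, I true (x - d)) then K.1 else 1 - K.1

def Real (a b i j : ℤ) (K K' : Kind) (h : ℕ) : Prop :=
  ∀ B, Row a b B → (∀ x, ¬ B c x) → Chain h (enc K (mkI B i)) (enc K' (mkJ a b B j))

theorem marks_ext {I J : Marks} (h1 : ∀ y, I false y ↔ J false y) (h2 : ∀ y, I true y ↔ J true y) : I = J := by
  funext t y
  cases t
  · exact propext (h1 y)
  · exact propext (h2 y)

theorem Real.step {a b i0 j0 i1 j1 : ℤ} {K K' : Kind} {h0 h1 : ℕ} (ha : 0 < a) (hb : 0 < b)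
    (H0 : Real a b i0 j0 K K' h0) (H1 : Real b (a + b) i1 j1 K' K h1) :
    Real (a + 2 * b) (2 * a + 3 * b) i1 (2 * j1 + j0 - i0 - i1) K' K (h1 + h0 + h1) := by
  intro B hB hc
  have rL : Row b (a + b) (Sub b (a + b) tL B) := hB.sub hc hb (by omega)
    (by intro β hβ; cases β <;> simp [tL] at hβ ⊢)
    (by intro β hβ; cases β <;> simp [tL, wsum, Blk.len] at hβ ⊢ <;> ring)
  have rM : Row a b (Sub a b tM B) := hB.sub hc ha hb
    (by intro β hβ; cases β <;> simp [tM] at hβ ⊢)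
    (by intro β hβ; cases β <;> simp [tM, wsum, Blk.len] at hβ ⊢ <;> ring)
  have rU : Row b (a + b) (Sub b (a + b) tU B) := hB.sub hc hb (by omega)
    (by intro β hβ; cases β <;> simp [tU] at hβ ⊢)
    (by intro β hβ; cases β <;> simp [tU, wsum, Blk.len] at hβ ⊢ <;> ring)
  have cL := H1 _ rL (Sub_nc (by intro β; cases β <;> simp [tL]))
  have cM := H0 _ (rM.shift (i0 - j1)) (fun x => Sub_nc (by intro β; cases β <;> simp [tM]) _)
  have cU := H1 _ (rU.shift (i1 - j0 + i0 - j1)) (fun x => Sub_nc (by intro β; cases β <;> simp [tU]) _)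
  have e1 : mkI (Sub b (a + b) tL B) i1 = mkI B i1 := marks_ext (fun y => m5s _) (fun y => m5l _)
  have e2 : mkJ b (a + b) (Sub b (a + b) tL B) j1 = mkI (fun β x => Sub a b tM B β (x + (i0 - j1))) i0 := by
    refine marks_ext (fun y => ?_) (fun y => ?_)
    · simp only [mkI, mkJ]
      rw [m1 (a := a), show y - i0 + (i0 - j1) = y - j1 by ring]
    · simp only [mkI, mkJ]
      rw [m2 hB hc, show y - i0 + (i0 - j1) = y - j1 by ring]
  have e3 : mkJ a b (fun β x => Sub a b tM B β (x + (i0 - j1))) j0 =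
      mkI (fun β x => Sub b (a + b) tU B β (x + (i1 - j0 + i0 - j1))) i1 := by
    refine marks_ext (fun y => ?_) (fun y => ?_)
    · simp only [mkI, mkJ]
      rw [show y - j0 - a + (i0 - j1) = y - j0 + i0 - j1 - a by ring, m3,
        show y - i1 + (i1 - j0 + i0 - j1) = y - j0 + i0 - j1 by ring]
    · simp only [mkI, mkJ]
      rw [show y - j0 - b + (i0 - j1) = y - j0 + i0 - j1 - b by ring, m4 hB hc,
        show y - i1 + (i1 - j0 + i0 - j1) = y - j0 + i0 - j1 by ring]
  have e4 : mkJ b (a + b) (fun β x => Sub b (a + b) tU B β (x + (i1 - j0 + i0 - j1))) j1 =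
      mkJ (a + 2 * b) (2 * a + 3 * b) B (2 * j1 + j0 - i0 - i1) := by
    refine marks_ext (fun y => ?_) (fun y => ?_)
    · simp only [mkJ]
      rw [show y - j1 - b + (i1 - j0 + i0 - j1) = y - j1 + (i1 - j0 + i0 - j1) - b by ring, m6s]
      ring_nf
    · simp only [mkJ]
      rw [show y - j1 - (a + b) + (i1 - j0 + i0 - j1) = y - j1 + (i1 - j0 + i0 - j1) - (a + b) by ring, m6l]
      ring_nf
  rw [e1, e2] at cL
  rw [e3] at cM
  rw [e4] at cU
  exact (cL.trans cM).trans cU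

end JR

namespace JR
open Blk

/-! ### Existence: base rows and compactness -/

abbrev Tab := ℕ × List ℕ × List ℕ × List ℕ × List ℕ

def Tab.col (t : Tab) : Blk → List ℕ
  | us => t.2.1
  | ul => t.2.2.1
  | ds => t.2.2.2.1
  | dl => t.2.2.2.2
  | c => []

def Tab.tile (t : Tab) (β : Blk) (k : ℕ) : WangTile := tiles.getD ((t.col β).getD k 0) (0, 0, 0, 0)

def tb1 : List Tab := [
  (2, [1,1,1,1,1], [1,1,1,1,1,1,1,1], [1,1,0,0,1], [1,1,0,0,0,1,1,1]),
  (0, [7,3,10,3,8], [7,3,8,7,3,10,3,8], [7,3,9,9,8], [7,3,9,9,9,10,3,8]),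
  (3, [5,7,4,3,10], [2,8,7,5,7,4,3,10], [2,8,7,3,10], [2,8,7,3,10,4,3,10]),
  (3, [5,6,6,7,4], [5,7,5,6,6,6,7,4], [5,7,5,7,4], [5,7,5,7,4,5,7,4])]

def tb2 : List Tab := [
  (2, [0,0,0,0,0,0,0,0], [0,0,0,0,0,0,0,0,0,0,0,0,0], [0,0,0,0,0,1,1,0], [0,0,0,0,1,1,1,0,0,0,0,0,0]),
  (1, [9,9,9,9,9,9,9,9], [9,9,9,9,9,9,9,9,9,9,9,9,9], [9,9,9,9,9,10,3,9], [9,9,9,9,8,7,3,9,9,9,9,9,9]),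
  (3, [3,8,7,3,8,7,3,10], [3,8,7,3,10,3,8,7,3,8,7,3,10], [3,8,7,3,10,4,3,10], [3,8,7,3,10,2,8,7,3,8,7,3,10]),
  (3, [3,10,2,8,7,5,7,4], [3,10,5,7,4,3,10,2,8,7,5,7,4], [3,10,5,7,4,5,7,4], [3,10,5,7,4,5,7,2,8,7,5,7,4]),
  (0, [7,4,5,7,5,6,6,6], [7,4,5,6,6,7,4,5,7,5,6,6,6], [7,4,5,6,6,6,6,6], [7,4,5,6,6,6,6,6,7,5,6,6,6]),
  (2, [0,0,0,0,0,1,1,1], [0,0,0,1,1,0,0,0,0,0,1,1,1], [0,0,0,1,1,1,1,1], [0,0,0,1,1,1,1,1,0,0,1,1,1]),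
  (1, [9,9,9,9,9,8,7,3], [9,9,9,10,3,9,9,9,9,9,8,7,3], [9,9,9,10,3,8,7,3], [9,9,9,10,3,8,7,3,9,9,8,7,3]),
  (0, [7,3,8,7,3,10,2,8], [7,3,10,4,3,10,3,8,7,3,10,2,8], [7,3,10,4,3,10,2,8], [7,3,10,4,3,10,2,8,7,3,10,2,8]),
  (3, [2,8,7,5,7,4,5,7], [5,7,4,5,7,4,3,10,5,7,4,5,7], [5,7,4,5,7,4,5,7], [5,7,4,5,7,4,5,7,5,7,4,5,7]),
  (0, [6,7,5,6,6,6,6,6], [6,6,6,6,6,6,7,4,5,6,6,6,6], [6,6,6,6,6,6,6,6], [6,6,6,6,6,6,6,6,6,6,6,6,6])]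

def tb3 : List Tab := [
  (2, [1,1,1,1,1,1,1,1,1,1,1,1,1], [1,1,1,1,1,1,1,1,1,1,1,1,1,1,1,1,1,1,1,1,1], [1,1,1,1,1,1,1,1,0,0,1,1,1], [1,1,1,1,1,1,1,1,0,0,0,1,1,1,1,1,1,1,1,1,1]),
  (1, [8,7,3,10,3,8,7,3,10,3,8,7,3], [8,7,3,10,3,8,7,3,8,7,3,10,3,8,7,3,10,3,8,7,3], [8,7,3,10,3,8,7,3,9,9,8,7,3], [8,7,3,10,3,8,7,3,9,9,9,10,3,8,7,3,10,3,8,7,3]),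
  (0, [7,5,7,4,3,10,5,7,4,3,10,2,8], [7,5,7,4,3,10,2,8,7,5,7,4,3,10,5,7,4,3,10,2,8], [7,5,7,4,3,10,2,8,7,3,10,2,8], [7,5,7,4,3,10,2,8,7,3,10,4,3,10,5,7,4,3,10,2,8]),
  (3, [5,6,6,6,7,4,5,6,6,7,4,5,7], [5,6,6,6,7,4,5,7,5,6,6,6,7,4,5,6,6,7,4,5,7], [5,6,6,6,7,4,5,7,5,7,4,5,7], [5,6,6,6,7,4,5,7,5,7,4,5,7,4,5,6,6,7,4,5,7]),
  (2, [0,1,1,1,0,0,0,1,1,0,0,0,0], [0,1,1,1,0,0,0,0,0,1,1,1,0,0,0,1,1,0,0,0,0], [0,1,1,1,0,0,0,0,0,0,0,0,0], [0,1,1,1,0,0,0,0,0,0,0,0,0,0,0,1,1,0,0,0,0]),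
  (1, [9,8,7,3,9,9,9,10,3,9,9,9,9], [9,8,7,3,9,9,9,9,9,8,7,3,9,9,9,10,3,9,9,9,9], [9,8,7,3,9,9,9,9,9,9,9,9,9], [9,8,7,3,9,9,9,9,9,9,9,9,9,9,9,10,3,9,9,9,9]),
  (3, [3,10,2,8,7,3,10,4,3,10,3,8,7], [3,10,2,8,7,3,8,7,3,10,2,8,7,3,10,4,3,10,3,8,7], [3,10,2,8,7,3,8,7,3,10,3,8,7], [3,10,2,8,7,3,8,7,3,10,3,8,7,3,10,4,3,10,3,8,7]),
  (0, [7,4,5,7,5,7,4,5,7,4,3,10,5], [7,4,5,7,2,8,7,5,7,4,5,7,5,7,4,5,7,4,3,10,5], [7,4,5,7,2,8,7,5,7,4,3,10,5], [7,4,5,7,2,8,7,5,7,4,3,10,5,7,4,5,7,4,3,10,5]),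
  (0, [6,6,6,6,6,6,6,6,6,6,7,4,5], [6,6,6,6,6,7,5,6,6,6,6,6,6,6,6,6,6,6,7,4,5], [6,6,6,6,6,7,5,6,6,6,7,4,5], [6,6,6,6,6,7,5,6,6,6,7,4,5,6,6,6,6,6,7,4,5]),
  (2, [1,1,1,1,1,1,1,1,1,1,0,0,0], [1,1,1,1,1,0,0,1,1,1,1,1,1,1,1,1,1,1,0,0,0], [1,1,1,1,1,0,0,1,1,1,0,0,0], [1,1,1,1,1,0,0,1,1,1,0,0,0,1,1,1,1,1,0,0,0]),
  (1, [10,3,8,7,3,10,3,8,7,3,9,9,9], [10,3,8,7,3,9,9,8,7,3,8,7,3,10,3,8,7,3,9,9,9], [10,3,8,7,3,9,9,8,7,3,9,9,9], [10,3,8,7,3,9,9,8,7,3,9,9,9,10,3,8,7,3,9,9,9]),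
  (3, [4,3,10,5,7,4,3,10,2,8,7,3,10], [4,3,10,2,8,7,3,10,2,8,7,5,7,4,3,10,2,8,7,3,10], [4,3,10,2,8,7,3,10,2,8,7,3,10], [4,3,10,2,8,7,3,10,2,8,7,3,10,4,3,10,2,8,7,3,10]),
  (3, [5,7,4,5,6,6,7,4,5,7,5,7,4], [5,7,4,5,7,5,7,4,5,7,5,6,6,6,7,4,5,7,5,7,4], [5,7,4,5,7,5,7,4,5,7,5,7,4], [5,7,4,5,7,5,7,4,5,7,5,7,4,5,7,4,5,7,5,7,4])]

def lenN (a b : ℕ) : Blk → ℕ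
  | us => a
  | ul => b
  | ds => a
  | dl => b
  | c => 1

theorem lenN_cast {a b : ℕ} {β : Blk} (h : β ≠ c) : (lenN a b β : ℤ) = β.len a b := by
  cases β <;> simp [lenN, Blk.len] at h ⊢

def Fits (a b : ℕ) (u v : Blk → ℕ → ℕ) : Prop :=
  ∀ β ∈ [us, ul, ds, dl], ∀ k < lenN a b β, u β k = v β k

instance (a b : ℕ) (u v : Blk → ℕ → ℕ) : Decidable (Fits a b u v) := by unfold Fits; infer_instance

def Tab.Good (t : Tab) (a b : ℕ) : Prop :=
  ∀ β ∈ [us, ul, ds, dl], (t.tile β 0).west = t.1 ∧ (t.tile β (lenN a b β - 1)).east = t.1 ∧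
    ∀ k < lenN a b β, t.tile β k ∈ tiles ∧
      (k + 1 < lenN a b β → (t.tile β k).east = (t.tile β (k + 1)).west)

instance (t : Tab) (a b : ℕ) : Decidable (t.Good a b) := by unfold Tab.Good; infer_instance

def lk (a b : ℕ) (v : Blk → ℕ → ℕ) : (Blk → ℕ → ℕ) → List Tab → Bool
  | u, [] => decide (Fits a b u v)
  | u, t :: l => decide (t.Good a b) && (decide (Fits a b u (fun β k => (t.tile β k).south)) &&
      lk a b v (fun β k => (t.tile β k).north) l)

structure Loc (a b : ℕ) (B : Blk → ℤ → Prop) (β : ℤ → Blk) (k : ℤ → ℕ) : Prop where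
  nc : ∀ x, β x ≠ c
  lt : ∀ x, k x < lenN a b (β x)
  nx : ∀ x, (β (x + 1) = β x ∧ k (x + 1) = k x + 1) ∨ (k x + 1 = lenN a b (β x) ∧ k (x + 1) = 0)
  iff : ∀ (x : ℤ) (γ : Blk) (m : ℤ), γ ≠ c → 0 ≤ m → m < γ.len a b → (B γ (x - m) ↔ β x = γ ∧ (k x : ℤ) = m)

theorem mem4 {β : Blk} (h : β ≠ c) : β ∈ [us, ul, ds, dl] := by
  cases β <;> simp at h ⊢

theorem exists_loc {a b : ℕ} (ha : 0 < a) (hb : 0 < b) {B : Blk → ℤ → Prop} (h : Row a b B)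
    (hc : ∀ x, ¬ B c x) : ∃ β k, Loc a b B β k := by
  have nc : ∀ {β x}, B β x → β ≠ c := fun hx e => hc _ (e ▸ hx)
  have lp : ∀ β : Blk, 0 < β.len (a : ℤ) b := len_pos (by omega) (by omega)
  have ex : ∀ x : ℤ, ∃ β, ∃ k : ℕ, B β (x - k) ∧ k < lenN a b β := by
    intro x
    obtain ⟨β, y, hB, h1, h2⟩ : ∃ β y, B β y ∧ y ≤ x ∧ x < y + β.len a b := by
      obtain ⟨y, z, -, -, ⟨β, hβ, e⟩, h1, h2⟩ := cover (P := fun x => ∃ β, B β x)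
        (Q := fun y z => ∃ β, B β y ∧ z = y + β.len a b)
        (by obtain ⟨β, x, hx⟩ := h.ne; exact ⟨x, β, hx⟩)
        (by
          rintro x ⟨β, hx⟩
          obtain ⟨β', h'⟩ := h.next hx
          have := lp β
          exact ⟨x + β.len a b, by omega, ⟨β', h'⟩, ⟨β, hx, rfl⟩⟩)
        (by
          rintro x ⟨β, hx⟩
          obtain ⟨β', h'⟩ := h.prev hx
          have := lp β'
          exact ⟨_, by omega, ⟨β', h'⟩⟩) x
      exact ⟨β, y, hβ, h1, by omega⟩
    refine ⟨β, (x - y).toNat, ?_, ?_⟩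
    · exact mv hB (by omega)
    · have := lenN_cast (a := a) (b := b) (nc hB); omega
  choose β k hB hk using ex
  have ncx : ∀ x, β x ≠ c := fun x => nc (hB x)
  have hl : ∀ x, (k x : ℤ) < (β x).len a b := by
    intro x
    rw [← lenN_cast (ncx x)]; exact_mod_cast hk x
  have uniq : ∀ (x : ℤ) (γ : Blk) (m : ℤ), 0 ≤ m → m < γ.len a b → B γ (x - m) → β x = γ ∧ (k x : ℤ) = m := by
    intro x γ m h0 h1 hγ
    have := hl x
    rcases h.sep (hB x) hγ with ⟨e, e'⟩ | e | e
    · exact ⟨e', by omega⟩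
    · omega
    · omega
  refine ⟨β, k, ncx, hk, ?_, ?_⟩
  · intro x
    have h1 := lenN_cast (a := a) (b := b) (ncx x)
    have h2 := hk x
    by_cases e : k x + 1 < lenN a b (β x)
    · left
      have := uniq (x + 1) (β x) (k x + 1) (by omega) (by omega) (mv (hB x) (by ring))
      exact ⟨this.1, by omega⟩
    · right
      obtain ⟨γ, hγ⟩ := h.next (hB x)
      have := uniq (x + 1) γ 0 le_rfl (lp γ) (mv hγ (by omega))
      exact ⟨by omega, by omega⟩
  · intro x γ m _ h0 h1
    constructor
    · exact uniq x γ m h0 h1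
    · rintro ⟨rfl, rfl⟩; exact hB x

section
variable {a b : ℕ} {B : Blk → ℤ → Prop} {β : ℤ → Blk} {k : ℤ → ℕ}

theorem Loc.fits (L : Loc a b B β k) {u v : Blk → ℕ → ℕ} (h : Fits a b u v) :
    (fun x => u (β x) (k x)) = fun x => v (β x) (k x) := by
  funext x
  exact h _ (mem4 (L.nc x)) _ (L.lt x)

theorem Loc.rowRel (L : Loc a b B β k) {t : Tab} (h : t.Good a b) :
    RowRel (fun x => (t.tile (β x) (k x)).south) (fun x => (t.tile (β x) (k x)).north) := by
  refine ⟨fun x => t.tile (β x) (k x), fun x => ?_⟩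
  obtain ⟨-, h2, h3⟩ := h _ (mem4 (L.nc x))
  refine ⟨(h3 _ (L.lt x)).1, ?_, rfl, rfl⟩
  rcases L.nx x with ⟨e1, e2⟩ | ⟨e1, e2⟩
  · have := L.lt (x + 1)
    simp only [e1, e2] at this ⊢
    exact (h3 _ (L.lt x)).2 this
  · simp only [e2]
    rw [(h _ (mem4 (L.nc (x + 1)))).1, ← h2, ← e1]
    rfl

theorem Loc.chain (L : Loc a b B β k) {v : Blk → ℕ → ℕ} (l : List Tab) : ∀ {u : Blk → ℕ → ℕ},
    lk a b v u l = true → Chain l.length (fun x => u (β x) (k x)) (fun x => v (β x) (k x)) := by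
  induction l with
  | nil =>
    intro u h
    rw [L.fits (of_decide_eq_true h)]
    exact Chain.zero _
  | cons t l ih =>
    intro u h
    simp only [lk, Bool.and_eq_true, decide_eq_true_eq] at h
    rw [L.fits h.2.1, List.length_cons, add_comm]
    exact ((Chain.zero _).succ (L.rowRel h.1)).trans (ih h.2.2)

def wd (K : Kind) (γ1 γ2 : Blk) (s1 s2 : ℤ) (β : Blk) (k : ℕ) : ℕ :=
  if (∃ d ∈ K.2.1, β = γ1 ∧ (k : ℤ) = d + s1) ∨ (∃ d ∈ K.2.2, β = γ2 ∧ (k : ℤ) = d + s2) then K.1 else 1 - K.1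

theorem Loc.enc (L : Loc a b B β k) {K : Kind} {γ1 γ2 : Blk} {s1 s2 : ℤ} {I : Marks}
    (n1 : γ1 ≠ c) (n2 : γ2 ≠ c)
    (h1 : ∀ d ∈ K.2.1, 0 ≤ d + s1 ∧ d + s1 < γ1.len a b) (h2 : ∀ d ∈ K.2.2, 0 ≤ d + s2 ∧ d + s2 < γ2.len a b)
    (e1 : ∀ y, I false y ↔ B γ1 (y - s1)) (e2 : ∀ y, I true y ↔ B γ2 (y - s2)) :
    JR.enc K I = fun x => wd K γ1 γ2 s1 s2 (β x) (k x) := by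
  funext x
  have q1 : (∃ d ∈ K.2.1, I false (x - d)) ↔ ∃ d ∈ K.2.1, β x = γ1 ∧ (k x : ℤ) = d + s1 := by
    refine exists_congr fun d => and_congr_right fun hd => ?_
    rw [e1, sub_sub, L.iff x γ1 (d + s1) n1 (h1 d hd).1 (h1 d hd).2]
  have q2 : (∃ d ∈ K.2.2, I true (x - d)) ↔ ∃ d ∈ K.2.2, β x = γ2 ∧ (k x : ℤ) = d + s2 := by
    refine exists_congr fun d => and_congr_right fun hd => ?_
    rw [e2, sub_sub, L.iff x γ2 (d + s2) n2 (h2 d hd).1 (h2 d hd).2]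
  unfold JR.enc wd
  simp only [q1, q2]

theorem real_of_table {i j : ℤ} {K K' : Kind} (l : List Tab) (ha : 0 < a) (hb : 0 < b)
    (h1 : (∀ d ∈ K.2.1, 0 ≤ d + i ∧ d + i < (a : ℤ)) ∧ (∀ d ∈ K.2.2, 0 ≤ d + i ∧ d + i < (b : ℤ)))
    (h2 : (∀ d ∈ K'.2.1, 0 ≤ d + (j + a) ∧ d + (j + a) < (a : ℤ)) ∧
      (∀ d ∈ K'.2.2, 0 ≤ d + (j + b) ∧ d + (j + b) < (b : ℤ)))
    (h : lk a b (wd K' us ul (j + a) (j + b)) (wd K ds dl i i) l = true) : Real a b i j K K' l.length := by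
  intro B hB hc
  obtain ⟨β, k, L⟩ := exists_loc ha hb hB hc
  rw [L.enc (γ1 := ds) (γ2 := dl) (s1 := i) (s2 := i) (by simp) (by simp) h1.1 h1.2
    (fun y => Iff.rfl) (fun y => Iff.rfl),
    L.enc (γ1 := us) (γ2 := ul) (s1 := j + a) (s2 := j + b) (by simp) (by simp) h2.1 h2.2
    (fun y => by simp only [mkJ, sub_sub]) (fun y => by simp only [mkJ, sub_sub])]
  exact L.chain l h

end

def K1 : Kind := (1, [1, 2], [1, 2, 3])
def K0 : Kind := (0, [-1, 0], [-2, -1, 0])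

theorem real1 : Real 5 8 1 (-3) K1 K0 4 :=
  real_of_table (a := 5) (b := 8) tb1 (by decide) (by decide) (by decide +kernel) (by decide +kernel)
    (by decide +kernel)
theorem real2 : Real 8 13 6 (-8) K0 K1 10 :=
  real_of_table (a := 8) (b := 13) tb2 (by decide) (by decide) (by decide +kernel) (by decide +kernel)
    (by decide +kernel)
theorem real3 : Real 13 21 7 (-8) K1 K0 13 :=
  real_of_table (a := 13) (b := 21) tb3 (by decide) (by decide) (by decide +kernel) (by decide +kernel)
    (by decide +kernel)

theorem levels (n : ℕ) : ∃ (a b i0 j0 i1 j1 i2 j2 : ℤ) (K K' : Kind) (h0 h1 h2 : ℕ), 0 < a ∧ 0 < b ∧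
    n + 1 ≤ h0 ∧ n + 2 ≤ h1 ∧ n + 3 ≤ h2 ∧ Real a b i0 j0 K K' h0 ∧ Real b (a + b) i1 j1 K' K h1 ∧
    Real (a + b) (a + 2 * b) i2 j2 K K' h2 := by
  induction n with
  | zero => exact ⟨5, 8, _, _, _, _, _, _, K1, K0, 4, 10, 13, by norm_num, by norm_num, by norm_num, by norm_num,
      by norm_num, real1, real2, real3⟩
  | succ n ih =>
    obtain ⟨a, b, i0, j0, i1, j1, i2, j2, K, K', h0, h1, h2, ha, hb, g0, g1, g2, r0, r1, r2⟩ := ih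
    have r3 := r0.step ha hb r1
    refine ⟨b, a + b, i1, j1, i2, j2, i1, 2 * j1 + j0 - i0 - i1, K', K, h1, h2, h1 + h0 + h1, hb, by omega, g1, g2, by omega, r1, ?_, ?_⟩
    · rwa [show b + (a + b) = a + 2 * b by ring]
    · rwa [show b + (a + b) = a + 2 * b by ring, show b + 2 * (a + b) = 2 * a + 3 * b by ring]

theorem const_row {a b : ℤ} (ha : 0 < a) : Row a b (fun β x => β = us ∧ a ∣ x) := by
  refine ⟨?_, ?_, ?_, ⟨us, 0, rfl, dvd_zero a⟩⟩
  · rintro β x ⟨rfl, h⟩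
    exact ⟨us, rfl, dvd_add h dvd_rfl⟩
  · rintro β x ⟨rfl, h⟩
    exact ⟨us, rfl, dvd_sub h dvd_rfl⟩
  · rintro β x β' y ⟨rfl, h, rfl⟩ ⟨rfl, h', rfl⟩
    simp only [Blk.len]
    rcases lt_trichotomy h h' with e | e | e
    · right; left; nlinarith
    · left; simp [e]
    · right; right; nlinarith

theorem long_chain (n : ℕ) : ∃ h, n ≤ h ∧ ∃ W V, Chain h W V := by
  obtain ⟨a, b, i0, j0, i1, j1, i2, j2, K, K', h0, h1, h2, ha, hb, g0, g1, g2, r0, r1, r2⟩ := levels n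
  exact ⟨h0, by omega, _, _, r0 _ (const_row ha) (fun x h => by simp at h)⟩

theorem Chain.rows {h : ℕ} {W V : ℤ → ℕ} (H : Chain h W V) : ∃ r : ℕ → ℤ → WangTile,
    (∀ y x, r y x ∈ tiles) ∧ (∀ y < h, ∀ x, (r y x).east = (r y (x + 1)).west) ∧
    (∀ y, y + 1 < h → ∀ x, (r y x).north = (r (y + 1) x).south) ∧
    (∀ y, y + 1 = h → ∀ x, (r y x).north = V x) := by
  induction H with
  | zero W => exact ⟨fun _ _ => (2,1,2,4), fun _ _ => by simp [tiles], by omega, by omega, by omega⟩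
  | @succ n W V V' _ hr ih =>
    obtain ⟨r, p1, p2, p3, p4⟩ := ih
    obtain ⟨s, hs⟩ := hr
    refine ⟨fun y => if y = n then s else r y, ?_, ?_, ?_, ?_⟩
    · intro y x
      by_cases e : y = n
      · simp only [e, if_true]; exact (hs x).1
      · simp only [e, if_false]; exact p1 y x
    · intro y hy x
      by_cases e : y = n
      · simp only [e, if_true]; exact (hs x).2.1
      · simp only [e, if_false]; exact p2 y (by omega) x
    · intro y hy x
      have e : y ≠ n := by omega
      by_cases e' : y + 1 = n
      · simp only [e, e', if_false, if_true]
        rw [p4 y e' x]; exact (hs x).2.2.1.symm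
      · simp only [e, e', if_false]; exact p3 y (by omega) x
    · intro y hy x
      have e : y = n := by omega
      simp only [e, if_true]; exact (hs x).2.2.2

theorem boxes (n : ℕ) : ∃ f : ℤ × ℤ → WangTile, (∀ p, f p ∈ tiles) ∧ ∀ x y : ℤ, -(n : ℤ) ≤ y → y < n →
    (f (x, y)).east = (f (x + 1, y)).west ∧ (f (x, y)).north = (f (x, y + 1)).south := by
  obtain ⟨h, hh, W, V, H⟩ := long_chain (2 * n + 2)
  obtain ⟨r, p1, p2, p3, -⟩ := H.rows
  refine ⟨fun p => r (p.2 + n).toNat p.1, fun p => p1 _ _, fun x y h1 h2 => ⟨?_, ?_⟩⟩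
  · exact p2 _ (by omega) x
  · have := p3 (y + n).toNat (by omega) x
    simp only
    rw [this, show (y + 1 + n).toNat = (y + n).toNat + 1 by omega]

theorem exists_tiling : ∃ f : ℤ × ℤ → WangTile, (∀ p, f p ∈ tiles) ∧ WangMatch f := by
  choose F hF hM using boxes
  have key : ∀ p, ∃ t ∈ tiles, ∀ᶠ n in (Filter.hyperfilter ℕ : Filter ℕ), F n p = t := by
    intro p
    have h : ∀ᶠ n in (Filter.hyperfilter ℕ : Filter ℕ), ∃ t ∈ {t | t ∈ tiles}, F n p = t :=
      Filter.Eventually.of_forall fun n => ⟨_, hF n p, rfl⟩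
    rw [Ultrafilter.eventually_exists_mem_iff (List.finite_toSet tiles)] at h
    exact h
  choose f hf hfe using key
  have big : ∀ m : ℕ, ∀ᶠ n in (Filter.hyperfilter ℕ : Filter ℕ), m ≤ n := fun m =>
    (Filter.eventually_ge_atTop m).filter_mono Nat.hyperfilter_le_atTop
  refine ⟨f, hf, fun x y => ?_⟩
  obtain ⟨n, ⟨⟨h1, h2⟩, h3⟩, h4⟩ :=
    ((((hfe (x, y)).and (hfe (x + 1, y))).and (hfe (x, y + 1))).and (big (y.natAbs + 1))).exists
  rw [← h1, ← h2, ← h3]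
  exact hM n x y (by omega) (by omega)

end JR

/-- **Jeandel–Rao.** There exists an aperiodic Wang tile set consisting of exactly 11 tiles. -/
theorem exists_aperiodic_wang_tile_set_card_eleven :
    ∃ S : Finset WangTile, S.card = 11 ∧ WangAperiodic S := by
  refine ⟨JR.tiles.toFinset, by decide, ?_, ?_⟩
  · obtain ⟨f, h1, h2⟩ := JR.exists_tiling
    exact ⟨f, fun p => List.mem_toFinset.2 (h1 p), h2⟩
  · rintro f ⟨h1, h2⟩
    exact JR.not_periodic (fun q => List.mem_toFinset.1 (h1 q)) h2
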